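/- Assume (H1). Let ε > 0 and let δ, γ, ρ > 0 be such that P_n(Ω_ε) ≥ 1 − ε for n large enough, where Ω_ε = Ω_n^{2/5,δ,γ,ρ}. Then there exist a > 0, β > 0 and c > 0 such that, for n large enough, for all s, t ∈ [0,1], E_{P_n}( ‖G^{(n)}(s) − G^{(n)}(t)‖_1^β · 1_{Ω_ε} ) ≤ c |t − s|^{1+a}, where ‖x‖_1 = ∑_{(k,j)∈I_K} |x_{k,j}|. -/

import Mathlib

open scoped Classical
open Filter
noncomputable section

/-- A planar tree: a finite set of words on `{1,2,...}` containing the root `[]`,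
closed under taking fathers and elder brothers. -/
def IsPlanarTree (T : Finset (List ℕ)) : Prop :=
  [] ∈ T ∧ ∀ (u : List ℕ) (i : ℕ), u ++ [i] ∈ T →
    1 ≤ i ∧ u ∈ T ∧ ∀ j, 1 ≤ j → j ≤ i → u ++ [j] ∈ T

/-- The type of planar trees. -/
def PlanarTree := {T : Finset (List ℕ) // IsPlanarTree T}

/-- Number of children of the vertex `u` in `T`. -/
def numChildren (T : Finset (List ℕ)) (u : List ℕ) : ℕ :=
  (T.filter fun v => ∃ i, v = u ++ [i]).card

/-- Galton-Watson weight of a tree: product over the vertices of `μ (number of children)`. -/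
def gwWeight (μ : ℕ → ℝ) (T : Finset (List ℕ)) : ℝ :=
  ∏ u ∈ T, μ (numChildren T u)

/-- Probability of a set of planar trees under the Galton-Watson measure. -/
def gwProb (μ : ℕ → ℝ) (S : Set PlanarTree) : ℝ :=
  ∑' T : S, gwWeight μ (T : PlanarTree).val

/-- `P(|T| = n)` : probability that the total progeny has `n` vertices. -/
def treeSizeProb (μ : ℕ → ℝ) (n : ℕ) : ℝ :=
  gwProb μ {T | T.val.card = n}

/-- Hypothesis (H1): `μ` is a probability distribution on ℕ, non-degenerate
(`μ 0 + μ 1 ≠ 1`), critical (mean 1), with support bounded by `K > 0`. -/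
def H1 (μ : ℕ → ℝ) (K : ℕ) : Prop :=
  (∀ k, 0 ≤ μ k) ∧ HasSum μ 1 ∧ μ 0 + μ 1 ≠ 1 ∧
    HasSum (fun k : ℕ => (k : ℝ) * μ k) 1 ∧ 0 < K ∧ ∀ k, K < k → μ k = 0

/-- Law of the random walk `W` started at 0 with i.i.d. increments distributed as
`ξ - 1`, `ξ ∼ μ` : `walkProb μ n x = P(W_n = x)`. -/
def walkProb (μ : ℕ → ℝ) : ℕ → ℤ → ℝ
  | 0, x => if x = 0 then 1 else 0
  | n + 1, x => ∑' k : ℕ, μ k * walkProb μ n (x - ((k : ℤ) - 1))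

/-- `P_n(S) = P(S | |𝐓| = n+1)` : the Galton-Watson measure conditioned to have `n`
edges (`n+1` vertices). -/
def condProb (μ : ℕ → ℝ) (n : ℕ) (S : Set PlanarTree) : ℝ :=
  gwProb μ (S ∩ {T | T.val.card = n + 1}) / treeSizeProb μ (n + 1)

/-- `u(k)`, the `(k+1)`-st vertex of `T` in the lexicographical (depth-first) order
(`[]`-junk value if `k` exceeds the number of vertices). -/
def vertexAt (T : PlanarTree) (k : ℕ) : List ℕ :=
  (T.val.sort (· ≤ ·)).getD k []

/-- The index set `I_K = {(k,j) : 1 ≤ j ≤ k ≤ K}` as a finset of `ℕ × ℕ`. -/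
def IKfin (K : ℕ) : Finset (ℕ × ℕ) :=
  (Finset.range (K + 1) ×ˢ Finset.range (K + 1)).filter fun p => 1 ≤ p.2 ∧ p.2 ≤ p.1

/-- The index set `I_K` as a (finite) type. -/
def IK (K : ℕ) := {p : ℕ × ℕ // p ∈ IKfin K}

instance (K : ℕ) : Fintype (IK K) := by unfold IK; infer_instance
instance (K : ℕ) : DecidableEq (IK K) := by unfold IK; infer_instance

/-- `A_{u,k,j}(T)`: the number of strict ancestors `v` of `u` having `k` children
and such that `u` is a descendant of `v·j`, the `j`-th child of `v`. -/
def Acount (T : PlanarTree) (u : List ℕ) (k j : ℕ) : ℕ :=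
  (T.val.filter fun v => (v ++ [j]) <+: u ∧ numChildren T.val v = k).card

/-- `A_{u,l,k,j}(T)`: the number of strict ancestors `v` of `u` at distance at most
`l` from `u`, having `k` children and such that `u` is a descendant of `v·j`. -/
def AcountLe (T : PlanarTree) (u : List ℕ) (l k j : ℕ) : ℕ :=
  (T.val.filter fun v =>
    (v ++ [j]) <+: u ∧ u.length - v.length ≤ l ∧ numChildren T.val v = k).card

/-- The linearly interpolated height process of `T`, at time `x ≥ 0`:
`H(k) = |u(k)|` at integer times. -/
def heightInterp (T : PlanarTree) (x : ℝ) : ℝ :=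
  ((vertexAt T ⌊x⌋₊).length : ℝ) +
    (x - ⌊x⌋₊) * (((vertexAt T (⌊x⌋₊ + 1)).length : ℝ) - ((vertexAt T ⌊x⌋₊).length : ℝ))

/-- The rescaled height process `h_n(s) = H(ns)/√n`. -/
def hn (T : PlanarTree) (n : ℕ) (s : ℝ) : ℝ := heightInterp T ((n : ℝ) * s) / Real.sqrt n

/-- The set `Ω_n^{α,δ,γ,ρ}` of trees with `n` edges such that: the rescaled height
process is `(δ, α)`-Hölder on `[0,1]`; the height increments along the depth-first
order are at most `ρ log n`; the depth of the last vertex `u(n)` is `< ρ log n`;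
and all the truncated lineage counts `A_{u,l,k,j}` deviate from `μ_k l` by at most
`γ √(l log n)`. -/
def Omega (μ : ℕ → ℝ) (K n : ℕ) (α δ γ ρ : ℝ) : Set PlanarTree :=
  {T | (∀ s ∈ Set.Icc (0 : ℝ) 1, ∀ t ∈ Set.Icc (0 : ℝ) 1,
          |hn T n s - hn T n t| ≤ δ * |t - s| ^ α) ∧
       (∀ l < n, |((vertexAt T (l + 1)).length : ℝ) - ((vertexAt T l).length : ℝ)| ≤
          ρ * Real.log n) ∧
       ((vertexAt T n).length : ℝ) < ρ * Real.log n ∧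
       (∀ p : IK K, ∀ u ∈ T.val, ∀ l : ℕ, 0 < l → l ≤ u.length →
          |(AcountLe T u l p.val.1 p.val.2 : ℝ) - μ p.val.1 * (l : ℝ)| ≤
            γ * Real.sqrt ((l : ℝ) * Real.log n))}

/-- Expectation of `f` under `P_n`. -/
def condExpect (μ : ℕ → ℝ) (n : ℕ) (f : PlanarTree → ℝ) : ℝ :=
  (∑' T : {T : PlanarTree // T.val.card = n + 1}, gwWeight μ T.val.val * f T.val) /
    treeSizeProb μ (n + 1)

/-- `g^{(n)}_{k,j}(l) = A_{u(l),k,j} - μ_k |u(l)|`. -/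
def gfun (μ : ℕ → ℝ) (T : PlanarTree) (k j l : ℕ) : ℝ :=
  (Acount T (vertexAt T l) k j : ℝ) - μ k * ((vertexAt T l).length : ℝ)

/-- The interpolated, normalized lineage process
`G^{(n)}_{k,j}(s) = n^{-1/4}(g(⌊ns⌋) + {ns}(g(⌊ns⌋+1) - g(⌊ns⌋)))`. -/
def Gn (μ : ℕ → ℝ) (T : PlanarTree) (n k j : ℕ) (s : ℝ) : ℝ :=
  (gfun μ T k j ⌊(n : ℝ) * s⌋₊ +
      ((n : ℝ) * s - ⌊(n : ℝ) * s⌋₊) *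
        (gfun μ T k j (⌊(n : ℝ) * s⌋₊ + 1) - gfun μ T k j ⌊(n : ℝ) * s⌋₊)) /
    (n : ℝ) ^ ((1 : ℝ) / 4)

/-- Number of trees of the forest encoded by a binary tree (left child: the forest of
subtrees of the first root; right child: the remaining trees). -/
def rootCount : BinaryTree Unit → ℕ
  | .nil => 0
  | .node _ _ r => rootCount r + 1

/-- The vertices of a forest in depth-first order, the roots being labelled `i, i + 1, ...`. -/
def words : BinaryTree Unit → ℕ → List (List ℕ)
  | .nil, _ => []
  | .node _ c r, i => [i] :: ((words c 1).map (List.cons i) ++ words r (i + 1))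

/-- The lineages of the vertices of a forest in depth-first order: the pairs
(number of children, index of the next vertex) along the path from the root.  The roots are
children of a common vertex with `k` children. -/
def lineages : BinaryTree Unit → ℕ → ℕ → List (List (ℕ × ℕ))
  | .nil, _, _ => []
  | .node _ c r, k, i =>
    [(k, i)] :: ((lineages c (rootCount c) 1).map (List.cons (k, i)) ++ lineages r k (i + 1))

/-- Product of the weights of the vertices of a forest. -/
def forestWeight (μ : ℕ → ℝ) : BinaryTree Unit → ℝ
  | .nil => 1
  | .node _ c r => μ (rootCount c) * forestWeight μ c * forestWeight μ r

lemma words_eq_map_lineages (c : BinaryTree Unit) (k i : ℕ) :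
    words c i = (lineages c k i).map (List.map Prod.snd) := by
  induction c generalizing k i with
  | nil => rfl
  | node _ c r ihc ihr =>
    simp [words, lineages, ihc (rootCount c) 1, ihr k (i + 1), Function.comp_def]

lemma length_words (c : BinaryTree Unit) (i : ℕ) : (words c i).length = c.numNodes := by
  induction c generalizing i with
  | nil => rfl
  | node _ c r ihc ihr => simp [words, BinaryTree.numNodes, ihc, ihr]

lemma length_lineages (c : BinaryTree Unit) (k i : ℕ) :
    (lineages c k i).length = c.numNodes := by
  rw [← length_words c i, words_eq_map_lineages c k i, List.length_map]

lemma exists_eq_cons_of_mem_words {c : BinaryTree Unit} {i : ℕ} {w : List ℕ}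
    (h : w ∈ words c i) : ∃ j v, w = j :: v ∧ i ≤ j := by
  induction c generalizing i w with
  | nil => simp [words] at h
  | node _ c r ihc ihr =>
    simp only [words, List.mem_cons, List.mem_append, List.mem_map] at h
    rcases h with rfl | ⟨v, hv, rfl⟩ | h
    · exact ⟨i, [], rfl, le_rfl⟩
    · exact ⟨i, v, rfl, le_rfl⟩
    · obtain ⟨j, v, rfl, hj⟩ := ihr h
      exact ⟨j, v, rfl, by omega⟩

lemma not_nil_mem_words (c : BinaryTree Unit) (i : ℕ) : [] ∉ words c i := by
  intro h
  obtain ⟨j, v, h, -⟩ := exists_eq_cons_of_mem_words h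
  simp at h

lemma pairwise_words (c : BinaryTree Unit) (i : ℕ) : (words c i).Pairwise (· < ·) := by
  induction c generalizing i with
  | nil => simp [words]
  | node _ c r ihc ihr =>
    simp only [words, List.pairwise_cons, List.pairwise_append, List.pairwise_map]
    refine ⟨?_, ?_, ihr _, ?_⟩
    · intro w hw
      simp only [List.mem_append, List.mem_map] at hw
      rcases hw with ⟨v, hv, rfl⟩ | hw
      · obtain ⟨j, v, rfl, -⟩ := exists_eq_cons_of_mem_words hv
        exact List.Lex.cons List.Lex.nil
      · obtain ⟨j, v, rfl, hj⟩ := exists_eq_cons_of_mem_words hw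
        exact List.Lex.rel (by omega)
    · exact (ihc 1).imp fun h => List.Lex.cons h
    · intro w hw v hv
      obtain ⟨w, -, rfl⟩ := List.mem_map.1 hw
      obtain ⟨j, v, rfl, hj⟩ := exists_eq_cons_of_mem_words hv
      exact List.Lex.rel (by omega)

lemma cons_mem_words_node_self (a : Unit) (c r : BinaryTree Unit) (i : ℕ) (v : List ℕ) :
    i :: v ∈ words (.node a c r) i ↔ v = [] ∨ v ∈ words c 1 := by
  have : i :: v ∉ words r (i + 1) := fun h => by
    obtain ⟨j, w, h, hj⟩ := exists_eq_cons_of_mem_words h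
    simp at h; omega
  simp [words, this]

lemma cons_mem_words_node_of_ne (a : Unit) (c r : BinaryTree Unit) {i j : ℕ} (h : j ≠ i) (v : List ℕ) :
    j :: v ∈ words (.node a c r) i ↔ j :: v ∈ words r (i + 1) := by
  simp [words, h, h.symm]

lemma singleton_mem_words (c : BinaryTree Unit) (i j : ℕ) :
    [j] ∈ words c i ↔ i ≤ j ∧ j < i + rootCount c := by
  induction c generalizing i with
  | nil => simp [words, rootCount]
  | node _ c r ihc ihr =>
    rcases eq_or_ne j i with rfl | h
    · simp [cons_mem_words_node_self, rootCount]
    · rw [cons_mem_words_node_of_ne _ c r h, ihr]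
      simp only [rootCount]; omega

lemma append_singleton_mem_words {c : BinaryTree Unit} {i : ℕ} {u : List ℕ} (hu : u ≠ []) {j : ℕ}
    (h : u ++ [j] ∈ words c i) :
    1 ≤ j ∧ u ∈ words c i ∧ ∀ j', 1 ≤ j' → j' ≤ j → u ++ [j'] ∈ words c i := by
  induction c generalizing i u with
  | nil => simp [words] at h
  | node _ c r ihc ihr =>
    obtain ⟨m, u, rfl⟩ := List.exists_cons_of_ne_nil hu
    simp only [List.cons_append] at h ⊢
    rcases eq_or_ne m i with rfl | hm
    · simp only [cons_mem_words_node_self] at h ⊢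
      have h : u ++ [j] ∈ words c 1 := by simpa using h
      rcases eq_or_ne u [] with rfl | hu'
      · simp only [List.nil_append, singleton_mem_words] at h ⊢
        exact ⟨h.1, by simp, fun j' h1 h2 => Or.inr ⟨h1, by omega⟩⟩
      · obtain ⟨h1, h2, h3⟩ := ihc hu' h
        exact ⟨h1, Or.inr h2, fun j' h4 h5 => Or.inr (h3 j' h4 h5)⟩
    · simp only [cons_mem_words_node_of_ne _ c r hm] at h ⊢
      exact ihr (by simp) h

/-- The vertices of the planar tree whose root has the forest `c` above it. -/
def treeWords (c : BinaryTree Unit) : List (List ℕ) := [] :: words c 1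

lemma pairwise_treeWords (c : BinaryTree Unit) : (treeWords c).Pairwise (· < ·) := by
  refine List.pairwise_cons.2 ⟨fun w hw => ?_, pairwise_words c 1⟩
  obtain ⟨j, v, rfl, -⟩ := exists_eq_cons_of_mem_words hw
  exact List.Lex.nil

lemma nodup_treeWords (c : BinaryTree Unit) : (treeWords c).Nodup :=
  (pairwise_treeWords c).imp fun h => ne_of_lt h

/-- The planar tree whose root has the forest `c` above it. -/
def toPlanarTree (c : BinaryTree Unit) : PlanarTree :=
  ⟨(treeWords c).toFinset, by
    refine ⟨by simp [treeWords], fun u i h => ?_⟩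
    have h : u ++ [i] ∈ words c 1 := by simpa [treeWords] using h
    rcases eq_or_ne u [] with rfl | hu
    · simp only [List.nil_append, singleton_mem_words] at h
      exact ⟨h.1, by simp [treeWords], fun j h1 h2 => by
        simp only [treeWords, List.nil_append, List.mem_toFinset, List.mem_cons,
          singleton_mem_words]; right; omega⟩
    · obtain ⟨h1, h2, h3⟩ := append_singleton_mem_words hu h
      exact ⟨h1, by simp [treeWords, h2], fun j h4 h5 => by
        simp [treeWords, h3 j h4 h5]⟩⟩

lemma toPlanarTree_val (c : BinaryTree Unit) :
    (toPlanarTree c).val = (treeWords c).toFinset := rfl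

lemma sort_toPlanarTree (c : BinaryTree Unit) :
    (toPlanarTree c).val.sort (· ≤ ·) = treeWords c := by
  rw [toPlanarTree_val, List.toFinset_sort _ (nodup_treeWords c)]
  exact (pairwise_treeWords c).imp fun h => le_of_lt h

lemma card_toPlanarTree (c : BinaryTree Unit) :
    (toPlanarTree c).val.card = c.numNodes + 1 := by
  rw [toPlanarTree_val, List.toFinset_card_of_nodup (nodup_treeWords c), treeWords,
    List.length_cons, length_words]

lemma words_injective (i : ℕ) : Function.Injective fun c => words c i := by
  intro c
  induction c generalizing i with
  | nil =>
    rintro (_ | ⟨_, c', r'⟩) h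
    · rfl
    · simp [words] at h
  | node _ c r ihc ihr =>
    rintro (_ | ⟨_, c', r'⟩) h
    · simp [words] at h
    · have key : ∀ (c r : BinaryTree Unit),
          ((words c 1).map (List.cons i) ++ words r (i + 1)).filter (fun w => w.head? = some i) =
            (words c 1).map (List.cons i) ∧
          ((words c 1).map (List.cons i) ++ words r (i + 1)).filter (fun w => w.head? ≠ some i) =
            words r (i + 1) := by
        intro c r
        have h1 : ∀ w ∈ words r (i + 1), w.head? ≠ some i := by
          intro w hw
          obtain ⟨j, v, rfl, hj⟩ := exists_eq_cons_of_mem_words hw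
          simp only [List.head?_cons, ne_eq, Option.some.injEq]; omega
        constructor
        · rw [List.filter_append, List.filter_eq_self.2 (by simp),
            List.filter_eq_nil_iff.2 (by simpa using h1), List.append_nil]
        · rw [List.filter_append, List.filter_eq_nil_iff.2 (by simp),
            List.filter_eq_self.2 (by simpa using h1), List.nil_append]
      simp only [words, List.cons.injEq, true_and] at h
      have e1 : (words c 1).map (List.cons i) = (words c' 1).map (List.cons i) := by
        rw [← (key c r).1, ← (key c' r').1, h]
      have e2 : words r (i + 1) = words r' (i + 1) := by
        rw [← (key c r).2, ← (key c' r').2, h]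
      rw [ihc 1 (List.map_injective_iff.2 (List.cons_injective) e1), ihr (i + 1) e2]

lemma toPlanarTree_injective : Function.Injective toPlanarTree := by
  intro c c' h
  have := sort_toPlanarTree c
  rw [h, sort_toPlanarTree c'] at this
  simp only [treeWords, List.cons.injEq, true_and] at this
  exact words_injective 1 this.symm

/-- A set of nonempty words closed under taking fathers and elder brothers, the labels of the
roots starting at `i`. -/
def IsForestSet (i : ℕ) (S : Finset (List ℕ)) : Prop :=
  [] ∉ S ∧ (∀ j, [j] ∈ S → i ≤ j ∧ ∀ j', i ≤ j' → j' ≤ j → [j'] ∈ S) ∧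
    ∀ u j, u ≠ [] → u ++ [j] ∈ S → 1 ≤ j ∧ u ∈ S ∧ ∀ j', 1 ≤ j' → j' ≤ j → u ++ [j'] ∈ S

lemma IsForestSet.singleton_mem {i : ℕ} {S : Finset (List ℕ)} (h : IsForestSet i S) (j : ℕ)
    (v : List ℕ) (hv : j :: v ∈ S) : [j] ∈ S := by
  induction v using List.reverseRecOn with
  | nil => exact hv
  | append_singleton v m ih => exact ih (h.2.2 (j :: v) m (by simp) hv).2.1

lemma exists_words_toFinset_eq (n : ℕ) : ∀ (i : ℕ) (S : Finset (List ℕ)), S.card ≤ n →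
    IsForestSet i S → ∃ c, (words c i).toFinset = S := by
  induction n with
  | zero =>
    intro i S hS _
    exact ⟨.nil, by simpa [words, eq_comm] using hS⟩
  | succ n ih =>
    intro i S hS h
    rcases S.eq_empty_or_nonempty with rfl | ⟨w, hw⟩
    · exact ⟨.nil, rfl⟩
    have hi : [i] ∈ S := by
      rcases w with _ | ⟨j, v⟩
      · exact absurd hw h.1
      · have := h.2.1 j (h.singleton_mem j v hw)
        exact this.2 i le_rfl this.1
    have hlt : (S.erase [i]).card ≤ n := by
      rw [Finset.card_erase_of_mem hi]; omega
    set S₁ : Finset (List ℕ) := ((S.filter fun w => w.head? = some i).image List.tail).erase [] with hS₁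
    set S₂ : Finset (List ℕ) := S.filter fun w => w.head? ≠ some i with hS₂
    have mem₁ : ∀ v, v ∈ S₁ ↔ v ≠ [] ∧ i :: v ∈ S := by
      intro v
      simp only [hS₁, Finset.mem_erase, Finset.mem_image, Finset.mem_filter]
      constructor
      · rintro ⟨h1, w, ⟨h2, h3⟩, rfl⟩
        rcases w with _ | ⟨j, w⟩
        · simp at h3
        · simp only [List.head?_cons, Option.some.injEq] at h3
          subst h3
          exact ⟨h1, h2⟩
      · rintro ⟨h1, h2⟩
        exact ⟨h1, i :: v, ⟨h2, rfl⟩, rfl⟩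
    have mem₂ : ∀ v, v ∈ S₂ ↔ v ∈ S ∧ v.head? ≠ some i := by
      intro v; simp [hS₂]
    have c₁ : S₁.card ≤ n := by
      refine le_trans ?_ hlt
      refine Finset.card_le_card_of_injOn (List.cons i) ?_ (List.cons_injective.injOn)
      intro v hv
      have := (mem₁ v).1 hv
      simp [this.1, this.2]
    have c₂ : S₂.card ≤ n := by
      refine le_trans (Finset.card_le_card ?_) hlt
      intro v hv
      have := (mem₂ v).1 hv
      rw [Finset.mem_erase]
      refine ⟨?_, this.1⟩
      rintro rfl
      exact this.2 rfl
    have f₁ : IsForestSet 1 S₁ := by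
      refine ⟨by simp [mem₁], fun j hj => ?_, fun u j hu hj => ?_⟩
      · have := h.2.2 [i] j (by simp) ((mem₁ _).1 hj).2
        exact ⟨this.1, fun j' h1 h2 => (mem₁ _).2 ⟨by simp, this.2.2 j' h1 h2⟩⟩
      · have := h.2.2 (i :: u) j (by simp) ((mem₁ _).1 hj).2
        exact ⟨this.1, (mem₁ _).2 ⟨hu, this.2.1⟩,
          fun j' h1 h2 => (mem₁ _).2 ⟨by simp, this.2.2 j' h1 h2⟩⟩
    have f₂ : IsForestSet (i + 1) S₂ := by
      refine ⟨fun h0 => h.1 ((mem₂ _).1 h0).1, fun j hj => ?_, fun u j hu hj => ?_⟩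
      · have h1 := (mem₂ _).1 hj
        have h2 := h.2.1 j h1.1
        have h3 : j ≠ i := by simpa using h1.2
        exact ⟨by omega, fun j' h4 h5 => (mem₂ _).2 ⟨h2.2 j' (by omega) h5, by
          simp only [List.head?_cons, ne_eq, Option.some.injEq]; omega⟩⟩
      · have h1 := (mem₂ _).1 hj
        have h2 := h.2.2 u j hu h1.1
        obtain ⟨m, u, rfl⟩ := List.exists_cons_of_ne_nil hu
        have h3 : m ≠ i := by simpa using h1.2
        exact ⟨h2.1, (mem₂ _).2 ⟨h2.2.1, by simpa⟩,
          fun j' h4 h5 => (mem₂ _).2 ⟨h2.2.2 j' h4 h5, by simpa⟩⟩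
    obtain ⟨c, hc⟩ := ih 1 S₁ c₁ f₁
    obtain ⟨r, hr⟩ := ih (i + 1) S₂ c₂ f₂
    refine ⟨.node () c r, ?_⟩
    ext w
    rw [List.mem_toFinset]
    rcases w with _ | ⟨j, v⟩
    · simp [not_nil_mem_words, h.1]
    · rcases eq_or_ne j i with rfl | hj
      · rw [cons_mem_words_node_self, ← List.mem_toFinset (l := words c 1), hc, mem₁]
        rcases eq_or_ne v [] with rfl | hv
        · simp [hi]
        · simp [hv]
      · rw [cons_mem_words_node_of_ne _ c r hj, ← List.mem_toFinset, hr, mem₂]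
        simp [hj]

lemma toPlanarTree_surjective : Function.Surjective toPlanarTree := by
  rintro ⟨T, hT⟩
  have hf : IsForestSet 1 (T.erase []) := by
    refine ⟨by simp, fun j hj => ?_, fun u j hu hj => ?_⟩
    · have := hT.2 [] j (by simpa using hj)
      exact ⟨this.1, fun j' h1 h2 => by simpa using this.2.2 j' h1 h2⟩
    · have := hT.2 u j (by simpa using hj)
      exact ⟨this.1, by simp [hu, this.2.1], fun j' h1 h2 => by
        simpa using this.2.2 j' h1 h2⟩
  obtain ⟨c, hc⟩ := exists_words_toFinset_eq _ 1 _ le_rfl hf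
  refine ⟨c, Subtype.ext ?_⟩
  rw [toPlanarTree_val, treeWords, List.toFinset_cons, hc, Finset.insert_erase hT.1]

lemma numChildren_words_nil (c : BinaryTree Unit) (i : ℕ) :
    numChildren (words c i).toFinset [] = rootCount c := by
  have : (words c i).toFinset.filter (fun v => ∃ j, v = [] ++ [j]) =
      (Finset.Ico i (i + rootCount c)).image (fun j => [j]) := by
    ext v
    simp only [List.nil_append, Finset.mem_filter, List.mem_toFinset, Finset.mem_image,
      Finset.mem_Ico]
    constructor
    · rintro ⟨h, j, rfl⟩
      exact ⟨j, (singleton_mem_words c i j).1 h, rfl⟩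
    · rintro ⟨j, h, rfl⟩
      exact ⟨(singleton_mem_words c i j).2 h, j, rfl⟩
  rw [numChildren, this, Finset.card_image_of_injective _ (fun a b h => by simpa using h)]
  simp

lemma numChildren_treeWords (c : BinaryTree Unit) (u : List ℕ) :
    numChildren (treeWords c).toFinset u = numChildren (words c 1).toFinset u := by
  have : (treeWords c).toFinset.filter (fun v => ∃ j, v = u ++ [j]) =
      (words c 1).toFinset.filter (fun v => ∃ j, v = u ++ [j]) := by
    ext v
    simp only [treeWords, Finset.mem_filter, List.mem_toFinset, List.mem_cons]
    constructor
    · rintro ⟨h | h, j, rfl⟩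
      · simp at h
      · exact ⟨h, j, rfl⟩
    · rintro ⟨h, j, rfl⟩
      exact ⟨Or.inr h, j, rfl⟩
  rw [numChildren, this, numChildren]

lemma numChildren_words_node_self (a : Unit) (c r : BinaryTree Unit) (i : ℕ) (u : List ℕ) :
    numChildren (words (.node a c r) i).toFinset (i :: u) = numChildren (words c 1).toFinset u := by
  have : (words (.node a c r) i).toFinset.filter (fun v => ∃ j, v = (i :: u) ++ [j]) =
      ((words c 1).toFinset.filter (fun v => ∃ j, v = u ++ [j])).image (List.cons i) := by
    ext v
    simp only [Finset.mem_filter, List.mem_toFinset, Finset.mem_image]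
    constructor
    · rintro ⟨h, j, rfl⟩
      rw [List.cons_append, cons_mem_words_node_self] at h
      exact ⟨u ++ [j], ⟨by simpa using h, j, rfl⟩, rfl⟩
    · rintro ⟨_, ⟨h, j, rfl⟩, rfl⟩
      exact ⟨(cons_mem_words_node_self _ _ _ _ _).2 (Or.inr h), j, rfl⟩
  rw [numChildren, this, Finset.card_image_of_injective _ List.cons_injective, numChildren]

lemma numChildren_words_node_of_ne (a : Unit) (c r : BinaryTree Unit) {i j : ℕ} (h : j ≠ i)
    (u : List ℕ) :
    numChildren (words (.node a c r) i).toFinset (j :: u) =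
      numChildren (words r (i + 1)).toFinset (j :: u) := by
  have : (words (.node a c r) i).toFinset.filter (fun v => ∃ m, v = (j :: u) ++ [m]) =
      (words r (i + 1)).toFinset.filter (fun v => ∃ m, v = (j :: u) ++ [m]) := by
    ext v
    simp only [Finset.mem_filter, List.mem_toFinset]
    refine and_congr_left ?_
    rintro ⟨m, rfl⟩
    rw [List.cons_append, cons_mem_words_node_of_ne _ _ _ h]
  rw [numChildren, this, numChildren]

lemma prod_map_words (μ : ℕ → ℝ) (c : BinaryTree Unit) (i : ℕ) :
    ((words c i).map fun u => μ (numChildren (words c i).toFinset u)).prod =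
      forestWeight μ c := by
  induction c generalizing i with
  | nil => rfl
  | node a c r ihc ihr =>
    have e1 : (words c 1).map
        (fun u => μ (numChildren (words (.node a c r) i).toFinset (i :: u))) =
        (words c 1).map (fun u => μ (numChildren (words c 1).toFinset u)) :=
      List.map_congr_left fun u _ => by rw [numChildren_words_node_self]
    have e2 : (words r (i + 1)).map
        (fun u => μ (numChildren (words (.node a c r) i).toFinset u)) =
        (words r (i + 1)).map (fun u => μ (numChildren (words r (i + 1)).toFinset u)) := by
      refine List.map_congr_left fun u hu => ?_
      obtain ⟨j, v, rfl, hj⟩ := exists_eq_cons_of_mem_words hu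
      rw [numChildren_words_node_of_ne _ _ _ (by omega)]
    have e3 : words (.node a c r) i = [i] :: ((words c 1).map (List.cons i) ++ words r (i + 1)) :=
      rfl
    have e4 : numChildren (words (.node a c r) i).toFinset [i] = rootCount c := by
      rw [numChildren_words_node_self, numChildren_words_nil]
    generalize (words (.node a c r) i).toFinset = S at e1 e2 e4 ⊢
    rw [e3, List.map_cons, List.map_append, List.map_map, List.prod_cons, List.prod_append]
    simp only [Function.comp_def]
    rw [e1, e2, e4, ihc, ihr, forestWeight, mul_assoc]

lemma gwWeight_toPlanarTree (μ : ℕ → ℝ) (c : BinaryTree Unit) :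
    gwWeight μ (toPlanarTree c).val = μ (rootCount c) * forestWeight μ c := by
  rw [gwWeight, toPlanarTree_val, List.prod_toFinset _ (nodup_treeWords c)]
  simp only [numChildren_treeWords]
  rw [treeWords, List.map_cons, List.prod_cons, prod_map_words, numChildren_words_nil]

/-- The lineages of all vertices of a planar tree in depth-first order. -/
def treeLineages (c : BinaryTree Unit) : List (List (ℕ × ℕ)) := [] :: lineages c (rootCount c) 1

lemma length_treeLineages (c : BinaryTree Unit) : (treeLineages c).length = c.numNodes + 1 := by
  simp [treeLineages, length_lineages]

lemma treeWords_eq_map_treeLineages (c : BinaryTree Unit) :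
    treeWords c = (treeLineages c).map (List.map Prod.snd) := by
  simp [treeWords, treeLineages, ← words_eq_map_lineages]

lemma vertexAt_toPlanarTree (c : BinaryTree Unit) (l : ℕ) :
    vertexAt (toPlanarTree c) l = ((treeLineages c).getD l []).map Prod.snd := by
  rw [vertexAt, sort_toPlanarTree, treeWords_eq_map_treeLineages]
  simp only [List.getD_eq_getElem?_getD, List.getElem?_map]
  cases (treeLineages c)[l]? <;> simp

lemma exists_eq_cons_of_mem_lineages {c : BinaryTree Unit} {k i : ℕ} {s : List (ℕ × ℕ)}
    (h : s ∈ lineages c k i) : ∃ j t, s = (k, j) :: t ∧ i ≤ j := by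
  induction c generalizing i with
  | nil => simp [lineages] at h
  | node _ c r ihc ihr =>
    simp only [lineages, List.mem_cons, List.mem_append, List.mem_map] at h
    rcases h with rfl | ⟨t, ht, rfl⟩ | h
    · exact ⟨i, [], rfl, le_rfl⟩
    · exact ⟨i, t, rfl, le_rfl⟩
    · obtain ⟨j, t, rfl, hj⟩ := ihr h
      exact ⟨j, t, rfl, by omega⟩

lemma numChildren_of_mem_lineages {c : BinaryTree Unit} {k i : ℕ} {s : List (ℕ × ℕ)}
    (h : s ∈ lineages c k i) {a b : List (ℕ × ℕ)} {p : ℕ × ℕ} (hs : s = a ++ p :: b)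
    (ha : a ≠ []) : numChildren (words c i).toFinset (a.map Prod.snd) = p.1 := by
  induction c generalizing k i s a with
  | nil => simp [lineages] at h
  | node _ c r ihc ihr =>
    obtain ⟨q, a, rfl⟩ := List.exists_cons_of_ne_nil ha
    simp only [lineages, List.mem_cons, List.mem_append, List.mem_map] at h
    rcases h with h | ⟨t, ht, h⟩ | h
    · rw [h] at hs
      simp at hs
    · rw [← h, List.cons_append, List.cons.injEq] at hs
      obtain ⟨rfl, rfl⟩ := hs
      rw [List.map_cons, numChildren_words_node_self]
      rcases eq_or_ne a [] with rfl | ha'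
      · obtain ⟨j, t, h, -⟩ := exists_eq_cons_of_mem_lineages ht
        simp only [List.nil_append, List.cons.injEq] at h
        rw [List.map_nil, numChildren_words_nil, h.1]
      · exact ihc ht rfl ha'
    · have := ihr h hs (by simp)
      obtain ⟨j, t, h', hj⟩ := exists_eq_cons_of_mem_lineages h
      rw [hs, List.cons_append, List.cons.injEq] at h'
      obtain ⟨rfl, -⟩ := h'
      simp only [List.map_cons] at this ⊢
      rw [numChildren_words_node_of_ne _ _ _ (by omega), this]

lemma numChildren_of_mem_treeLineages {c : BinaryTree Unit} {s : List (ℕ × ℕ)}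
    (h : s ∈ treeLineages c) {a b : List (ℕ × ℕ)} {p : ℕ × ℕ} (hs : s = a ++ p :: b) :
    numChildren (toPlanarTree c).val (a.map Prod.snd) = p.1 := by
  rw [toPlanarTree_val, numChildren_treeWords]
  rcases List.mem_cons.1 h with h | h
  · simp [h] at hs
  rcases eq_or_ne a [] with rfl | ha
  · obtain ⟨j, t, h', -⟩ := exists_eq_cons_of_mem_lineages h
    rw [hs, List.nil_append, List.cons.injEq] at h'
    rw [List.map_nil, numChildren_words_nil, h'.1]
  · exact numChildren_of_mem_lineages h hs ha

lemma IsPlanarTree.mem_of_isPrefix {T : Finset (List ℕ)} (hT : IsPlanarTree T) {u v : List ℕ}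
    (hv : v ∈ T) (h : u <+: v) : u ∈ T := by
  obtain ⟨w, rfl⟩ := h
  induction w using List.reverseRecOn with
  | nil => simpa using hv
  | append_singleton w m ih =>
    exact ih (hT.2 (u ++ w) m (by simpa using hv)).2.1

lemma count_drop_eq_card (s : List (ℕ × ℕ)) (p : ℕ × ℕ) (b : ℕ) :
    (s.drop b).count p =
      ((Finset.range s.length).filter fun i => b ≤ i ∧ s[i]? = some p).card := by
  induction s using List.reverseRecOn with
  | nil => simp
  | append_singleton s q ih =>
    have e : (Finset.range s.length).filter (fun i => b ≤ i ∧ (s ++ [q])[i]? = some p) =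
        (Finset.range s.length).filter (fun i => b ≤ i ∧ s[i]? = some p) := by
      refine Finset.filter_congr fun i hi => ?_
      rw [List.getElem?_append_left (Finset.mem_range.1 hi)]
    rw [List.length_append, List.length_singleton, Finset.range_add_one, Finset.filter_insert, e,
      List.drop_append, List.count_append, ih]
    have hn : s.length ∉ (Finset.range s.length).filter (fun i => b ≤ i ∧ s[i]? = some p) := by
      simp
    by_cases hb : b ≤ s.length
    · rw [Nat.sub_eq_zero_of_le hb]
      by_cases hq : q = p
      · simp [hb, hq]
      · simp [hq]
    · rw [List.drop_eq_nil_of_le (by simp; omega)]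
      simp [hb]

lemma card_filter_lineage {c : BinaryTree Unit} {s : List (ℕ × ℕ)} (h : s ∈ treeLineages c)
    (b k j : ℕ) :
    ((toPlanarTree c).val.filter fun v => (v ++ [j]) <+: s.map Prod.snd ∧ b ≤ v.length ∧
      numChildren (toPlanarTree c).val v = k).card = (s.drop b).count (k, j) := by
  rw [count_drop_eq_card]
  symm
  have hmem : s.map Prod.snd ∈ (toPlanarTree c).val := by
    rw [toPlanarTree_val, List.mem_toFinset, treeWords_eq_map_treeLineages]
    exact List.mem_map_of_mem h
  have htake : ∀ i < s.length, ((s.take i).map Prod.snd).length = i := by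
    intro i hi; simp; omega
  refine Finset.card_bij (fun i _ => (s.take i).map Prod.snd) ?_ ?_ ?_
  · intro i hi
    simp only [Finset.mem_filter, Finset.mem_range] at hi
    obtain ⟨h1, h2, h3⟩ := hi
    rw [List.getElem?_eq_getElem h1, Option.some.injEq] at h3
    have hs : s = s.take i ++ s[i] :: s.drop (i + 1) := by
      rw [← List.drop_eq_getElem_cons, List.take_append_drop]
    have hp : (s.take i).map Prod.snd ++ [j] <+: s.map Prod.snd := by
      refine ⟨(s.drop (i + 1)).map Prod.snd, ?_⟩
      conv_rhs => rw [hs]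
      simp [h3]
    rw [Finset.mem_filter, htake i h1]
    refine ⟨(toPlanarTree c).2.mem_of_isPrefix hmem ((List.prefix_append _ _).trans hp), hp, h2, ?_⟩
    rw [numChildren_of_mem_treeLineages h hs, h3]
  · intro i hi i' hi' he
    simp only [Finset.mem_filter, Finset.mem_range] at hi hi'
    rw [← htake i hi.1, ← htake i' hi'.1, he]
  · intro v hv
    obtain ⟨-, ⟨w, hw⟩, h2, h3⟩ := Finset.mem_filter.1 hv
    have hl : v.length < s.length := by
      have := congrArg List.length hw
      simp at this; omega
    have hs : s = s.take v.length ++ s[v.length] :: s.drop (v.length + 1) := by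
      rw [← List.drop_eq_getElem_cons, List.take_append_drop]
    have hv : (s.take v.length).map Prod.snd = v := by
      rw [List.map_take, ← hw]; simp
    have hj : s[v.length].2 = j := by
      have : (s.map Prod.snd)[v.length]? = some j := by rw [← hw]; simp
      simpa [List.getElem?_map, List.getElem?_eq_getElem hl] using this
    refine ⟨v.length, ?_, hv⟩
    simp only [Finset.mem_filter, Finset.mem_range]
    refine ⟨hl, h2, ?_⟩
    rw [List.getElem?_eq_getElem hl, Option.some.injEq]
    have := numChildren_of_mem_treeLineages h hs
    rw [hv, h3] at this
    exact Prod.ext this.symm hj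

lemma Acount_lineage {c : BinaryTree Unit} {s : List (ℕ × ℕ)} (h : s ∈ treeLineages c)
    (k j : ℕ) : Acount (toPlanarTree c) (s.map Prod.snd) k j = s.count (k, j) := by
  have := card_filter_lineage h 0 k j
  simpa [Acount] using this

lemma AcountLe_lineage {c : BinaryTree Unit} {s : List (ℕ × ℕ)} (h : s ∈ treeLineages c)
    (l k j : ℕ) :
    AcountLe (toPlanarTree c) (s.map Prod.snd) l k j = (s.drop (s.length - l)).count (k, j) := by
  rw [← card_filter_lineage h, AcountLe]
  congr 1
  refine Finset.filter_congr fun v _ => ?_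
  rw [List.length_map, and_congr_right_iff]
  intro hv
  have := hv.length_le
  simp only [List.length_append, List.length_singleton, List.length_map] at this
  rw [show s.length - v.length ≤ l ↔ s.length - l ≤ v.length by omega]

open BinaryTree in
lemma sum_treesOfNumNodesEq_succ (f : BinaryTree Unit → ℝ) (m : ℕ) :
    ∑ c ∈ treesOfNumNodesEq (m + 1), f c =
      ∑ p ∈ Finset.HasAntidiagonal.antidiagonal m, ∑ c ∈ treesOfNumNodesEq p.1, ∑ r ∈ treesOfNumNodesEq p.2,
        f (.node () c r) := by
  rw [treesOfNumNodesEq_succ, Finset.sum_biUnion]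
  · refine Finset.sum_congr rfl fun p _ => ?_
    rw [Finset.sum_map, Finset.sum_product]
    rfl
  · simp_rw [Set.PairwiseDisjoint, Set.Pairwise, Finset.disjoint_left]
    intro p _ q _ hpq c hc hc'
    simp only [Finset.mem_map, Finset.mem_product] at hc hc'
    obtain ⟨x, hx, rfl⟩ := hc
    obtain ⟨y, hy, h⟩ := hc'
    aesop

/-- Total Galton-Watson weight of the planar trees with `m` vertices. -/
def treeCoeff (μ : ℕ → ℝ) : ℕ → ℝ
  | 0 => 0
  | m + 1 => ∑ c ∈ BinaryTree.treesOfNumNodesEq m, μ (rootCount c) * forestWeight μ c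

/-- Generating function of the total progeny. -/
def treeSeries (μ : ℕ → ℝ) : PowerSeries ℝ := PowerSeries.mk (treeCoeff μ)

lemma coeff_zero_treeSeries_pow (μ : ℕ → ℝ) (L : ℕ) :
    PowerSeries.coeff 0 (treeSeries μ ^ (L + 1)) = 0 := by
  rw [pow_succ, PowerSeries.coeff_mul]
  simp [treeSeries, treeCoeff]

lemma sum_forestWeight (μ : ℕ → ℝ) (L m : ℕ) :
    ∑ c ∈ BinaryTree.treesOfNumNodesEq m, (if rootCount c = L then forestWeight μ c else 0) =
      PowerSeries.coeff m (treeSeries μ ^ L) := by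
  induction L generalizing m with
  | zero =>
    cases m with
    | zero => simp [rootCount, forestWeight]
    | succ m =>
      rw [sum_treesOfNumNodesEq_succ]
      simp [rootCount, PowerSeries.coeff_one]
  | succ L ih =>
    cases m with
    | zero => rw [coeff_zero_treeSeries_pow]; simp [rootCount]
    | succ m =>
      rw [sum_treesOfNumNodesEq_succ, pow_succ', PowerSeries.coeff_mul,
        Finset.Nat.sum_antidiagonal_succ]
      have h0 : PowerSeries.coeff 0 (treeSeries μ) = 0 := by simp [treeSeries, treeCoeff]
      rw [h0, zero_mul, zero_add]
      refine Finset.sum_congr rfl fun p _ => ?_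
      rw [← ih, treeSeries, PowerSeries.coeff_mk, treeCoeff, Finset.sum_mul_sum]
      refine Finset.sum_congr rfl fun c _ => Finset.sum_congr rfl fun r _ => ?_
      simp only [rootCount, add_left_inj, forestWeight]
      split_ifs <;> simp

lemma treeSeries_eq {μ : ℕ → ℝ} {K : ℕ} (hK : ∀ k, K < k → μ k = 0) :
    treeSeries μ = PowerSeries.X *
      ∑ k ∈ Finset.range (K + 1), PowerSeries.C (μ k) * treeSeries μ ^ k := by
  ext m
  cases m with
  | zero => simp [treeSeries, treeCoeff]
  | succ m =>
    rw [PowerSeries.coeff_succ_X_mul, map_sum]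
    simp only [PowerSeries.coeff_C_mul, ← sum_forestWeight]
    rw [treeSeries, PowerSeries.coeff_mk, treeCoeff]
    simp only [Finset.mul_sum]
    rw [Finset.sum_comm]
    refine Finset.sum_congr rfl fun c _ => ?_
    simp only [mul_ite, mul_zero]
    rw [Finset.sum_ite_eq]
    split_ifs with h
    · rfl
    · rw [hK _ (by simpa using h), zero_mul]

/-- The bijection between forests with `n` vertices and planar trees with `n` edges. -/
def forestEquiv (n : ℕ) :
    {c // c ∈ BinaryTree.treesOfNumNodesEq n} ≃ {T : PlanarTree // T.val.card = n + 1} :=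
  Equiv.ofBijective
    (fun c => ⟨toPlanarTree c.1, by
      rw [card_toPlanarTree, BinaryTree.mem_treesOfNumNodesEq.1 c.2]⟩) <| by
    constructor
    · intro c c' h
      exact Subtype.ext (toPlanarTree_injective (congrArg Subtype.val h))
    · rintro ⟨T, hT⟩
      obtain ⟨c, rfl⟩ := toPlanarTree_surjective T
      exact ⟨⟨c, BinaryTree.mem_treesOfNumNodesEq.2 (by
        rw [card_toPlanarTree] at hT; omega)⟩, rfl⟩

lemma tsum_planarTree (n : ℕ) (f : PlanarTree → ℝ) :
    ∑' T : {T : PlanarTree // T.val.card = n + 1}, f T =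
      ∑ c ∈ BinaryTree.treesOfNumNodesEq n, f (toPlanarTree c) := by
  rw [← (forestEquiv n).tsum_eq, ← Finset.tsum_subtype]
  rfl

lemma treeSizeProb_eq (μ : ℕ → ℝ) (n : ℕ) :
    treeSizeProb μ (n + 1) = PowerSeries.coeff (n + 1) (treeSeries μ) := by
  have := tsum_planarTree n fun T => gwWeight μ T.val
  simp only [gwWeight_toPlanarTree] at this
  rw [treeSeries, PowerSeries.coeff_mk, treeCoeff, ← this]
  rfl

lemma condExpect_eq (μ : ℕ → ℝ) (n : ℕ) (f : PlanarTree → ℝ) :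
    condExpect μ n f = (∑ c ∈ BinaryTree.treesOfNumNodesEq n,
      μ (rootCount c) * forestWeight μ c * f (toPlanarTree c)) /
        PowerSeries.coeff (n + 1) (treeSeries μ) := by
  have := tsum_planarTree n fun T => gwWeight μ T.val * f T
  simp only [gwWeight_toPlanarTree] at this
  rw [condExpect, treeSizeProb_eq, ← this]

lemma sum_antidiagonal_add_left (l b : ℕ) (f : ℕ → ℕ → ℝ) :
    ∑ p ∈ Finset.HasAntidiagonal.antidiagonal (l + b), (if l ≤ p.1 then f (p.1 - l) p.2 else 0) =
      ∑ p ∈ Finset.HasAntidiagonal.antidiagonal b, f p.1 p.2 := by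
  rw [← Finset.sum_filter]
  refine Finset.sum_nbij' (fun p => (p.1 - l, p.2)) (fun p => (p.1 + l, p.2)) ?_ ?_ ?_ ?_ ?_
  · intro p hp
    simp only [Finset.mem_filter, Finset.HasAntidiagonal.mem_antidiagonal] at hp ⊢
    omega
  · intro p hp
    simp only [Finset.mem_filter, Finset.HasAntidiagonal.mem_antidiagonal] at hp ⊢
    omega
  · intro p hp
    simp only [Finset.mem_filter, Finset.HasAntidiagonal.mem_antidiagonal] at hp ⊢
    ext <;> simp; omega
  · intro p hp
    simp
  · intro p hp
    rfl

lemma sum_antidiagonal_add_right (l b : ℕ) (f : ℕ → ℕ → ℝ) :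
    ∑ p ∈ Finset.HasAntidiagonal.antidiagonal (l + b), (if p.1 ≤ l then f p.1 (l - p.1) else 0) =
      ∑ p ∈ Finset.HasAntidiagonal.antidiagonal l, f p.1 p.2 := by
  rw [← Finset.sum_filter]
  refine Finset.sum_nbij' (fun p => (p.1, p.2 - b)) (fun p => (p.1, p.2 + b)) ?_ ?_ ?_ ?_ ?_
  · intro p hp
    simp only [Finset.mem_filter, Finset.HasAntidiagonal.mem_antidiagonal] at hp ⊢
    omega
  · intro p hp
    simp only [Finset.mem_filter, Finset.HasAntidiagonal.mem_antidiagonal] at hp ⊢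
    omega
  · intro p hp
    simp only [Finset.mem_filter, Finset.HasAntidiagonal.mem_antidiagonal] at hp ⊢
    ext <;> simp; omega
  · intro p hp
    simp
  · intro p hp
    simp only [Finset.mem_filter, Finset.HasAntidiagonal.mem_antidiagonal] at hp ⊢
    congr 1; omega

/-- Number of elder siblings along a lineage. -/
def leftCount (σ : List (ℕ × ℕ)) : ℕ := (σ.map fun p => p.2 - 1).sum

/-- Number of younger siblings along a lineage. -/
def rightCount (σ : List (ℕ × ℕ)) : ℕ := (σ.map fun p => p.1 - p.2).sum

/-- Weight of a lineage. -/
def lineageWeight (μ : ℕ → ℝ) (σ : List (ℕ × ℕ)) : ℝ := (σ.map fun p => μ p.1).prod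

lemma lineages_node (a : Unit) (c r : BinaryTree Unit) (k i : ℕ) :
    lineages (.node a c r) k i = (treeLineages c).map (List.cons (k, i)) ++ lineages r k (i + 1) := by
  simp [lineages, treeLineages]

lemma getElem?_lineages_node (a : Unit) (c r : BinaryTree Unit) (k i l : ℕ) :
    (lineages (.node a c r) k i)[l]? =
      if l < c.numNodes + 1 then ((treeLineages c)[l]?).map (List.cons (k, i))
      else (lineages r k (i + 1))[l - (c.numNodes + 1)]? := by
  rw [lineages_node, List.getElem?_append, List.length_map, length_treeLineages, List.getElem?_map]

/-- The right-hand side of the spine decomposition at a marked vertex. -/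
def spineCoeff (μ : ℕ → ℝ) (h L R l b : ℕ) : ℝ :=
  PowerSeries.coeff l (PowerSeries.X ^ h * treeSeries μ ^ L) *
    PowerSeries.coeff b (treeSeries μ ^ R)

lemma sum_marked_forest (μ : ℕ → ℝ) (σ : List (ℕ × ℕ))
    (ih : ∀ l b n, n + 1 = l + b → 1 ≤ b →
      ∑ c ∈ BinaryTree.treesOfNumNodesEq n, (if (treeLineages c)[l]? = some σ then
        μ (rootCount c) * forestWeight μ c else 0) =
        lineageWeight μ σ * spineCoeff μ σ.length (leftCount σ) (rightCount σ + 1) l b)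
    (k j : ℕ) : ∀ M i l b, j < M → 1 ≤ b →
      ∑ c ∈ BinaryTree.treesOfNumNodesEq (l + b),
        (if rootCount c = M ∧ (lineages c k i)[l]? = some ((k, i + j) :: σ) then
          forestWeight μ c else 0) =
        lineageWeight μ σ *
          spineCoeff μ σ.length (leftCount σ + j) (rightCount σ + (M - j)) l b := by
  induction j with
  | zero =>
    intro M i l b hM hb
    obtain ⟨M, rfl⟩ := Nat.exists_eq_succ_of_ne_zero hM.ne'
    obtain ⟨b, rfl⟩ := Nat.exists_eq_succ_of_ne_zero (by omega : b ≠ 0)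
    have key : PowerSeries.coeff (b + 1) (treeSeries μ ^ (rightCount σ + (M + 1))) =
        ∑ p ∈ Finset.HasAntidiagonal.antidiagonal (l + (b + 1)), (if l ≤ p.1 then
          PowerSeries.coeff (p.1 - l) (treeSeries μ ^ (rightCount σ + 1)) *
            PowerSeries.coeff p.2 (treeSeries μ ^ M) else 0) := by
      rw [sum_antidiagonal_add_left l (b + 1) fun x y =>
        PowerSeries.coeff x (treeSeries μ ^ (rightCount σ + 1)) *
            PowerSeries.coeff y (treeSeries μ ^ M), ← PowerSeries.coeff_mul, ← pow_add]
      congr 2; ring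
    simp only [Nat.succ_eq_add_one, Nat.sub_zero, add_zero]
    rw [spineCoeff, key, ← add_assoc, sum_treesOfNumNodesEq_succ, Finset.Nat.sum_antidiagonal_succ]
    have h0 : (if l ≤ 0 then PowerSeries.coeff (0 - l) (treeSeries μ ^ (rightCount σ + 1)) *
        PowerSeries.coeff (l + b + 1) (treeSeries μ ^ M) else 0) = 0 := by
      split_ifs
      · rw [Nat.zero_sub, coeff_zero_treeSeries_pow, zero_mul]
      · rfl
    rw [h0, zero_add, Finset.mul_sum, Finset.mul_sum]
    refine Finset.sum_congr rfl fun p hp => ?_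
    rw [Finset.HasAntidiagonal.mem_antidiagonal] at hp
    have hnot : ∀ (r : BinaryTree Unit) (x : ℕ), (lineages r k (i + 1))[x]? ≠ some ((k, i) :: σ) := by
      intro r x hx
      obtain ⟨j, t, h, hj⟩ := exists_eq_cons_of_mem_lineages (List.mem_of_getElem? hx)
      simp at h; omega
    by_cases hl : l < p.1 + 1
    · have hr : ∀ c ∈ BinaryTree.treesOfNumNodesEq p.1, ∀ r ∈ BinaryTree.treesOfNumNodesEq p.2,
          (if rootCount (.node () c r) = M + 1 ∧
            (lineages (.node () c r) k i)[l]? = some ((k, i) :: σ) then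
            forestWeight μ (.node () c r) else 0) =
          (if (treeLineages c)[l]? = some σ then μ (rootCount c) * forestWeight μ c else 0) *
            (if rootCount r = M then forestWeight μ r else 0) := by
        intro c hc r hr
        rw [getElem?_lineages_node, BinaryTree.mem_treesOfNumNodesEq.1 hc, if_pos hl]
        have e : ((treeLineages c)[l]?).map (List.cons (k, i)) = some ((k, i) :: σ) ↔
            (treeLineages c)[l]? = some σ := by
          cases (treeLineages c)[l]? <;> simp
        simp only [e, rootCount, add_left_inj, forestWeight]
        by_cases h1 : rootCount r = M <;> by_cases h2 : (treeLineages c)[l]? = some σ <;>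
          simp [h1, h2]
      rw [Finset.sum_congr rfl fun c hc => Finset.sum_congr rfl fun r hr' => hr c hc r hr',
        ← Finset.sum_mul_sum, sum_forestWeight]
      rcases eq_or_lt_of_le (Nat.le_of_lt_succ hl) with hl' | hl'
      · rw [ih l (p.1 + 1 - l) p.1 (by omega) (by omega), spineCoeff, if_pos (by omega)]
        ring
      · rw [ih l (p.1 + 1 - l) p.1 (by omega) (by omega), spineCoeff, if_pos (by omega)]
        ring
    · have hr : ∀ c ∈ BinaryTree.treesOfNumNodesEq p.1, ∀ r ∈ BinaryTree.treesOfNumNodesEq p.2,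
          (if rootCount (.node () c r) = M + 1 ∧
            (lineages (.node () c r) k i)[l]? = some ((k, i) :: σ) then
            forestWeight μ (.node () c r) else 0) = 0 := by
        intro c hc r hr
        rw [getElem?_lineages_node, BinaryTree.mem_treesOfNumNodesEq.1 hc, if_neg hl,
          if_neg fun h => hnot _ _ h.2]
      rw [Finset.sum_congr rfl fun c hc => Finset.sum_congr rfl fun r hr' => hr c hc r hr']
      split_ifs with h
      · rw [show p.1 + 1 - l = 0 by omega, coeff_zero_treeSeries_pow]; simp
      · simp
  | succ j ihj =>
    intro M i l b hM hb
    obtain ⟨M, rfl⟩ := Nat.exists_eq_succ_of_ne_zero (by omega : M ≠ 0)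
    obtain ⟨b, rfl⟩ := Nat.exists_eq_succ_of_ne_zero (by omega : b ≠ 0)
    have key : PowerSeries.coeff l (PowerSeries.X ^ σ.length *
          treeSeries μ ^ (leftCount σ + (j + 1))) =
        ∑ p ∈ Finset.HasAntidiagonal.antidiagonal (l + (b + 1)), (if p.1 ≤ l then
          PowerSeries.coeff p.1 (treeSeries μ) * PowerSeries.coeff (l - p.1)
            (PowerSeries.X ^ σ.length * treeSeries μ ^ (leftCount σ + j)) else 0) := by
      rw [sum_antidiagonal_add_right l (b + 1) fun x y => PowerSeries.coeff x (treeSeries μ) *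
        PowerSeries.coeff y (PowerSeries.X ^ σ.length * treeSeries μ ^ (leftCount σ + j)),
        ← PowerSeries.coeff_mul]
      congr 1; ring
    simp only [Nat.succ_eq_add_one, Nat.add_sub_add_right]
    rw [spineCoeff, key, ← add_assoc, sum_treesOfNumNodesEq_succ, Finset.Nat.sum_antidiagonal_succ]
    have h0 : PowerSeries.coeff 0 (treeSeries μ) = 0 := by simp [treeSeries, treeCoeff]
    rw [h0, zero_mul, ite_self, zero_add, Finset.sum_mul, Finset.mul_sum]
    refine Finset.sum_congr rfl fun p hp => ?_
    rw [Finset.HasAntidiagonal.mem_antidiagonal] at hp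
    by_cases hl : p.1 + 1 ≤ l
    · have hr : ∀ c ∈ BinaryTree.treesOfNumNodesEq p.1, ∀ r ∈ BinaryTree.treesOfNumNodesEq p.2,
          (if rootCount (.node () c r) = M + 1 ∧
            (lineages (.node () c r) k i)[l]? = some ((k, i + (j + 1)) :: σ) then
            forestWeight μ (.node () c r) else 0) =
          (μ (rootCount c) * forestWeight μ c) *
            (if rootCount r = M ∧
              (lineages r k (i + 1))[l - (p.1 + 1)]? = some ((k, i + 1 + j) :: σ) then
              forestWeight μ r else 0) := by
        intro c hc r hr
        rw [getElem?_lineages_node, BinaryTree.mem_treesOfNumNodesEq.1 hc,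
          if_neg (show ¬ l < p.1 + 1 by omega)]
        simp only [rootCount, add_left_inj, forestWeight, show i + (j + 1) = i + 1 + j by ring]
        split_ifs <;> simp
      have e := ihj M (i + 1) (l - (p.1 + 1)) (b + 1) (by omega) (by omega)
      rw [show l - (p.1 + 1) + (b + 1) = p.2 by omega] at e
      rw [Finset.sum_congr rfl fun c hc => Finset.sum_congr rfl fun r hr' => hr c hc r hr',
        ← Finset.sum_mul_sum, e, spineCoeff, if_pos hl, treeSeries, PowerSeries.coeff_mk,
        treeCoeff]
      ring
    · have hr : ∀ c ∈ BinaryTree.treesOfNumNodesEq p.1, ∀ r ∈ BinaryTree.treesOfNumNodesEq p.2,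
          (if rootCount (.node () c r) = M + 1 ∧
            (lineages (.node () c r) k i)[l]? = some ((k, i + (j + 1)) :: σ) then
            forestWeight μ (.node () c r) else 0) = 0 := by
        intro c hc r hr
        rw [getElem?_lineages_node, BinaryTree.mem_treesOfNumNodesEq.1 hc, if_pos (show l < p.1 + 1 by omega),
          if_neg]
        rintro ⟨-, h⟩
        cases h' : (treeLineages c)[l]? <;> simp [h'] at h
      rw [Finset.sum_congr rfl fun c hc => Finset.sum_congr rfl fun r hr' => hr c hc r hr']
      simp [hl]

lemma sum_marked_tree (μ : ℕ → ℝ) (σ : List (ℕ × ℕ)) (hσ : ∀ p ∈ σ, 1 ≤ p.2 ∧ p.2 ≤ p.1) :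
    ∀ l b n, n + 1 = l + b → 1 ≤ b →
      ∑ c ∈ BinaryTree.treesOfNumNodesEq n, (if (treeLineages c)[l]? = some σ then
        μ (rootCount c) * forestWeight μ c else 0) =
        lineageWeight μ σ * spineCoeff μ σ.length (leftCount σ) (rightCount σ + 1) l b := by
  induction σ with
  | nil =>
    intro l b n h hb
    cases l with
    | zero =>
      obtain rfl : n + 1 = b := by omega
      simp [treeLineages, lineageWeight, spineCoeff, leftCount, rightCount, treeSeries, treeCoeff]
    | succ l =>
      have : ∀ c : BinaryTree Unit, (treeLineages c)[l + 1]? ≠ some [] := by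
        intro c hc
        rw [treeLineages, List.getElem?_cons_succ] at hc
        obtain ⟨j, t, h, -⟩ := exists_eq_cons_of_mem_lineages (List.mem_of_getElem? hc)
        simp at h
      simp [this, spineCoeff, leftCount, PowerSeries.coeff_one]
  | cons p σ ih =>
    obtain ⟨k, j⟩ := p
    intro l b n h hb
    have hkj := hσ (k, j) (by simp)
    simp only at hkj
    cases l with
    | zero => simp [treeLineages, spineCoeff]
    | succ l =>
      obtain rfl : n = l + b := by omega
      have := sum_marked_forest μ σ (ih fun p hp => hσ p (by simp [hp])) k (j - 1) k 1 l b
        (by omega) hb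
      rw [show 1 + (j - 1) = j by omega] at this
      have e : ∀ c ∈ BinaryTree.treesOfNumNodesEq (l + b),
          (if (treeLineages c)[l + 1]? = some ((k, j) :: σ) then
            μ (rootCount c) * forestWeight μ c else 0) =
          μ k * (if rootCount c = k ∧ (lineages c k 1)[l]? = some ((k, j) :: σ) then
            forestWeight μ c else 0) := by
        intro c _
        rw [treeLineages, List.getElem?_cons_succ]
        by_cases hc : rootCount c = k
        · subst hc; simp
        · rw [if_neg, if_neg (by simp [hc]), mul_zero]
          intro h'
          obtain ⟨j, t, h, -⟩ := exists_eq_cons_of_mem_lineages (List.mem_of_getElem? h')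
          simp at h; exact hc h.1.1.symm
      rw [Finset.sum_congr rfl e, ← Finset.mul_sum, this]
      simp only [lineageWeight, List.map_cons, List.prod_cons, spineCoeff, List.length_cons,
        leftCount, rightCount, List.sum_cons]
      rw [pow_succ', mul_assoc PowerSeries.X, PowerSeries.coeff_succ_X_mul,
        add_comm (j - 1), show k - j + (List.map (fun p => p.1 - p.2) σ).sum + 1 =
          (List.map (fun p => p.1 - p.2) σ).sum + (k - (j - 1)) by omega]
      ring

/-- Generating polynomial of the offspring distribution. -/
def offspringPoly (μ : ℕ → ℝ) (K : ℕ) : Polynomial ℝ :=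
  ∑ k ∈ Finset.range (K + 1), Polynomial.C (μ k) * Polynomial.X ^ k

lemma coeff_offspringPoly_mul (μ : ℕ → ℝ) (K : ℕ) (p : Polynomial ℝ) (j : ℕ) :
    (offspringPoly μ K * p).coeff j =
      ∑ k ∈ Finset.range (K + 1), μ k * (if k ≤ j then p.coeff (j - k) else 0) := by
  rw [offspringPoly, Finset.sum_mul, Polynomial.finsetSum_coeff]
  refine Finset.sum_congr rfl fun k _ => ?_
  rw [mul_assoc, Polynomial.coeff_C_mul, Polynomial.coeff_X_pow_mul']

lemma sum_mul_coeff_offspringPoly_pow (μ : ℕ → ℝ) (K m j : ℕ) :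
    (m + 1 : ℝ) * ∑ k ∈ Finset.range (K + 1),
      (k * μ k) * (if k ≤ j then (offspringPoly μ K ^ m).coeff (j - k) else 0) =
      j * (offspringPoly μ K ^ (m + 1)).coeff j := by
  have hd : Polynomial.X * Polynomial.derivative (offspringPoly μ K) =
      ∑ k ∈ Finset.range (K + 1), Polynomial.C (k * μ k) * Polynomial.X ^ k := by
    rw [offspringPoly, Polynomial.derivative_sum, Finset.mul_sum]
    refine Finset.sum_congr rfl fun k _ => ?_
    cases k with
    | zero => simp
    | succ k =>
      rw [Polynomial.derivative_C_mul_X_pow, mul_comm (μ _), pow_succ']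
      simp only [Nat.add_sub_cancel]
      ring
  have h1 : (Polynomial.X * Polynomial.derivative (offspringPoly μ K ^ (m + 1))).coeff j =
      j * (offspringPoly μ K ^ (m + 1)).coeff j := by
    cases j with
    | zero => simp
    | succ j =>
      rw [Polynomial.coeff_X_mul, Polynomial.coeff_derivative]
      push_cast; ring
  rw [← h1, Polynomial.derivative_pow_succ,
    show Polynomial.X * (Polynomial.C ((m : ℝ) + 1) * offspringPoly μ K ^ m *
      Polynomial.derivative (offspringPoly μ K)) = Polynomial.C ((m : ℝ) + 1) *
      ((Polynomial.X * Polynomial.derivative (offspringPoly μ K)) * offspringPoly μ K ^ m) by ring,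
    hd, Polynomial.coeff_C_mul, Finset.sum_mul, Polynomial.finsetSum_coeff]
  congr 1
  refine Finset.sum_congr rfl fun k _ => ?_
  rw [mul_assoc (Polynomial.C _), Polynomial.coeff_C_mul, Polynomial.coeff_X_pow_mul']

/-- The cycle lemma, in the form of Lagrange inversion. -/
lemma mul_coeff_treeSeries_pow {μ : ℕ → ℝ} {K : ℕ} (hK : ∀ k, K < k → μ k = 0) (m : ℕ) :
    ∀ L : ℕ, (m : ℝ) * PowerSeries.coeff m (treeSeries μ ^ L) =
      L * (if L ≤ m then (offspringPoly μ K ^ m).coeff (m - L) else 0) := by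
  induction m with
  | zero => intro L; by_cases h : L = 0 <;> simp [h]
  | succ m ih =>
    intro L
    cases L with
    | zero => simp [PowerSeries.coeff_one]
    | succ L =>
      have e : PowerSeries.coeff (m + 1) (treeSeries μ ^ (L + 1)) =
          ∑ k ∈ Finset.range (K + 1), μ k * PowerSeries.coeff m (treeSeries μ ^ (k + L)) := by
        rw [pow_succ']
        nth_rewrite 1 [treeSeries_eq hK]
        rw [mul_assoc, PowerSeries.coeff_succ_X_mul, Finset.sum_mul, map_sum]
        refine Finset.sum_congr rfl fun k _ => ?_
        rw [mul_assoc, ← pow_add, PowerSeries.coeff_C_mul]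
      rw [e]
      rcases Nat.eq_zero_or_pos m with rfl | hm
      · have : ∀ k L : ℕ, PowerSeries.coeff 0 (treeSeries μ ^ (k + L)) =
            if k = 0 ∧ L = 0 then 1 else 0 := by
          intro k L
          rcases Nat.eq_zero_or_pos (k + L) with h | h
          · simp [Nat.add_eq_zero_iff.1 h]
          · obtain ⟨r, hr⟩ := Nat.exists_eq_succ_of_ne_zero h.ne'
            rw [hr, Nat.succ_eq_add_one, coeff_zero_treeSeries_pow, if_neg (by omega)]
        simp only [this]
        by_cases hL : L = 0
        · subst hL
          simp [offspringPoly, Polynomial.coeff_X_pow]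
        · simp [hL]
      · have hm' : (m : ℝ) ≠ 0 := by positivity
        by_cases hL : L ≤ m
        · have h1 := coeff_offspringPoly_mul μ K (offspringPoly μ K ^ m) (m - L)
          rw [← pow_succ'] at h1
          have h2 := sum_mul_coeff_offspringPoly_pow μ K m (m - L)
          have h3 : (m : ℝ) * ∑ k ∈ Finset.range (K + 1),
              μ k * PowerSeries.coeff m (treeSeries μ ^ (k + L)) =
              ∑ k ∈ Finset.range (K + 1),
                (k * μ k) * (if k ≤ m - L then (offspringPoly μ K ^ m).coeff (m - L - k) else 0) +
              L * (offspringPoly μ K ^ (m + 1)).coeff (m - L) := by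
            rw [h1, Finset.mul_sum, Finset.mul_sum, ← Finset.sum_add_distrib]
            refine Finset.sum_congr rfl fun k _ => ?_
            rw [mul_left_comm, ih]
            by_cases hk : k ≤ m - L
            · rw [if_pos hk, if_pos (by omega), show m - (k + L) = m - L - k by omega]
              push_cast; ring
            · rw [if_neg hk, if_neg (by omega)]; simp
          rw [if_pos (by omega), Nat.add_sub_add_right]
          rw [Nat.cast_sub hL] at h2
          apply mul_left_cancel₀ hm'
          push_cast
          rw [mul_left_comm, h3, mul_add, h2]
          ring
        · rw [if_neg (by omega), mul_zero, Finset.sum_eq_zero, mul_zero]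
          intro k _
          have := ih (k + L)
          rw [if_neg (by omega), mul_zero] at this
          rw [(mul_eq_zero.1 this).resolve_left hm', mul_zero]

/-- Characteristic function of the law `ν` on `{0, ..., N}`. -/
def charSum (ν : ℕ → ℝ) (N : ℕ) (θ : ℝ) : ℂ :=
  ∑ k ∈ Finset.range (N + 1), (ν k : ℂ) * Complex.exp ((k * θ : ℝ) * Complex.I)

lemma re_charSum (ν : ℕ → ℝ) (N : ℕ) (θ : ℝ) :
    (charSum ν N θ).re = ∑ k ∈ Finset.range (N + 1), ν k * Real.cos (k * θ) := by
  rw [charSum, Complex.re_sum]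
  refine Finset.sum_congr rfl fun k _ => ?_
  rw [Complex.re_ofReal_mul, Complex.exp_ofReal_mul_I_re]

lemma norm_charSum_le {ν : ℕ → ℝ} {N : ℕ} (h0 : ∀ k, 0 ≤ ν k)
    (h1 : ∑ k ∈ Finset.range (N + 1), ν k = 1) {c : ℝ} (hc : 0 ≤ c)
    (hap : ∀ θ : ℝ, c * (1 - Real.cos θ) ≤
      ∑ k ∈ Finset.range (N + 1), ν k * (1 - Real.cos (k * θ)))
    {θ : ℝ} (hθ : |θ| ≤ Real.pi) :
    ‖charSum ν N θ‖ ≤ Real.exp (-(2 * ν 0 * c / Real.pi ^ 2) * θ ^ 2) := by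
  set r : ℂ := charSum ν N θ - ν 0 with hr
  have hr1 : ‖r‖ ≤ 1 - ν 0 := by
    have : r = ∑ k ∈ Finset.range N, (ν (k + 1) : ℂ) *
        Complex.exp (((k + 1 : ℕ) * θ : ℝ) * Complex.I) := by
      rw [hr, charSum, Finset.sum_range_succ']; simp
    rw [this]
    refine (norm_sum_le _ _).trans ?_
    rw [← h1, Finset.sum_range_succ', add_sub_cancel_right]
    refine Finset.sum_le_sum fun k _ => ?_
    rw [norm_mul, Complex.norm_exp_ofReal_mul_I, mul_one, Complex.norm_real, Real.norm_eq_abs,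
      abs_of_nonneg (h0 _)]
  have hre : r.re ≤ 1 - ν 0 - c * (1 - Real.cos θ) := by
    have := hap θ
    simp only [mul_sub, mul_one, Finset.sum_sub_distrib, h1] at this
    rw [hr, Complex.sub_re, re_charSum, Complex.ofReal_re]
    linarith
  have hsq : ‖charSum ν N θ‖ ^ 2 ≤ 1 - 2 * ν 0 * (c * (1 - Real.cos θ)) := by
    have e : charSum ν N θ = ν 0 + r := by rw [hr]; ring
    have e2 : ‖charSum ν N θ‖ ^ 2 = ν 0 ^ 2 + ‖r‖ ^ 2 + 2 * (ν 0 * r.re) := by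
      rw [e, Complex.sq_norm, Complex.normSq_add, Complex.normSq_ofReal, Complex.sq_norm,
        Complex.re_ofReal_mul, Complex.conj_re]
      ring
    have h3 : ‖r‖ ^ 2 ≤ (1 - ν 0) ^ 2 := by gcongr
    have h4 : ν 0 * r.re ≤ ν 0 * (1 - ν 0 - c * (1 - Real.cos θ)) :=
      mul_le_mul_of_nonneg_left hre (h0 0)
    rw [e2]; nlinarith
  have hcos := Real.cos_le_one_sub_mul_cos_sq hθ
  have hνc : 0 ≤ ν 0 * c := mul_nonneg (h0 0) hc
  have hexp : ‖charSum ν N θ‖ ^ 2 ≤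
      Real.exp (-(2 * ν 0 * c / Real.pi ^ 2) * θ ^ 2) ^ 2 := by
    rw [← Real.exp_nat_mul]
    refine hsq.trans ?_
    refine le_trans ?_ (Real.add_one_le_exp _)
    have : ν 0 * c * (2 / Real.pi ^ 2 * θ ^ 2) ≤ ν 0 * c * (1 - Real.cos θ) :=
      mul_le_mul_of_nonneg_left (by linarith) hνc
    have e : ((2 : ℕ) : ℝ) * (-(2 * ν 0 * c / Real.pi ^ 2) * θ ^ 2) =
        -2 * (ν 0 * c * (2 / Real.pi ^ 2 * θ ^ 2)) := by push_cast; ring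
    rw [e]; linarith
  exact le_of_sq_le_sq hexp (Real.exp_pos _).le

lemma integral_exp_int_mul (n : ℤ) :
    ∫ θ in (-Real.pi)..Real.pi, Complex.exp ((n * θ : ℝ) * Complex.I) =
      if n = 0 then (2 * Real.pi : ℂ) else 0 := by
  split_ifs with h
  · subst h; simp; ring
  · have hc : (n : ℂ) * Complex.I ≠ 0 := by simp [h]
    have e : ∀ θ : ℝ, Complex.exp ((n * θ : ℝ) * Complex.I) =
        Complex.exp ((n : ℂ) * Complex.I * θ) := by
      intro θ; congr 1; push_cast; ring
    simp_rw [e]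
    rw [integral_exp_mul_complex hc, div_eq_zero_iff]
    left
    rw [sub_eq_zero, Complex.exp_eq_exp_iff_exists_int]
    exact ⟨n, by push_cast; ring⟩

lemma integral_eval_exp (p : Polynomial ℝ) (j : ℕ) :
    ∫ θ in (-Real.pi)..Real.pi, (p.map (algebraMap ℝ ℂ)).eval (Complex.exp (θ * Complex.I)) *
      Complex.exp ((-(j : ℤ) * θ : ℝ) * Complex.I) = 2 * Real.pi * (p.coeff j : ℂ) := by
  have e : ∀ θ : ℝ, (p.map (algebraMap ℝ ℂ)).eval (Complex.exp (θ * Complex.I)) *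
      Complex.exp ((-(j : ℤ) * θ : ℝ) * Complex.I) =
      ∑ k ∈ Finset.range (p.natDegree + j + 1), (p.coeff k : ℂ) *
        Complex.exp (((((k : ℤ) - j : ℤ) : ℝ) * θ : ℝ) * Complex.I) := by
    intro θ
    have hdeg : (p.map (algebraMap ℝ ℂ)).natDegree < p.natDegree + j + 1 :=
      lt_of_le_of_lt (Polynomial.natDegree_map_le) (by omega)
    rw [Polynomial.eval_eq_sum_range' hdeg, Finset.sum_mul]
    refine Finset.sum_congr rfl fun k _ => ?_
    rw [Polynomial.coeff_map, ← Complex.exp_nat_mul, mul_assoc, ← Complex.exp_add]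
    simp only [Complex.coe_algebraMap]
    congr 2; push_cast; ring
  simp_rw [e]
  rw [intervalIntegral.integral_finsetSum]
  · simp_rw [intervalIntegral.integral_const_mul, integral_exp_int_mul]
    rw [Finset.sum_eq_single j]
    · simp; ring
    · intro k _ hk
      rw [if_neg (by omega), mul_zero]
    · intro h; exact absurd (Finset.mem_range.2 (by omega)) h
  · intro k _
    apply Continuous.intervalIntegrable
    fun_prop

lemma eval_offspringPoly (ν : ℕ → ℝ) (N : ℕ) (θ : ℝ) :
    ((offspringPoly ν N).map (algebraMap ℝ ℂ)).eval (Complex.exp (θ * Complex.I)) =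
      charSum ν N θ := by
  rw [offspringPoly, Polynomial.map_sum, Polynomial.eval_finsetSum, charSum]
  refine Finset.sum_congr rfl fun k _ => ?_
  simp only [Polynomial.map_mul, Polynomial.map_C, Polynomial.map_pow, Polynomial.map_X,
    Polynomial.eval_mul, Polynomial.eval_C, Polynomial.eval_pow, Polynomial.eval_X]
  rw [← Complex.exp_nat_mul]
  simp only [Complex.coe_algebraMap]
  congr 2; push_cast; ring

lemma continuous_charSum (ν : ℕ → ℝ) (N : ℕ) : Continuous (charSum ν N) := by
  unfold charSum; fun_prop

lemma coeff_offspringPoly_pow (ν : ℕ → ℝ) (N m j : ℕ) :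
    2 * Real.pi * ((offspringPoly ν N ^ m).coeff j : ℂ) =
      ∫ θ in (-Real.pi)..Real.pi, charSum ν N θ ^ m *
        Complex.exp ((-(j : ℤ) * θ : ℝ) * Complex.I) := by
  rw [← integral_eval_exp]
  simp_rw [Polynomial.map_pow, Polynomial.eval_pow, eval_offspringPoly]

lemma abs_coeff_offspringPoly_pow_le {ν : ℕ → ℝ} {N : ℕ} {κ : ℝ} (hκ : 0 < κ)
    (h : ∀ θ : ℝ, |θ| ≤ Real.pi → ‖charSum ν N θ‖ ≤ Real.exp (-κ * θ ^ 2)) (m j : ℕ)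
    (hm : 1 ≤ m) :
    |(offspringPoly ν N ^ m).coeff j| ≤ √(Real.pi / κ) / √m := by
  have hπ := Real.pi_pos
  have hm' : (0 : ℝ) < m := by exact_mod_cast hm
  have e : ‖(2 * Real.pi * ((offspringPoly ν N ^ m).coeff j : ℂ))‖ =
      2 * Real.pi * |(offspringPoly ν N ^ m).coeff j| := by
    rw [norm_mul, norm_mul, Complex.norm_real, Complex.norm_real, Real.norm_eq_abs,
      Real.norm_eq_abs, abs_of_pos hπ]; simp
  have hint : MeasureTheory.Integrable fun θ : ℝ => Real.exp (-(κ * m) * θ ^ 2) :=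
    integrable_exp_neg_mul_sq (by positivity)
  have h1 : ‖(2 * Real.pi * ((offspringPoly ν N ^ m).coeff j : ℂ))‖ ≤
      ∫ θ in (-Real.pi)..Real.pi, Real.exp (-(κ * m) * θ ^ 2) := by
    rw [coeff_offspringPoly_pow]
    refine intervalIntegral.norm_integral_le_of_norm_le (by linarith) ?_
      hint.intervalIntegrable
    refine Eventually.of_forall fun θ hθ => ?_
    rw [norm_mul, Complex.norm_exp_ofReal_mul_I, mul_one, norm_pow]
    calc ‖charSum ν N θ‖ ^ m ≤ Real.exp (-κ * θ ^ 2) ^ m := by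
          gcongr; exact h θ (abs_le.2 ⟨hθ.1.le, hθ.2⟩)
      _ = _ := by rw [← Real.exp_nat_mul]; congr 1; ring
  have h2 : ∫ θ in (-Real.pi)..Real.pi, Real.exp (-(κ * m) * θ ^ 2) ≤ √(Real.pi / (κ * m)) := by
    rw [← integral_gaussian, intervalIntegral.integral_of_le (by linarith)]
    exact MeasureTheory.setIntegral_le_integral hint
      (Eventually.of_forall fun _ => (Real.exp_pos _).le)
  rw [← div_div, Real.sqrt_div (by positivity)] at h2
  have h3 : 1 ≤ 2 * Real.pi := by linarith [Real.pi_gt_three]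
  calc |(offspringPoly ν N ^ m).coeff j| ≤ 2 * Real.pi * |(offspringPoly ν N ^ m).coeff j| :=
        le_mul_of_one_le_left (abs_nonneg _) h3
    _ ≤ _ := by rw [← e]; exact h1.trans h2

lemma norm_cexp_sub_quadratic_le {y : ℝ} (hy : |y| ≤ 1) :
    ‖Complex.exp (y * Complex.I) - 1 - y * Complex.I + y ^ 2 / 2‖ ≤ |y| ^ 3 := by
  have hn : ‖(y * Complex.I : ℂ)‖ = |y| := by simp
  have := Complex.exp_bound (x := y * Complex.I) (by rwa [hn]) (n := 3) (by norm_num)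
  rw [hn] at this
  simp only [Finset.sum_range_succ, Finset.sum_range_zero] at this
  have e : Complex.exp (y * Complex.I) - 1 - y * Complex.I + y ^ 2 / 2 =
      Complex.exp (y * Complex.I) - (0 + (y * Complex.I) ^ 0 / ((0 : ℕ).factorial : ℂ) +
        (y * Complex.I) ^ 1 / ((1 : ℕ).factorial : ℂ) +
        (y * Complex.I) ^ 2 / ((2 : ℕ).factorial : ℂ)) := by
    rw [mul_pow _ _ 2, Complex.I_sq]; simp [Nat.factorial]; ring
  rw [e]
  refine this.trans (mul_le_of_le_one_right (by positivity) ?_)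
  norm_num [Nat.factorial]

lemma tendsto_mul_cexp_sub (x : ℝ) :
    Tendsto (fun m : ℕ => (m : ℂ) * (Complex.exp ((x / √m : ℝ) * Complex.I) - 1 -
      (x / √m : ℝ) * Complex.I)) atTop (nhds (-(x ^ 2 / 2 : ℝ))) := by
  rw [tendsto_iff_norm_sub_tendsto_zero]
  have hs : Tendsto (fun m : ℕ => √(m : ℝ)) atTop atTop :=
    Real.tendsto_sqrt_atTop.comp tendsto_natCast_atTop_atTop
  have hz : Tendsto (fun m : ℕ => |x| ^ 3 / √(m : ℝ)) atTop (nhds 0) :=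
    tendsto_const_nhds.div_atTop hs
  refine squeeze_zero' (Eventually.of_forall fun _ => norm_nonneg _) ?_ hz
  filter_upwards [hs.eventually_ge_atTop (max 1 |x|)] with m hm
  have hm1 : 0 < √(m : ℝ) := lt_of_lt_of_le one_pos ((le_max_left _ _).trans hm)
  have hmm : (m : ℝ) = √(m : ℝ) ^ 2 := (Real.sq_sqrt (Nat.cast_nonneg m)).symm
  have hy : |x / √(m : ℝ)| ≤ 1 := by
    rw [abs_div, abs_of_pos hm1, div_le_one hm1]; exact (le_max_right _ _).trans hm
  have e : (m : ℂ) * (Complex.exp ((x / √m : ℝ) * Complex.I) - 1 - (x / √m : ℝ) * Complex.I) -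
      -(x ^ 2 / 2 : ℝ) = (m : ℝ) * (Complex.exp ((x / √m : ℝ) * Complex.I) - 1 -
      (x / √m : ℝ) * Complex.I + (x / √m : ℝ) ^ 2 / 2) := by
    have h2 : (x : ℂ) ^ 2 = (m : ℝ) * (x / √m : ℝ) ^ 2 := by
      norm_cast
      rw [div_pow, Real.sq_sqrt (Nat.cast_nonneg m)]
      have : (m : ℝ) ≠ 0 := by rw [hmm]; positivity
      field_simp
    push_cast at h2 ⊢
    rw [h2]; ring
  rw [e, norm_mul, Complex.norm_real, Real.norm_eq_abs, abs_of_nonneg (Nat.cast_nonneg m)]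
  refine (mul_le_mul_of_nonneg_left (norm_cexp_sub_quadratic_le hy) (Nat.cast_nonneg m)).trans
    (le_of_eq ?_)
  rw [abs_div, abs_of_pos hm1, div_pow]
  nth_rewrite 1 [hmm]
  field_simp

lemma tendsto_charSum_pow {ν : ℕ → ℝ} {N : ℕ} {a : ℝ}
    (h1 : ∑ k ∈ Finset.range (N + 1), ν k = 1)
    (ha : ∑ k ∈ Finset.range (N + 1), k * ν k = a) (u : ℝ) :
    Tendsto (fun m : ℕ => (charSum ν N (u / √m) *
      Complex.exp ((-a * (u / √m) : ℝ) * Complex.I)) ^ m) atTop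
      (nhds (Complex.exp (-((∑ k ∈ Finset.range (N + 1), ν k * (k - a) ^ 2) * u ^ 2 / 2 : ℝ)))) := by
  set g : ℕ → ℂ := fun m => ∑ k ∈ Finset.range (N + 1), (ν k : ℂ) *
    (Complex.exp (((k - a) * u / √m : ℝ) * Complex.I) - 1 - ((k - a) * u / √m : ℝ) * Complex.I)
    with hg
  have e : ∀ m : ℕ, charSum ν N (u / √m) * Complex.exp ((-a * (u / √m) : ℝ) * Complex.I) =
      1 + g m := by
    intro m
    have h1' : ∑ k ∈ Finset.range (N + 1), (ν k : ℂ) = 1 := by exact_mod_cast h1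
    have h2 : ∑ k ∈ Finset.range (N + 1), (ν k : ℂ) * (((k - a) * u / √m : ℝ) * Complex.I) = 0 := by
      have : ∑ k ∈ Finset.range (N + 1), ν k * ((k - a) * u / √m) =
          ((∑ k ∈ Finset.range (N + 1), k * ν k) - a * ∑ k ∈ Finset.range (N + 1), ν k) *
            (u / √m) := by
        rw [Finset.mul_sum, ← Finset.sum_sub_distrib, Finset.sum_mul]
        exact Finset.sum_congr rfl fun k _ => by ring
      rw [ha, h1, mul_one, sub_self, zero_mul] at this
      simp_rw [← mul_assoc, ← Finset.sum_mul]
      exact_mod_cast (by rw [this]; simp : ((∑ k ∈ Finset.range (N + 1),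
        ν k * ((k - a) * u / √m) : ℝ) : ℂ) * Complex.I = 0)
    rw [hg]
    simp only [mul_sub, Finset.sum_sub_distrib, mul_one, h1', h2, charSum, Finset.sum_mul]
    rw [sub_zero, add_sub_cancel]
    refine Finset.sum_congr rfl fun k _ => ?_
    rw [mul_assoc, ← Complex.exp_add]
    congr 2; push_cast; ring
  simp_rw [e]
  apply Complex.tendsto_one_add_pow_exp_of_tendsto
  have := tendsto_finsetSum (Finset.range (N + 1)) fun k _ =>
    (tendsto_mul_cexp_sub ((k - a) * u)).const_mul (ν k : ℂ)
  convert this using 2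
  · rw [hg, Finset.mul_sum]
    refine Finset.sum_congr rfl fun k _ => ?_
    ring
  · push_cast
    rw [Finset.sum_mul, Finset.sum_div, ← Finset.sum_neg_distrib]
    refine Finset.sum_congr rfl fun k _ => ?_
    ring

lemma coeff_offspringPoly_pow_eq_integral (ν : ℕ → ℝ) (N : ℕ) {a : ℝ} {m j : ℕ} (hm : 1 ≤ m)
    (hj : (j : ℝ) = a * (m - 1)) :
    √m * (2 * Real.pi * ((offspringPoly ν N ^ m).coeff j : ℂ)) =
      ∫ u : ℝ, (Set.Ioc (-(Real.pi * √m)) (Real.pi * √m)).indicator (fun u =>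
        (charSum ν N (u / √m) * Complex.exp ((-a * (u / √m) : ℝ) * Complex.I)) ^ m *
          Complex.exp ((a * (u / √m) : ℝ) * Complex.I)) u := by
  have hπ := Real.pi_pos
  have hm' : 0 < √(m : ℝ) := Real.sqrt_pos.2 (by exact_mod_cast hm)
  rw [MeasureTheory.integral_indicator measurableSet_Ioc, ← intervalIntegral.integral_of_le
    (by nlinarith [mul_pos hπ hm']), coeff_offspringPoly_pow]
  have := intervalIntegral.integral_comp_div (a := -(Real.pi * √(m : ℝ))) (b := Real.pi * √(m : ℝ))
    (fun θ : ℝ => charSum ν N θ ^ m * Complex.exp ((-(j : ℤ) * θ : ℝ) * Complex.I)) hm'.ne'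
  rw [neg_div, mul_div_cancel_right₀ _ hm'.ne'] at this
  rw [← Complex.real_smul, ← this]
  congr 1
  ext u
  rw [mul_pow, ← Complex.exp_nat_mul, mul_assoc, ← Complex.exp_add]
  congr 2
  push_cast
  have : (j : ℂ) = a * (m - 1) := by exact_mod_cast hj
  rw [this]; ring

lemma exists_le_coeff_offspringPoly_pow {ν : ℕ → ℝ} {N : ℕ} {a κ : ℝ} (h0 : ∀ k, 0 ≤ ν k)
    (h1 : ∑ k ∈ Finset.range (N + 1), ν k = 1)
    (ha : ∑ k ∈ Finset.range (N + 1), k * ν k = a) (ha0 : 0 < a) (hν : 0 < ν 0) (hκ : 0 < κ)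
    (h : ∀ θ : ℝ, |θ| ≤ Real.pi → ‖charSum ν N θ‖ ≤ Real.exp (-κ * θ ^ 2)) :
    ∃ c > 0, ∀ᶠ m : ℕ in atTop, ∀ j : ℕ, (j : ℝ) = a * (m - 1) →
      c / √m ≤ (offspringPoly ν N ^ m).coeff j := by
  have hπ := Real.pi_pos
  set V := ∑ k ∈ Finset.range (N + 1), ν k * (k - a) ^ 2 with hV
  have hVpos : 0 < V := by
    refine lt_of_lt_of_le (b := ν 0 * ((0 : ℕ) - a) ^ 2) (by simp; positivity) ?_
    exact Finset.single_le_sum (f := fun k : ℕ => ν k * (k - a) ^ 2)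
      (fun k _ => mul_nonneg (h0 k) (sq_nonneg _)) (Finset.mem_range.2 (Nat.succ_pos N))
  set Φ : ℕ → ℝ → ℂ := fun m => (Set.Ioc (-(Real.pi * √m)) (Real.pi * √m)).indicator (fun u =>
        (charSum ν N (u / √m) * Complex.exp ((-a * (u / √m) : ℝ) * Complex.I)) ^ m *
          Complex.exp ((a * (u / √m) : ℝ) * Complex.I)) with hΦ
  have hs : Tendsto (fun m : ℕ => √(m : ℝ)) atTop atTop :=
    Real.tendsto_sqrt_atTop.comp tendsto_natCast_atTop_atTop
  have hlim : Tendsto (fun m => ∫ u, Φ m u) atTop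
      (nhds (∫ u : ℝ, Complex.exp (-(V * u ^ 2 / 2 : ℝ)))) := by
    refine MeasureTheory.tendsto_integral_filter_of_dominated_convergence
      (fun u => Real.exp (-κ * u ^ 2)) ?_ ?_ (integrable_exp_neg_mul_sq hκ) ?_
    · refine Eventually.of_forall fun m => ?_
      refine (Continuous.aestronglyMeasurable ?_).indicator measurableSet_Ioc
      have := continuous_charSum ν N
      fun_prop
    · filter_upwards [eventually_ge_atTop 1] with m hm
      refine Eventually.of_forall fun u => ?_
      have hm1 : (0 : ℝ) < m := by exact_mod_cast hm
      have hm' : 0 < √(m : ℝ) := Real.sqrt_pos.2 hm1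
      rw [hΦ, norm_indicator_eq_indicator_norm]
      rw [Set.indicator_apply]
      split_ifs with hu
      swap
      · exact (Real.exp_pos _).le
      rw [norm_mul, Complex.norm_exp_ofReal_mul_I, mul_one, norm_pow, norm_mul,
        Complex.norm_exp_ofReal_mul_I, mul_one]
      have hu' : |u / √(m : ℝ)| ≤ Real.pi := by
        rw [abs_div, abs_of_pos hm', div_le_iff₀ hm']
        exact abs_le.2 ⟨hu.1.le, hu.2⟩
      calc ‖charSum ν N (u / √m)‖ ^ m ≤ Real.exp (-κ * (u / √m) ^ 2) ^ m := by
            gcongr; exact h _ hu'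
        _ = _ := by
          rw [← Real.exp_nat_mul, div_pow, Real.sq_sqrt hm1.le]
          congr 1; field_simp
    · refine Eventually.of_forall fun u => ?_
      have hq : Tendsto (fun m : ℕ => Complex.exp ((a * (u / √m) : ℝ) * Complex.I)) atTop
          (nhds 1) := by
        have : Tendsto (fun m : ℕ => a * (u / √(m : ℝ))) atTop (nhds (a * 0)) :=
          (tendsto_const_nhds.div_atTop hs).const_mul a
        have c : Continuous fun y : ℝ => Complex.exp ((y : ℝ) * Complex.I) := by fun_prop
        have := (c.tendsto (a * 0)).comp this
        have e : Complex.exp ((a * 0 : ℝ) * Complex.I) = 1 := by simp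
        rw [e] at this
        exact this
      have := (tendsto_charSum_pow h1 ha u).mul hq
      rw [mul_one] at this
      refine this.congr' ?_
      filter_upwards [hs.eventually_ge_atTop (|u| + 1)] with m hm
      rw [hΦ]
      simp only
      rw [Set.indicator_of_mem]
      have := neg_abs_le u
      have := le_abs_self u
      have := Real.pi_gt_three
      constructor <;> nlinarith [abs_nonneg u]
  have hval : ∫ u : ℝ, Complex.exp (-(V * u ^ 2 / 2 : ℝ)) = (√(Real.pi / (V / 2)) : ℝ) := by
    rw [← integral_gaussian, ← integral_complex_ofReal]
    congr 1; ext u; push_cast; congr 1; ring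
  set I := √(Real.pi / (V / 2)) with hI
  have hIpos : 0 < I := Real.sqrt_pos.2 (by positivity)
  rw [hval] at hlim
  have hre : Tendsto (fun m => (∫ u, Φ m u).re) atTop (nhds I) :=
    (Complex.continuous_re.tendsto _).comp hlim
  refine ⟨I / 2 / (2 * Real.pi), by positivity, ?_⟩
  filter_upwards [hre.eventually_const_le (half_lt_self hIpos), eventually_ge_atTop 1]
    with m hm hm1 j hj
  have hm' : 0 < √(m : ℝ) := Real.sqrt_pos.2 (by exact_mod_cast hm1)
  rw [hΦ, ← coeff_offspringPoly_pow_eq_integral ν N hm1 hj] at hm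
  have e : (√m * (2 * Real.pi * ((offspringPoly ν N ^ m).coeff j : ℂ))).re =
      √m * (2 * Real.pi * (offspringPoly ν N ^ m).coeff j) := by
    rw [← Complex.ofReal_re (√m * (2 * Real.pi * (offspringPoly ν N ^ m).coeff j))]
    push_cast; rfl
  rw [e] at hm
  rw [div_div, div_le_iff₀ (by positivity)]
  linarith

lemma H1.sum_eq_one {μ : ℕ → ℝ} {K : ℕ} (hμ : H1 μ K) : ∑ k ∈ Finset.range (K + 1), μ k = 1 :=
  (hasSum_sum_of_ne_finset_zero fun k hk => hμ.2.2.2.2.2 k (by simpa using hk)).unique hμ.2.1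

lemma H1.sum_mul_eq_one {μ : ℕ → ℝ} {K : ℕ} (hμ : H1 μ K) :
    ∑ k ∈ Finset.range (K + 1), k * μ k = 1 :=
  (hasSum_sum_of_ne_finset_zero fun k hk => by
    rw [hμ.2.2.2.2.2 k (by simpa using hk), mul_zero]).unique hμ.2.2.2.1

lemma H1.pos_zero {μ : ℕ → ℝ} {K : ℕ} (hμ : H1 μ K) : 0 < μ 0 := by
  refine lt_of_le_of_ne (hμ.1 0) fun h0 => hμ.2.2.1 ?_
  have h : ∑ k ∈ Finset.range (K + 1), ((k : ℝ) - 1) * μ k = 0 := by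
    simp only [sub_mul, one_mul, Finset.sum_sub_distrib, hμ.sum_eq_one, hμ.sum_mul_eq_one, sub_self]
  have hz := (Finset.sum_eq_zero_iff_of_nonneg fun k _ => ?_).1 h
  · rw [← hμ.sum_eq_one, ← h0, zero_add]
    refine (Finset.sum_eq_single 1 (fun k hk hk1 => ?_) fun h => ?_).symm
    · rcases Nat.eq_zero_or_pos k with rfl | hk0
      · exact h0.symm
      · refine (mul_eq_zero.1 (hz k hk)).resolve_left ?_
        rw [sub_eq_zero]; exact_mod_cast hk1
    · exact hμ.2.2.2.2.2 1 (by simpa using h)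
  · rcases Nat.eq_zero_or_pos k with rfl | hk0
    · rw [← h0, mul_zero]
    · refine mul_nonneg ?_ (hμ.1 k)
      rw [sub_nonneg]; exact_mod_cast hk0

lemma H1.exists_pos {μ : ℕ → ℝ} {K : ℕ} (hμ : H1 μ K) : ∃ k, k ≠ 0 ∧ 0 < μ k := by
  by_contra! h
  have := hμ.sum_mul_eq_one
  rw [Finset.sum_eq_zero] at this
  · exact zero_ne_one this
  · intro k _
    by_cases hk : k = 0
    · simp [hk]
    · rw [le_antisymm (h k hk) (hμ.1 k), mul_zero]

lemma one_sub_cos_add_le (x y : ℝ) :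
    1 - Real.cos (x + y) ≤ 2 * (1 - Real.cos x) + 2 * (1 - Real.cos y) := by
  have h : ∀ z : ℝ, 1 - Real.cos z = 2 * Real.sin (z / 2) ^ 2 := by
    intro z
    have := Real.cos_sq' (z / 2)
    have h2 := Real.cos_two_mul (z / 2)
    rw [show 2 * (z / 2) = z by ring] at h2
    rw [h2, this]; ring
  rw [h, h, h, add_div, Real.sin_add]
  have h1 := Real.sin_sq_add_cos_sq (x / 2)
  have h2 := Real.sin_sq_add_cos_sq (y / 2)
  set a := Real.sin (x / 2); set b := Real.cos (x / 2)
  set c := Real.sin (y / 2); set d := Real.cos (y / 2)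
  have h3 : (a * d + b * c) ^ 2 ≤ 2 * (a * d) ^ 2 + 2 * (b * c) ^ 2 := by
    nlinarith [sq_nonneg (a * d - b * c)]
  have h4 : (a * d) ^ 2 ≤ a ^ 2 := by
    rw [mul_pow]; exact mul_le_of_le_one_right (sq_nonneg _) (by nlinarith [sq_nonneg c])
  have h5 : (b * c) ^ 2 ≤ c ^ 2 := by
    rw [mul_pow]; exact mul_le_of_le_one_left (sq_nonneg _) (by nlinarith [sq_nonneg a])
  linarith

/-- The frequencies whose characteristic function is controlled by the one of `μ`. -/
def frequencyGroup (μ : ℕ → ℝ) (K : ℕ) : AddSubgroup ℤ where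
  carrier := {a | ∃ C, 0 ≤ C ∧ ∀ θ : ℝ, 1 - Real.cos (a * θ) ≤
    C * ∑ k ∈ Finset.range (K + 1), μ k * (1 - Real.cos (k * θ))}
  zero_mem' := ⟨0, le_rfl, fun θ => by simp⟩
  add_mem' := by
    rintro a b ⟨C, hC, h⟩ ⟨D, hD, h'⟩
    refine ⟨2 * C + 2 * D, by positivity, fun θ => ?_⟩
    push_cast
    rw [add_mul]
    refine (one_sub_cos_add_le _ _).trans ?_
    have := h θ
    have := h' θ
    rw [add_mul]; linarith
  neg_mem' := by
    rintro a ⟨C, hC, h⟩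
    refine ⟨C, hC, fun θ => ?_⟩
    push_cast
    rw [neg_mul, Real.cos_neg]; exact h θ

lemma mem_frequencyGroup {μ : ℕ → ℝ} {K : ℕ} (h0 : ∀ k, 0 ≤ μ k) (hK : ∀ k, K < k → μ k = 0)
    {k : ℕ} (hk : 0 < μ k) : (k : ℤ) ∈ frequencyGroup μ K := by
  refine ⟨(μ k)⁻¹, by positivity, fun θ => ?_⟩
  rw [le_inv_mul_iff₀ hk]
  refine Finset.single_le_sum (f := fun k : ℕ => μ k * (1 - Real.cos (k * θ)))
    (fun i _ => mul_nonneg (h0 i) (by linarith [Real.cos_le_one (i * θ)])) ?_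
  by_contra h
  exact hk.ne' (hK k (by simpa using h))

lemma exists_span {μ : ℕ → ℝ} {K : ℕ} (hμ : H1 μ K) : ∃ d : ℕ, 0 < d ∧ (∀ k, ¬ d ∣ k → μ k = 0) ∧
    ∃ c > 0, ∀ θ : ℝ, c * (1 - Real.cos (d * θ)) ≤
      ∑ k ∈ Finset.range (K + 1), μ k * (1 - Real.cos (k * θ)) := by
  obtain ⟨a, ha⟩ := Int.subgroup_cyclic (frequencyGroup μ K)
  have hdvd : ∀ k, 0 < μ k → a.natAbs ∣ k := by
    intro k hk
    have := mem_frequencyGroup hμ.1 hμ.2.2.2.2.2 hk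
    rw [ha, AddSubgroup.mem_closure_singleton] at this
    obtain ⟨n, hn⟩ := this
    rw [← Int.natCast_dvd_natCast, Int.natAbs_dvd]
    exact ⟨n, by rw [← hn, smul_eq_mul, mul_comm]⟩
  have hmem : ((a.natAbs : ℕ) : ℤ) ∈ frequencyGroup μ K := by
    have : a ∈ frequencyGroup μ K := by rw [ha]; exact AddSubgroup.subset_closure rfl
    rcases Int.natAbs_eq a with h | h
    · rwa [← h]
    · rw [eq_comm, neg_eq_iff_eq_neg] at h
      rw [h]; exact neg_mem this
  obtain ⟨k, hk0, hk⟩ := hμ.exists_pos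
  obtain ⟨C, hC, h⟩ := hmem
  refine ⟨a.natAbs, Nat.pos_of_ne_zero fun h0 => ?_, fun k hk => ?_, (C + 1)⁻¹, by positivity,
    fun θ => ?_⟩
  · have := hdvd k hk
    rw [h0, zero_dvd_iff] at this
    exact hk0 this
  · by_contra h'
    exact hk (hdvd k (lt_of_le_of_ne (hμ.1 k) (Ne.symm h')))
  · rw [inv_mul_le_iff₀ (by positivity)]
    have hF : 0 ≤ ∑ k ∈ Finset.range (K + 1), μ k * (1 - Real.cos (k * θ)) :=
      Finset.sum_nonneg fun i _ => mul_nonneg (hμ.1 i) (by linarith [Real.cos_le_one (i * θ)])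
    have := h θ
    rw [Int.cast_natCast] at this
    linarith

lemma coeff_offspringPoly {μ : ℕ → ℝ} {K : ℕ} (hK : ∀ k, K < k → μ k = 0) (n : ℕ) :
    (offspringPoly μ K).coeff n = μ n := by
  have := coeff_offspringPoly_mul μ K 1 n
  rw [mul_one] at this
  rw [this]
  by_cases hn : n ≤ K
  · rw [Finset.sum_eq_single n]
    · simp
    · intro k _ hk
      split_ifs
      · rw [Polynomial.coeff_one, if_neg (by omega), mul_zero]
      · rw [mul_zero]
    · intro h; exact absurd (Finset.mem_range.2 (by omega)) h
  · rw [hK n (by omega)]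
    refine Finset.sum_eq_zero fun k hk => ?_
    rw [Finset.mem_range] at hk
    rw [if_pos (by omega), Polynomial.coeff_one, if_neg (by omega), mul_zero]

lemma offspringPoly_eq_expand {μ : ℕ → ℝ} {K d : ℕ} (hK : ∀ k, K < k → μ k = 0) (hd : 0 < d)
    (h : ∀ k, ¬ d ∣ k → μ k = 0) :
    offspringPoly μ K = Polynomial.expand ℝ d (offspringPoly (fun k => μ (d * k)) K) := by
  ext n
  rw [Polynomial.coeff_expand hd, coeff_offspringPoly hK,
    coeff_offspringPoly fun k hk => hK _ (lt_of_lt_of_le hk (Nat.le_mul_of_pos_left k hd))]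
  split_ifs with hn
  · rw [Nat.mul_div_cancel' hn]
  · exact h n hn

lemma sum_dilate {μ : ℕ → ℝ} {K d : ℕ} (hK : ∀ k, K < k → μ k = 0) (hd : 0 < d)
    (h : ∀ k, ¬ d ∣ k → μ k = 0) (f : ℕ → ℝ) :
    ∑ k ∈ Finset.range (K + 1), μ (d * k) * f (d * k) = ∑ k ∈ Finset.range (K + 1), μ k * f k := by
  have h1 : ∑ k ∈ Finset.range (K + 1), μ k * f k = ∑ k ∈ Finset.range (d * K + 1), μ k * f k := by
    refine Finset.sum_subset (Finset.range_mono ?_) fun k _ hk => ?_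
    · have := Nat.le_mul_of_pos_left K hd; omega
    · rw [hK k (by simpa using hk), zero_mul]
  rw [h1]
  refine Finset.sum_of_injOn (fun k => d * k) ?_ ?_ ?_ fun _ _ => rfl
  · intro x _ y _ hxy
    exact Nat.eq_of_mul_eq_mul_left hd hxy
  · intro k hk
    simp only [Finset.coe_range, Set.mem_Iio, Nat.lt_succ_iff] at hk ⊢
    exact Nat.mul_le_mul_left d hk
  · intro k hk hk'
    by_cases hdk : d ∣ k
    · obtain ⟨r, rfl⟩ := hdk
      exfalso; apply hk'
      refine ⟨r, ?_, rfl⟩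
      simp only [Finset.mem_range, Nat.lt_succ_iff] at hk
      simpa [Nat.lt_succ_iff] using Nat.le_of_mul_le_mul_left hk hd
    · rw [h k hdk, zero_mul]

lemma exists_coeff_offspringPoly_bounds {μ : ℕ → ℝ} {K : ℕ} (hμ : H1 μ K) :
    (∃ C > 0, ∀ m j : ℕ, 1 ≤ m → (offspringPoly μ K ^ m).coeff j ≤ C / √m) ∧
    ∃ c > 0, ∀ᶠ m : ℕ in atTop, (offspringPoly μ K ^ m).coeff (m - 1) = 0 ∨
      c / √m ≤ (offspringPoly μ K ^ m).coeff (m - 1) := by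
  obtain ⟨d, hd, hdvd, c, hc, hap⟩ := exists_span hμ
  have hK := hμ.2.2.2.2.2
  have hd' : (0 : ℝ) < d := by exact_mod_cast hd
  set ν : ℕ → ℝ := fun k => μ (d * k) with hν
  have hν0 : 0 < ν 0 := by simpa [hν] using hμ.pos_zero
  have hνn : ∀ k, 0 ≤ ν k := fun k => hμ.1 _
  have h1 : ∑ k ∈ Finset.range (K + 1), ν k = 1 := by
    have := sum_dilate hK hd hdvd fun _ => 1
    simp only [mul_one] at this
    rw [← hμ.sum_eq_one, ← this]
  have ha : ∑ k ∈ Finset.range (K + 1), k * ν k = 1 / d := by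
    have := sum_dilate hK hd hdvd fun k => k
    rw [eq_div_iff hd'.ne', ← hμ.sum_mul_eq_one, Finset.sum_mul]
    simp_rw [mul_comm _ (μ _)]
    rw [← this]
    refine Finset.sum_congr rfl fun k _ => ?_
    push_cast; ring
  have hap' : ∀ θ : ℝ, c * (1 - Real.cos θ) ≤
      ∑ k ∈ Finset.range (K + 1), ν k * (1 - Real.cos (k * θ)) := by
    intro θ
    have h2 := hap (θ / d)
    rw [mul_div_cancel₀ _ hd'.ne', ← sum_dilate hK hd hdvd fun k => 1 - Real.cos (k * (θ / d))] at h2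
    refine h2.trans (le_of_eq (Finset.sum_congr rfl fun k _ => ?_))
    congr 3; push_cast; field_simp
  set κ := 2 * ν 0 * c / Real.pi ^ 2 with hκ
  have hκ0 : 0 < κ := by have := Real.pi_pos; positivity
  have hb : ∀ θ : ℝ, |θ| ≤ Real.pi → ‖charSum ν K θ‖ ≤ Real.exp (-κ * θ ^ 2) := fun θ hθ =>
    norm_charSum_le hνn h1 hc.le hap' hθ
  have hexp : ∀ m j : ℕ, (offspringPoly μ K ^ m).coeff j =
      if d ∣ j then (offspringPoly ν K ^ m).coeff (j / d) else 0 := by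
    intro m j
    rw [offspringPoly_eq_expand hK hd hdvd, ← map_pow, Polynomial.coeff_expand hd]
  refine ⟨⟨√(Real.pi / κ), Real.sqrt_pos.2 (by have := Real.pi_pos; positivity), ?_⟩, ?_⟩
  · intro m j hm
    rw [hexp]
    split_ifs
    · exact (le_abs_self _).trans (abs_coeff_offspringPoly_pow_le hκ0 hb m _ hm)
    · positivity
  · obtain ⟨c', hc', h⟩ := exists_le_coeff_offspringPoly_pow hνn h1 ha (by positivity) hν0 hκ0 hb
    refine ⟨c', hc', ?_⟩
    filter_upwards [h, eventually_ge_atTop 1] with m hm hm1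
    rw [hexp]
    split_ifs with hdm
    · right
      refine hm _ ?_
      rw [Nat.cast_div hdm hd'.ne', Nat.cast_sub hm1]
      push_cast; ring
    · left; rfl

lemma forestWeight_nonneg {μ : ℕ → ℝ} (h : ∀ k, 0 ≤ μ k) (c : BinaryTree Unit) :
    0 ≤ forestWeight μ c := by
  induction c with
  | nil => simp [forestWeight]
  | node a c r ih ih' => simp only [forestWeight]; have := h (rootCount c); positivity

lemma coeff_treeSeries_pow_nonneg {μ : ℕ → ℝ} (h : ∀ k, 0 ≤ μ k) (L m : ℕ) :
    0 ≤ PowerSeries.coeff m (treeSeries μ ^ L) := by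
  rw [← sum_forestWeight]
  refine Finset.sum_nonneg fun c _ => ?_
  split_ifs
  · exact forestWeight_nonneg h c
  · exact le_rfl

lemma exists_coeff_treeSeries_pow_le {μ : ℕ → ℝ} {K : ℕ} (hμ : H1 μ K) :
    ∃ C > 0, ∀ L m : ℕ, 1 ≤ m →
      PowerSeries.coeff m (treeSeries μ ^ L) ≤ C * L / (m * √m) := by
  obtain ⟨⟨C, hC, h⟩, -⟩ := exists_coeff_offspringPoly_bounds hμ
  refine ⟨C, hC, fun L m hm => ?_⟩
  have hm' : (0 : ℝ) < m := by exact_mod_cast hm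
  have hs : 0 < √(m : ℝ) := Real.sqrt_pos.2 hm'
  have := mul_coeff_treeSeries_pow hμ.2.2.2.2.2 m L
  have h2 : (m : ℝ) * PowerSeries.coeff m (treeSeries μ ^ L) ≤ L * (C / √m) := by
    rw [this]
    gcongr
    split_ifs
    · exact h m _ hm
    · positivity
  rw [le_div_iff₀ (by positivity)]
  have h3 : L * (C / √m) = C * L / √m := by ring
  rw [h3, le_div_iff₀ hs] at h2
  linarith

lemma exists_le_coeff_treeSeries {μ : ℕ → ℝ} {K : ℕ} (hμ : H1 μ K) :
    ∃ c > 0, ∀ᶠ n : ℕ in atTop, PowerSeries.coeff (n + 1) (treeSeries μ) = 0 ∨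
      c / (n * √n) ≤ PowerSeries.coeff (n + 1) (treeSeries μ) := by
  obtain ⟨-, c, hc, h⟩ := exists_coeff_offspringPoly_bounds hμ
  refine ⟨c / 4, by positivity, ?_⟩
  filter_upwards [(tendsto_add_atTop_nat 1).eventually h, eventually_ge_atTop 1] with n hn hn1
  have h2 := mul_coeff_treeSeries_pow hμ.2.2.2.2.2 (n + 1) 1
  rw [if_pos (by omega), pow_one] at h2
  rcases hn with hn | hn
  · left
    rw [hn, mul_zero] at h2
    exact (mul_eq_zero.1 h2).resolve_left (by positivity)
  · right
    have hn0 : (1 : ℝ) ≤ n := by exact_mod_cast hn1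
    have hsn : 0 < √(n : ℝ) := Real.sqrt_pos.2 (by linarith)
    have hsn1 : √((n + 1 : ℕ) : ℝ) ≤ 2 * √n := by
      rw [Real.sqrt_le_left (by positivity), mul_pow, Real.sq_sqrt (by linarith)]
      push_cast; linarith
    rw [Nat.cast_one, one_mul] at h2
    rw [← h2, div_le_iff₀ (Real.sqrt_pos.2 (by positivity))] at hn
    have hq : 0 ≤ PowerSeries.coeff (n + 1) (treeSeries μ) := by
      have := coeff_treeSeries_pow_nonneg hμ.1 1 (n + 1)
      rwa [pow_one] at this
    rw [div_le_iff₀ (by positivity)]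
    have h3 : ((n + 1 : ℕ) : ℝ) * PowerSeries.coeff (n + 1) (treeSeries μ) * √((n + 1 : ℕ) : ℝ) ≤
        (2 * n) * PowerSeries.coeff (n + 1) (treeSeries μ) * (2 * √n) := by
      gcongr
      push_cast; linarith
    linarith

lemma index_of_mem_lineages {c : BinaryTree Unit} {k i : ℕ} {s : List (ℕ × ℕ)}
    (h : s ∈ lineages c k i) (hi : 1 ≤ i) (hk : i + rootCount c ≤ k + 1) :
    ∀ p ∈ s, 1 ≤ p.2 ∧ p.2 ≤ p.1 := by
  induction c generalizing k i s with
  | nil => simp [lineages] at h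
  | node a c r ihc ihr =>
    simp only [rootCount] at hk
    simp only [lineages, List.mem_cons, List.mem_append, List.mem_map] at h
    rcases h with rfl | ⟨t, ht, rfl⟩ | h
    · simp only [List.mem_singleton, forall_eq]
      omega
    · intro p hp
      rcases List.mem_cons.1 hp with rfl | hp
      · simp only
        omega
      · exact ihc ht le_rfl (by omega) p hp
    · exact ihr h (by omega) (by omega)

lemma offspring_ne_zero_of_mem_lineages {μ : ℕ → ℝ} {c : BinaryTree Unit} {k i : ℕ}
    {s : List (ℕ × ℕ)} (hw : forestWeight μ c ≠ 0) (h : s ∈ lineages c k i) :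
    ∀ p ∈ s, p.1 = k ∨ μ p.1 ≠ 0 := by
  induction c generalizing k i s with
  | nil => simp [lineages] at h
  | node a c r ihc ihr =>
    simp only [forestWeight, ne_eq, mul_eq_zero, not_or] at hw
    simp only [lineages, List.mem_cons, List.mem_append, List.mem_map] at h
    rcases h with rfl | ⟨t, ht, rfl⟩ | h
    · simp
    · intro p hp
      rcases List.mem_cons.1 hp with rfl | hp
      · exact Or.inl rfl
      · rcases ihc hw.1.2 ht p hp with h1 | h1
        · exact Or.inr (h1 ▸ hw.1.1)
        · exact Or.inr h1
    · exact ihr hw.2 h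

lemma mem_IKfin {K : ℕ} {p : ℕ × ℕ} : p ∈ IKfin K ↔ (1 ≤ p.2 ∧ p.2 ≤ p.1) ∧ p.1 ≤ K := by
  simp only [IKfin, Finset.mem_filter, Finset.mem_product, Finset.mem_range]
  omega

lemma mem_IKfin_of_mem_treeLineages {μ : ℕ → ℝ} {K : ℕ} (hK : ∀ k, K < k → μ k = 0)
    {c : BinaryTree Unit} (hw : μ (rootCount c) * forestWeight μ c ≠ 0) {s : List (ℕ × ℕ)}
    (h : s ∈ treeLineages c) : ∀ p ∈ s, p ∈ IKfin K := by
  intro p hp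
  rcases List.mem_cons.1 h with rfl | h
  · simp at hp
  refine mem_IKfin.2 ⟨index_of_mem_lineages h le_rfl (by omega) p hp, ?_⟩
  have hne : μ p.1 ≠ 0 := by
    rcases offspring_ne_zero_of_mem_lineages (right_ne_zero_of_mul hw) h p hp with h1 | h1
    · exact h1 ▸ left_ne_zero_of_mul hw
    · exact h1
  by_contra hlt
  exact hne (hK _ (not_le.1 hlt))

/-- The lists of length `h` with entries in `I_K`. -/
def lineageSet (K : ℕ) : ℕ → Finset (List (ℕ × ℕ))
  | 0 => {[]}
  | h + 1 => (IKfin K ×ˢ lineageSet K h).image fun p => p.1 :: p.2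

lemma mem_lineageSet {K h : ℕ} {σ : List (ℕ × ℕ)} :
    σ ∈ lineageSet K h ↔ σ.length = h ∧ ∀ p ∈ σ, p ∈ IKfin K := by
  induction h generalizing σ with
  | zero =>
    simp only [lineageSet, Finset.mem_singleton, List.length_eq_zero_iff]
    constructor
    · rintro rfl
      simp
    · exact fun h => h.1
  | succ h ih =>
    simp only [lineageSet, Finset.mem_image, Finset.mem_product, Prod.exists]
    constructor
    · rintro ⟨a, b, t, ⟨hp, ht⟩, rfl⟩
      rw [ih] at ht
      refine ⟨by simp [ht.1], fun q hq => ?_⟩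
      rcases List.mem_cons.1 hq with rfl | hq
      · exact hp
      · exact ht.2 q hq
    · rintro ⟨hl, hm⟩
      cases σ with
      | nil => simp at hl
      | cons q t =>
        exact ⟨q.1, q.2, t, ⟨hm q (by simp), ih.2 ⟨by simpa using hl,
          fun r hr => hm r (by simp [hr])⟩⟩, rfl⟩

/-- The sum of `F` over the lists of length `h`, weighted by the offspring laws of the entries. -/
def lineageSum (μ : ℕ → ℝ) (K h : ℕ) (F : List (ℕ × ℕ) → ℝ) : ℝ :=
  ∑ σ ∈ lineageSet K h, lineageWeight μ σ * F σ

lemma lineageSum_zero (μ : ℕ → ℝ) (K : ℕ) (F : List (ℕ × ℕ) → ℝ) :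
    lineageSum μ K 0 F = F [] := by
  simp [lineageSum, lineageSet, lineageWeight]

lemma lineageSum_succ (μ : ℕ → ℝ) (K h : ℕ) (F : List (ℕ × ℕ) → ℝ) :
    lineageSum μ K (h + 1) F =
      ∑ p ∈ IKfin K, μ p.1 * lineageSum μ K h fun σ => F (p :: σ) := by
  rw [lineageSum, lineageSet, Finset.sum_image, Finset.sum_product]
  · refine Finset.sum_congr rfl fun p _ => ?_
    rw [lineageSum, Finset.mul_sum]
    refine Finset.sum_congr rfl fun σ _ => ?_
    simp [lineageWeight, mul_assoc]
  · rintro ⟨a, b⟩ _ ⟨a', b'⟩ _ h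
    simpa using h

lemma lineageWeight_nonneg {μ : ℕ → ℝ} (h : ∀ k, 0 ≤ μ k) (σ : List (ℕ × ℕ)) :
    0 ≤ lineageWeight μ σ :=
  List.prod_nonneg fun x hx => by
    obtain ⟨p, _, rfl⟩ := List.mem_map.1 hx
    exact h _

lemma lineageSum_reverse (μ : ℕ → ℝ) (K h : ℕ) (F : List (ℕ × ℕ) → ℝ) :
    lineageSum μ K h (fun σ => F σ.reverse) = lineageSum μ K h F := by
  refine Finset.sum_nbij' List.reverse List.reverse ?_ ?_ ?_ ?_ ?_
  · intro σ hσ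
    simpa [mem_lineageSet] using hσ
  · intro σ hσ
    simpa [mem_lineageSet] using hσ
  · simp
  · simp
  · intro σ _
    simp [lineageWeight, List.map_reverse, List.prod_reverse]

lemma lineageSum_le {μ : ℕ → ℝ} (h0 : ∀ k, 0 ≤ μ k) {K h : ℕ} {F G : List (ℕ × ℕ) → ℝ}
    (hFG : ∀ σ ∈ lineageSet K h, F σ ≤ G σ) : lineageSum μ K h F ≤ lineageSum μ K h G :=
  Finset.sum_le_sum fun σ hσ => mul_le_mul_of_nonneg_left (hFG σ hσ) (lineageWeight_nonneg h0 σ)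

lemma lineageSum_mul_const (μ : ℕ → ℝ) (K h : ℕ) (F : List (ℕ × ℕ) → ℝ) (C : ℝ) :
    lineageSum μ K h (fun σ => F σ * C) = lineageSum μ K h F * C := by
  simp only [lineageSum, Finset.sum_mul, mul_assoc]

/-- The lineage of the vertex of index `l`. -/
def lineageAt (c : BinaryTree Unit) (l : ℕ) : List (ℕ × ℕ) := (treeLineages c).getD l []

lemma sum_lineageAt {μ : ℕ → ℝ} {K : ℕ} (hK : ∀ k, K < k → μ k = 0)
    {n l H : ℕ} (hl : l ≤ n) (F : List (ℕ × ℕ) → ℝ) :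
    ∑ c ∈ BinaryTree.treesOfNumNodesEq n, μ (rootCount c) * forestWeight μ c *
        (if (lineageAt c l).length ≤ H then F (lineageAt c l) else 0) =
      ∑ h ∈ Finset.range (H + 1), lineageSum μ K h fun σ =>
        F σ * spineCoeff μ h (leftCount σ) (rightCount σ + 1) l (n + 1 - l) := by
  have key : ∀ c ∈ BinaryTree.treesOfNumNodesEq n,
      μ (rootCount c) * forestWeight μ c *
        (if (lineageAt c l).length ≤ H then F (lineageAt c l) else 0) =
      ∑ h ∈ Finset.range (H + 1), ∑ σ ∈ lineageSet K h,
        (if (treeLineages c)[l]? = some σ then μ (rootCount c) * forestWeight μ c else 0) * F σ := by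
    intro c hc
    by_cases hw : μ (rootCount c) * forestWeight μ c = 0
    · simp [hw]
    have hlen : l < (treeLineages c).length := by
      rw [length_treeLineages, BinaryTree.mem_treesOfNumNodesEq.1 hc]
      omega
    have hsome : (treeLineages c)[l]? = some (lineageAt c l) := by
      simp [lineageAt, List.getD, hlen]
    have hmem : lineageAt c l ∈ treeLineages c := List.mem_of_getElem? hsome
    have hIK := mem_IKfin_of_mem_treeLineages hK hw hmem
    simp only [hsome, Option.some.injEq, ite_mul, zero_mul]
    simp only [Finset.sum_ite_eq, mem_lineageSet]
    have hP : ∀ h, ((lineageAt c l).length = h ∧ ∀ p ∈ lineageAt c l, p ∈ IKfin K) ↔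
        (lineageAt c l).length = h := fun h => ⟨fun h => h.1, fun h => ⟨h, hIK⟩⟩
    simp only [hP, Finset.sum_ite_eq, Finset.mem_range, Nat.lt_succ_iff, mul_ite, mul_zero]
  rw [Finset.sum_congr rfl key, Finset.sum_comm]
  refine Finset.sum_congr rfl fun h _ => ?_
  rw [Finset.sum_comm]
  refine Finset.sum_congr rfl fun σ hσ => ?_
  rw [mem_lineageSet] at hσ
  rw [← Finset.sum_mul, sum_marked_tree μ σ (fun p hp => (mem_IKfin.1 (hσ.2 p hp)).1) l (n + 1 - l)
    n (by omega) (by omega), hσ.1]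
  ring

lemma leftCount_le {K h : ℕ} {σ : List (ℕ × ℕ)} (hσ : σ ∈ lineageSet K h) :
    leftCount σ ≤ h * K ∧ rightCount σ ≤ h * K := by
  rw [mem_lineageSet] at hσ
  rw [leftCount, rightCount, ← hσ.1]
  constructor
  · refine (List.sum_le_card_nsmul _ K ?_).trans (by simp)
    intro x hx
    obtain ⟨p, hp, rfl⟩ := List.mem_map.1 hx
    have := mem_IKfin.1 (hσ.2 p hp)
    omega
  · refine (List.sum_le_card_nsmul _ K ?_).trans (by simp)
    intro x hx
    obtain ⟨p, hp, rfl⟩ := List.mem_map.1 hx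
    have := mem_IKfin.1 (hσ.2 p hp)
    omega

/-- Upper bound for the number of ways to complete a spine of length `h`. -/
lemma spineCoeff_le {μ : ℕ → ℝ} {K : ℕ} (h0 : ∀ k, 0 ≤ μ k) {C : ℝ} (hC : 0 < C)
    (hQ : ∀ L m : ℕ, 1 ≤ m → PowerSeries.coeff m (treeSeries μ ^ L) ≤ C * L / (m * √m))
    {h l b : ℕ} {σ : List (ℕ × ℕ)} (hσ : σ ∈ lineageSet K h) (hl : 1 ≤ l) (hb : 1 ≤ b)
    (hh : 2 * h ≤ l) :
    spineCoeff μ h (leftCount σ) (rightCount σ + 1) l b ≤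
      3 * C ^ 2 * (h * K) * (h * K + 1) / (l * √l * (b * √b)) := by
  obtain ⟨hL, hR⟩ := leftCount_le hσ
  have hL' : (leftCount σ : ℝ) ≤ h * K := by exact_mod_cast hL
  have hR' : ((rightCount σ + 1 : ℕ) : ℝ) ≤ h * K + 1 := by
    push_cast
    exact add_le_add_left (by exact_mod_cast hR) 1
  have hlpos : (0 : ℝ) < l := by exact_mod_cast hl
  have hbpos : (0 : ℝ) < b := by exact_mod_cast hb
  have h1 : PowerSeries.coeff l (PowerSeries.X ^ h * treeSeries μ ^ leftCount σ) ≤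
      3 * C * (h * K) / (l * √l) := by
    rw [PowerSeries.coeff_X_pow_mul', if_pos (by omega)]
    refine (hQ _ (l - h) (by omega)).trans ?_
    have hsub : (l : ℝ) / 2 ≤ ((l - h : ℕ) : ℝ) := by
      have : (l : ℝ) ≤ 2 * ((l - h : ℕ) : ℝ) := by exact_mod_cast (by omega : l ≤ 2 * (l - h))
      linarith
    have hpos : (0 : ℝ) < ((l - h : ℕ) : ℝ) := by linarith
    have hs : √(l : ℝ) ≤ 3 / 2 * √((l - h : ℕ) : ℝ) := by
      rw [Real.sqrt_le_left (by positivity), mul_pow, Real.sq_sqrt hpos.le]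
      linarith
    have hmul : (l : ℝ) * √l ≤ 3 * (((l - h : ℕ) : ℝ) * √((l - h : ℕ) : ℝ)) := by
      calc (l : ℝ) * √l ≤ (2 * ((l - h : ℕ) : ℝ)) * (3 / 2 * √((l - h : ℕ) : ℝ)) :=
            mul_le_mul (by linarith) hs (Real.sqrt_nonneg _) (by positivity)
        _ = _ := by ring
    have hs2 : 0 < √(l : ℝ) := Real.sqrt_pos.2 hlpos
    have hs3 : 0 < √((l - h : ℕ) : ℝ) := Real.sqrt_pos.2 hpos
    rw [div_le_div_iff₀ (by positivity) (by positivity)]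
    calc C * (leftCount σ : ℝ) * (l * √l)
        ≤ C * (h * K) * (3 * (((l - h : ℕ) : ℝ) * √((l - h : ℕ) : ℝ))) :=
          mul_le_mul (mul_le_mul_of_nonneg_left hL' hC.le) hmul (by positivity) (by positivity)
      _ = _ := by ring
  have h2 : PowerSeries.coeff b (treeSeries μ ^ (rightCount σ + 1)) ≤
      C * (h * K + 1) / (b * √b) :=
    (hQ _ b hb).trans (by gcongr)
  rw [spineCoeff]
  refine (mul_le_mul h1 h2 (coeff_treeSeries_pow_nonneg h0 _ _) (by positivity)).trans_eq ?_
  rw [div_mul_div_comm]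
  ring

/-- The running maximum, over the first `D` steps of the walk with steps `w` along a list, of
`cosh (θ z)`, where `z` is the position of the walk. -/
def maxCosh (w : ℕ × ℕ → ℝ) (θ : ℝ) : List (ℕ × ℕ) → ℕ → ℝ → ℝ → ℝ
  | _, 0, _, M => M
  | [], _ + 1, _, M => M
  | x :: τ, D + 1, z, M => maxCosh w θ τ D (z + w x) (max M (Real.cosh (θ * (z + w x))))

lemma maxCosh_nil (w : ℕ × ℕ → ℝ) (θ : ℝ) (D : ℕ) (z M : ℝ) : maxCosh w θ [] D z M = M := by
  cases D <;> rfl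

lemma maxCosh_zero (w : ℕ × ℕ → ℝ) (θ : ℝ) (τ : List (ℕ × ℕ)) (z M : ℝ) :
    maxCosh w θ τ 0 z M = M := by
  cases τ <;> rfl

lemma le_maxCosh (w : ℕ × ℕ → ℝ) (θ : ℝ) (τ : List (ℕ × ℕ)) (D : ℕ) (z M : ℝ) :
    M ≤ maxCosh w θ τ D z M := by
  induction τ generalizing D z M with
  | nil => rw [maxCosh_nil]
  | cons x τ ih =>
    cases D with
    | zero => rw [maxCosh_zero]
    | succ D => exact (le_max_left _ _).trans (ih D _ _)

lemma cosh_le_maxCosh (w : ℕ × ℕ → ℝ) (θ : ℝ) (τ : List (ℕ × ℕ)) (D d : ℕ) (hd : d ≤ D)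
    (z M : ℝ) (hM : Real.cosh (θ * z) ≤ M) :
    Real.cosh (θ * (z + ((τ.take d).map w).sum)) ≤ maxCosh w θ τ D z M := by
  induction τ generalizing D d z M with
  | nil => simpa [maxCosh_nil] using hM
  | cons x τ ih =>
    cases d with
    | zero => simpa using hM.trans (le_maxCosh _ _ _ _ _ _)
    | succ d =>
      obtain ⟨D, rfl⟩ : ∃ D', D = D' + 1 := ⟨D - 1, by omega⟩
      simpa [maxCosh, add_assoc] using
        ih D d (by omega) (z + w x) (max M (Real.cosh (θ * (z + w x)))) (le_max_right _ _)

lemma sum_mul_exp_bounds {ι : Type*} {s : Finset ι} {p w : ι → ℝ} (hp : ∀ i ∈ s, 0 ≤ p i)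
    (hp1 : ∑ i ∈ s, p i = 1) (hw : ∀ i ∈ s, |w i| ≤ 1) (hw0 : ∑ i ∈ s, p i * w i = 0)
    {a : ℝ} (ha : |a| ≤ 1) :
    1 ≤ ∑ i ∈ s, p i * Real.exp (a * w i) ∧
      ∑ i ∈ s, p i * Real.exp (a * w i) ≤ Real.exp (a ^ 2) := by
  have hlin : ∑ i ∈ s, p i * (a * w i + 1) = 1 := by
    have : ∀ i ∈ s, p i * (a * w i + 1) = a * (p i * w i) + p i := fun i _ => by ring
    rw [Finset.sum_congr rfl this, Finset.sum_add_distrib, ← Finset.mul_sum, hw0, hp1]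
    ring
  constructor
  · rw [← hlin]
    exact Finset.sum_le_sum fun i hi =>
      mul_le_mul_of_nonneg_left (Real.add_one_le_exp _) (hp i hi)
  · have hup : ∀ i ∈ s, p i * Real.exp (a * w i) ≤ p i * (a * w i + 1) + p i * a ^ 2 := by
      intro i hi
      rw [← mul_add]
      refine mul_le_mul_of_nonneg_left ?_ (hp i hi)
      have hle : |a * w i| ≤ 1 := by
        rw [abs_mul]
        exact mul_le_one₀ ha (abs_nonneg _) (hw i hi)
      have h1 := (abs_le.1 (Real.abs_exp_sub_one_sub_id_le hle)).2
      have h2 : w i ^ 2 ≤ 1 := (sq_le_one_iff_abs_le_one _).2 (hw i hi)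
      nlinarith [sq_nonneg a]
    refine (Finset.sum_le_sum hup).trans ?_
    rw [Finset.sum_add_distrib, hlin, ← Finset.sum_mul, hp1, one_mul, add_comm]
    exact Real.add_one_le_exp _

lemma sum_mul_cosh_bounds {ι : Type*} {s : Finset ι} {p w : ι → ℝ} (hp : ∀ i ∈ s, 0 ≤ p i)
    (hp1 : ∑ i ∈ s, p i = 1) (hw : ∀ i ∈ s, |w i| ≤ 1) (hw0 : ∑ i ∈ s, p i * w i = 0)
    {a : ℝ} (ha : |a| ≤ 1) (z : ℝ) :
    Real.cosh (a * z) ≤ ∑ i ∈ s, p i * Real.cosh (a * (z + w i)) ∧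
      ∑ i ∈ s, p i * Real.cosh (a * (z + w i)) ≤ Real.exp (a ^ 2) * Real.cosh (a * z) := by
  have h1 := sum_mul_exp_bounds hp hp1 hw hw0 ha
  have h2 := sum_mul_exp_bounds hp hp1 hw hw0 (a := -a) (by rwa [abs_neg])
  have heq : ∑ i ∈ s, p i * Real.cosh (a * (z + w i)) =
      (Real.exp (a * z) * ∑ i ∈ s, p i * Real.exp (a * w i) +
        Real.exp (-(a * z)) * ∑ i ∈ s, p i * Real.exp (-a * w i)) / 2 := by
    rw [Finset.mul_sum, Finset.mul_sum, ← Finset.sum_add_distrib, Finset.sum_div]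
    refine Finset.sum_congr rfl fun i _ => ?_
    rw [Real.cosh_eq, show a * (z + w i) = a * z + a * w i by ring, Real.exp_add,
      show -(a * z + a * w i) = -(a * z) + -a * w i by ring, Real.exp_add]
    ring
  rw [heq, Real.cosh_eq]
  rw [neg_sq] at h2
  have e1 := Real.exp_pos (a * z)
  have e2 := Real.exp_pos (-(a * z))
  constructor <;> nlinarith [mul_le_mul_of_nonneg_left h1.1 e1.le,
    mul_le_mul_of_nonneg_left h1.2 e1.le, mul_le_mul_of_nonneg_left h2.1 e2.le,
    mul_le_mul_of_nonneg_left h2.2 e2.le]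

lemma lineageSum_maxCosh_sq_le {μ : ℕ → ℝ} {K : ℕ} (h0 : ∀ k, 0 ≤ μ k)
    (h1 : ∑ p ∈ IKfin K, μ p.1 = 1) {w : ℕ × ℕ → ℝ} (hw : ∀ p ∈ IKfin K, |w p| ≤ 1)
    (hw0 : ∑ p ∈ IKfin K, μ p.1 * w p = 0) {θ : ℝ} (hθ : |2 * θ| ≤ 1) (h D : ℕ) (z M : ℝ)
    (hM : Real.cosh (θ * z) ≤ M) :
    lineageSum μ K h (fun τ => maxCosh w θ τ D z M ^ 2) ≤
      4 * Real.exp ((2 * θ) ^ 2 * D) * Real.cosh (2 * θ * z) - 4 * M * Real.cosh (θ * z) +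
        2 * M ^ 2 := by
  have hpos : ∀ D : ℕ, 1 ≤ Real.exp ((2 * θ) ^ 2 * D) := fun D =>
    Real.one_le_exp (by positivity)
  have hsq : Real.cosh (θ * z) ^ 2 ≤ Real.cosh (2 * θ * z) := by
    rw [mul_assoc, Real.cosh_two_mul]
    nlinarith [sq_nonneg (Real.sinh (θ * z))]
  have hbase : M ^ 2 ≤ 4 * Real.exp ((2 * θ) ^ 2 * D) * Real.cosh (2 * θ * z) -
      4 * M * Real.cosh (θ * z) + 2 * M ^ 2 := by
    nlinarith [hpos D, sq_nonneg (2 * Real.cosh (θ * z) - M), Real.cosh_pos (2 * θ * z),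
      mul_le_mul_of_nonneg_right (hpos D) (Real.cosh_pos (2 * θ * z)).le]
  have hθ' : |θ| ≤ 1 := by
    rw [abs_mul, abs_two] at hθ
    linarith [abs_nonneg θ]
  induction h generalizing D z M with
  | zero =>
    rw [lineageSum_zero, maxCosh_nil]
    exact hbase
  | succ h ih =>
    cases D with
    | zero =>
      rw [lineageSum_succ]
      simp only [maxCosh_zero] at ih ⊢
      have hconst : lineageSum μ K h (fun _ => M ^ 2) ≤ M ^ 2 := by
        have : ∀ h, lineageSum μ K h (fun _ => M ^ 2) = M ^ 2 := by
          intro h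
          induction h with
          | zero => rw [lineageSum_zero]
          | succ h ihh =>
            rw [lineageSum_succ]
            simp only [ihh, ← Finset.sum_mul, h1, one_mul]
        exact (this h).le
      rw [← Finset.sum_mul, h1, one_mul]
      exact hconst.trans hbase
    | succ D =>
      rw [lineageSum_succ]
      have hstep : ∀ p ∈ IKfin K,
          μ p.1 * lineageSum μ K h (fun τ => maxCosh w θ (p :: τ) (D + 1) z M ^ 2) ≤
          4 * Real.exp ((2 * θ) ^ 2 * D) * (μ p.1 * Real.cosh (2 * θ * (z + w p))) -
            4 * M * (μ p.1 * Real.cosh (θ * (z + w p))) + μ p.1 * (2 * M ^ 2) := by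
        intro p _
        set X := Real.cosh (θ * (z + w p)) with hX
        have hsq' : X ^ 2 ≤ Real.cosh (2 * θ * (z + w p)) := by
          rw [mul_assoc, Real.cosh_two_mul, ← hX]
          nlinarith [sq_nonneg (Real.sinh (θ * (z + w p)))]
        have hbase' : max M X ^ 2 ≤ 4 * Real.exp ((2 * θ) ^ 2 * D) *
            Real.cosh (2 * θ * (z + w p)) - 4 * max M X * X + 2 * max M X ^ 2 := by
          nlinarith [hpos D, sq_nonneg (2 * X - max M X),
            Real.cosh_pos (2 * θ * (z + w p)),
            mul_le_mul_of_nonneg_right (hpos D) (Real.cosh_pos (2 * θ * (z + w p))).le]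
        have := ih D (z + w p) (max M X) (le_max_right _ _) hsq' hbase'
        have hmax : 2 * max M X ^ 2 - 4 * max M X * X ≤ 2 * M ^ 2 - 4 * M * X := by
          rcases le_total M X with hMX | hMX
          · rw [max_eq_right hMX]
            nlinarith [sq_nonneg (M - X)]
          · rw [max_eq_left hMX]
        have hfin : lineageSum μ K h (fun τ => maxCosh w θ (p :: τ) (D + 1) z M ^ 2) ≤
            4 * Real.exp ((2 * θ) ^ 2 * D) * Real.cosh (2 * θ * (z + w p)) - 4 * M * X +
              2 * M ^ 2 := by
          refine this.trans ?_
          linarith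
        refine (mul_le_mul_of_nonneg_left hfin (h0 p.1)).trans_eq ?_
        ring
      refine (Finset.sum_le_sum hstep).trans ?_
      rw [Finset.sum_add_distrib, Finset.sum_sub_distrib, ← Finset.mul_sum, ← Finset.mul_sum,
        ← Finset.sum_mul, h1]
      have hc1 := (sum_mul_cosh_bounds (fun p _ => h0 p.1) h1 hw hw0 hθ z).2
      have hc2 := (sum_mul_cosh_bounds (fun p _ => h0 p.1) h1 hw hw0 hθ' z).1
      have hMpos : 0 < M := (Real.cosh_pos _).trans_le hM
      have hexp : Real.exp ((2 * θ) ^ 2 * (D + 1 : ℕ)) =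
          Real.exp ((2 * θ) ^ 2 * D) * Real.exp ((2 * θ) ^ 2) := by
        rw [← Real.exp_add]
        push_cast
        ring_nf
      rw [hexp]
      have e := Real.exp_pos ((2 * θ) ^ 2 * D)
      nlinarith [mul_le_mul_of_nonneg_left hc1 e.le, mul_le_mul_of_nonneg_left hc2 hMpos.le]

/-- The centred step of the walk counting the entries equal to `p` along a lineage. -/
def centredStep (μ : ℕ → ℝ) (p x : ℕ × ℕ) : ℝ := (if x = p then 1 else 0) - μ p.1

lemma sum_map_centredStep (μ : ℕ → ℝ) (p : ℕ × ℕ) (σ : List (ℕ × ℕ)) :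
    (σ.map (centredStep μ p)).sum = σ.count p - μ p.1 * σ.length := by
  induction σ with
  | nil => simp
  | cons x σ ih =>
    rw [List.map_cons, List.sum_cons, ih, List.count_cons, List.length_cons, centredStep]
    simp only [beq_iff_eq]
    push_cast
    ring

lemma H1.sum_IKfin {μ : ℕ → ℝ} {K : ℕ} (hμ : H1 μ K) : ∑ p ∈ IKfin K, μ p.1 = 1 := by
  rw [← hμ.sum_mul_eq_one, IKfin, Finset.sum_filter, Finset.sum_product]
  refine Finset.sum_congr rfl fun k hk => ?_
  have hk' := Finset.mem_range.1 hk
  rw [← Finset.sum_filter]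
  simp only [Finset.sum_const, nsmul_eq_mul]
  congr 2
  have : (Finset.range (K + 1)).filter (fun j => 1 ≤ j ∧ j ≤ k) = Finset.Icc 1 k := by
    ext j
    simp only [Finset.mem_filter, Finset.mem_range, Finset.mem_Icc]
    omega
  simp only [this, Nat.card_Icc]
  omega

lemma H1.le_one {μ : ℕ → ℝ} {K : ℕ} (hμ : H1 μ K) (k : ℕ) : μ k ≤ 1 := by
  rcases lt_or_ge K k with h | h
  · rw [hμ.2.2.2.2.2 k h]
    exact zero_le_one
  · rw [← hμ.sum_eq_one]
    exact Finset.single_le_sum (f := μ) (fun i _ => hμ.1 i) (Finset.mem_range.2 (by omega))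

/-- A moment bound, uniform over the starting point, for the increments of the walk counting the
entries equal to `p` along the last entries of a lineage. -/
lemma exists_lineageSum_moment_le {μ : ℕ → ℝ} {K : ℕ} (hμ : H1 μ K) {p : ℕ × ℕ}
    (hp : p ∈ IKfin K) (β : ℕ) {D : ℕ} (hD : 1 ≤ D) :
    ∃ F : List (ℕ × ℕ) → ℝ,
      (∀ σ, 0 ≤ F σ) ∧
      (∀ σ : List (ℕ × ℕ), ∀ d ≤ D, d ≤ σ.length →
        |((σ.drop (σ.length - d)).count p : ℝ) - μ p.1 * d| ^ β ≤ F σ) ∧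
      ∀ h, lineageSum μ K h F ≤ 8 * Real.exp 1 * β.factorial * (2 * √D) ^ β := by
  have hDpos : (0 : ℝ) < D := by exact_mod_cast hD
  have hDsq : 1 ≤ √(D : ℝ) := Real.one_le_sqrt.2 (by exact_mod_cast hD)
  set θ : ℝ := (2 * √(D : ℝ))⁻¹ with hθ
  have hθpos : 0 < θ := by positivity
  have hθ2 : (2 * θ) ^ 2 * D = 1 := by
    rw [hθ, mul_inv, ← mul_assoc, mul_inv_cancel₀ two_ne_zero, one_mul, inv_pow,
      Real.sq_sqrt hDpos.le, inv_mul_cancel₀ hDpos.ne']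
  have hθ1 : |2 * θ| ≤ 1 := by
    rw [abs_of_pos (by positivity), hθ, mul_inv, ← mul_assoc, mul_inv_cancel₀ two_ne_zero, one_mul]
    exact inv_le_one_of_one_le₀ hDsq
  have hw : ∀ x ∈ IKfin K, |centredStep μ p x| ≤ 1 := by
    intro x _
    have h1 := hμ.1 p.1
    have h2 := hμ.le_one p.1
    rw [centredStep, abs_le]
    split_ifs <;> constructor <;> linarith
  have hw0 : ∑ x ∈ IKfin K, μ x.1 * centredStep μ p x = 0 := by
    simp only [centredStep, mul_sub, Finset.sum_sub_distrib, mul_ite, mul_one, mul_zero,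
      Finset.sum_ite_eq', if_pos hp]
    rw [← Finset.sum_mul, hμ.sum_IKfin, one_mul, sub_self]
  set A : ℝ := 2 * β.factorial * (2 * √(D : ℝ)) ^ β with hA
  have hApos : 0 < A := by positivity
  set V : List (ℕ × ℕ) → ℝ := fun τ => maxCosh (centredStep μ p) θ τ D 0 1 ^ 2 with hV
  refine ⟨fun σ => V σ.reverse * A, fun σ => by positivity, ?_, ?_⟩
  · intro σ d hd hdl
    have hcosh := cosh_le_maxCosh (centredStep μ p) θ σ.reverse D d hd 0 1 (by simp)
    rw [zero_add, List.take_reverse, List.map_reverse, List.sum_reverse, sum_map_centredStep,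
      List.length_drop, Nat.sub_sub_self hdl] at hcosh
    set Z : ℝ := ((σ.drop (σ.length - d)).count p : ℝ) - μ p.1 * d with hZ
    set m := maxCosh (centredStep μ p) θ σ.reverse D 0 1
    have hm1 : 1 ≤ m := le_maxCosh _ _ _ _ _ _
    have hexp : (θ * |Z|) ^ β ≤ β.factorial * (2 * Real.cosh (θ * Z)) := by
      have h1 := Real.pow_div_factorial_le_exp (θ * |Z|) (by positivity) β
      have h2 : Real.exp (θ * |Z|) ≤ 2 * Real.cosh (θ * Z) := by
        rw [show θ * |Z| = |θ * Z| by rw [abs_mul, abs_of_pos hθpos], ← Real.cosh_abs,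
          Real.cosh_eq]
        linarith [Real.exp_pos (-|θ * Z|)]
      rw [div_le_iff₀ (by positivity)] at h1
      refine h1.trans ?_
      rw [mul_comm]
      gcongr
    have hθinv : (2 * √(D : ℝ)) ^ β * θ ^ β = 1 := by
      rw [← mul_pow, hθ, mul_inv_cancel₀ (by positivity), one_pow]
    calc |Z| ^ β = (2 * √(D : ℝ)) ^ β * (θ * |Z|) ^ β := by
          rw [mul_pow θ, ← mul_assoc, hθinv, one_mul]
      _ ≤ (2 * √(D : ℝ)) ^ β * (β.factorial * (2 * m ^ 2)) := by
          refine mul_le_mul_of_nonneg_left (hexp.trans ?_) (by positivity)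
          gcongr
          nlinarith
      _ = m ^ 2 * A := by rw [hA]; ring
  · intro h
    rw [lineageSum_reverse μ K h (fun σ => V σ * A), lineageSum_mul_const]
    have := lineageSum_maxCosh_sq_le hμ.1 hμ.sum_IKfin hw hw0 hθ1 h D 0 1 (by simp)
    rw [hθ2] at this
    simp only [mul_zero, Real.cosh_zero, mul_one, one_pow] at this
    have h2 : lineageSum μ K h V ≤ 4 * Real.exp 1 := by linarith
    refine (mul_le_mul_of_nonneg_right h2 hApos.le).trans_eq ?_
    rw [hA]
    ring

lemma exists_branching_of_lt {u v : List ℕ} (h : u < v) :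
    ∃ w j b, v = w ++ j :: b ∧ w <+: u ∧ u < w ++ [j] := by
  induction u generalizing v with
  | nil =>
    cases v with
    | nil => exact absurd h (lt_irrefl _)
    | cons j b => exact ⟨[], j, b, rfl, List.nil_prefix, List.nil_lt_cons _ _⟩
  | cons i a ih =>
    cases v with
    | nil => exact absurd h (List.not_lt_nil _)
    | cons j b =>
      rcases List.cons_lt_cons_iff.1 h with h1 | ⟨rfl, h1⟩
      · exact ⟨[], j, b, rfl, List.nil_prefix, List.cons_lt_cons_iff.2 (Or.inl h1)⟩
      · obtain ⟨w, j, b', rfl, hw, hlt⟩ := ih h1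
        exact ⟨i :: w, j, b', rfl, List.cons_prefix_cons.2 ⟨rfl, hw⟩,
          List.cons_lt_cons_iff.2 (Or.inr ⟨rfl, hlt⟩)⟩

lemma append_singleton_le (w : List ℕ) (j : ℕ) (b : List ℕ) : w ++ [j] ≤ w ++ j :: b := by
  cases b with
  | nil => exact le_rfl
  | cons x b =>
    refine le_of_lt ?_
    induction w with
    | nil => exact List.cons_lt_cons_iff.2 (Or.inr ⟨rfl, List.nil_lt_cons _ _⟩)
    | cons i w ih => exact List.cons_lt_cons_iff.2 (Or.inr ⟨rfl, ih⟩)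

lemma vertexAt_toPlanarTree_eq (c : BinaryTree Unit) (l : ℕ) :
    vertexAt (toPlanarTree c) l = (lineageAt c l).map Prod.snd :=
  vertexAt_toPlanarTree c l

lemma lineageAt_mem {c : BinaryTree Unit} {l : ℕ} (hl : l ≤ c.numNodes) :
    lineageAt c l ∈ treeLineages c := by
  have hlen : l < (treeLineages c).length := by
    rw [length_treeLineages]
    omega
  rw [lineageAt, List.getD_eq_getElem _ _ hlen]
  exact List.getElem_mem hlen

lemma lineageAt_zero (c : BinaryTree Unit) : lineageAt c 0 = [] := rfl

lemma vertexAt_eq_getElem {c : BinaryTree Unit} {l : ℕ} (hl : l < (treeWords c).length) :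
    vertexAt (toPlanarTree c) l = (treeWords c)[l] := by
  rw [vertexAt, sort_toPlanarTree, List.getD_eq_getElem _ _ hl]

lemma length_treeWords (c : BinaryTree Unit) : (treeWords c).length = c.numNodes + 1 := by
  simp [treeWords, length_words]

/-- The lineages of two vertices agree as far as the vertices themselves do. -/
lemma take_lineage_eq {c : BinaryTree Unit} {s t : List (ℕ × ℕ)} (hs : s ∈ treeLineages c)
    (ht : t ∈ treeLineages c) (q : ℕ)
    (h : (s.map Prod.snd).take q = (t.map Prod.snd).take q) : s.take q = t.take q := by
  induction q with
  | zero => simp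
  | succ q ih =>
    have hq : (s.map Prod.snd).take q = (t.map Prod.snd).take q := by
      have := congrArg (List.take q) h
      simpa [List.take_take] using this
    have ih' := ih hq
    have hget : (s[q]?).map Prod.snd = (t[q]?).map Prod.snd := by
      have := congrArg (fun l => l[q]?) h
      simpa [List.getElem?_take] using this
    rw [List.take_add_one, List.take_add_one, ih']
    congr 2
    rcases hsq : s[q]? with _ | p
    · rw [hsq] at hget
      simpa using hget.symm
    · rcases htq : t[q]? with _ | r
      · rw [hsq, htq] at hget
        simp at hget
      · rw [hsq, htq] at hget
        have hsnd : p.2 = r.2 := by simpa using hget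
        have hsplit : ∀ {σ : List (ℕ × ℕ)} {x : ℕ × ℕ}, σ[q]? = some x →
            σ = σ.take q ++ x :: σ.drop (q + 1) := by
          intro σ x hx
          obtain ⟨hlt, rfl⟩ := List.getElem?_eq_some_iff.1 hx
          rw [← List.drop_eq_getElem_cons hlt, List.take_append_drop]
        have h1 := numChildren_of_mem_treeLineages hs (hsplit hsq)
        have h2 := numChildren_of_mem_treeLineages ht (hsplit htq)
        rw [ih', h2] at h1
        exact congrArg some (Prod.ext h1.symm hsnd)

/-- Two vertices branch from each other just below some vertex lying between them in
lexicographical order. -/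
lemma exists_branching {c : BinaryTree Unit} {l l' : ℕ} (hll : l < l') (hl' : l' ≤ c.numNodes) :
    ∃ q r, l ≤ r ∧ r ≤ l' ∧ q ≤ (lineageAt c l).length ∧ q ≤ (lineageAt c l').length ∧
      (lineageAt c l).take q = (lineageAt c l').take q ∧ (lineageAt c r).length ≤ q + 1 := by
  have hlen := length_treeWords c
  have hmono : ∀ {a b : ℕ} (ha : a < (treeWords c).length) (hb : b < (treeWords c).length),
      a < b → (treeWords c)[a] < (treeWords c)[b] := fun ha hb hab =>
    List.pairwise_iff_getElem.1 (pairwise_treeWords c) _ _ ha hb hab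
  have hl1 : l < (treeWords c).length := by omega
  have hl2 : l' < (treeWords c).length := by omega
  have e1 : (treeWords c)[l] = (lineageAt c l).map Prod.snd := by
    rw [← vertexAt_toPlanarTree_eq, vertexAt_eq_getElem hl1]
  have e2 : (treeWords c)[l'] = (lineageAt c l').map Prod.snd := by
    rw [← vertexAt_toPlanarTree_eq, vertexAt_eq_getElem hl2]
  obtain ⟨w, j, b, hv, hw, hlt⟩ := exists_branching_of_lt (hmono hl1 hl2 hll)
  have hmem : w ++ [j] ∈ treeWords c := by
    have := IsPlanarTree.mem_of_isPrefix (toPlanarTree c).2 (u := w ++ [j]) (v := (treeWords c)[l'])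
      (by rw [toPlanarTree_val]; exact List.mem_toFinset.2 (List.getElem_mem hl2))
      ⟨b, by rw [hv]; simp⟩
    rw [toPlanarTree_val] at this
    exact List.mem_toFinset.1 this
  obtain ⟨r, hr, hxr⟩ := List.mem_iff_getElem.1 hmem
  have hle : w ++ [j] ≤ (treeWords c)[l'] := hv ▸ append_singleton_le w j b
  have e3 : (lineageAt c r).length = w.length + 1 := by
    have : (treeWords c)[r] = (lineageAt c r).map Prod.snd := by
      rw [← vertexAt_toPlanarTree_eq, vertexAt_eq_getElem hr]
    rw [hxr] at this
    simpa using (congrArg List.length this).symm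
  have hw1 : w.length ≤ (lineageAt c l).length := by
    have := hw.length_le
    rw [e1] at this
    simpa using this
  have hw2 : w.length ≤ (lineageAt c l').length := by
    have := congrArg List.length hv
    rw [e2] at this
    simp at this
    omega
  refine ⟨w.length, r, ?_, ?_, hw1, hw2, ?_, e3.le⟩
  · by_contra h
    have := hmono hr hl1 (not_le.1 h)
    rw [hxr] at this
    exact lt_asymm this hlt
  · by_contra h
    have := hmono hl2 hr (not_le.1 h)
    rw [hxr] at this
    exact absurd hle (not_le.2 this)
  · refine take_lineage_eq (lineageAt_mem (by omega)) (lineageAt_mem hl') _ ?_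
    rw [← e1, ← e2, hv, List.take_left' rfl]
    exact (List.prefix_iff_eq_take.1 hw).symm

lemma length_vertexAt (c : BinaryTree Unit) (l : ℕ) :
    (vertexAt (toPlanarTree c) l).length = (lineageAt c l).length := by
  rw [vertexAt_toPlanarTree_eq, List.length_map]

lemma hn_natCast_div (T : PlanarTree) {n : ℕ} (hn0 : 1 ≤ n) (a : ℕ) :
    hn T n ((a : ℝ) / n) = ((vertexAt T a).length : ℝ) / √(n : ℝ) := by
  have hpos : (n : ℝ) ≠ 0 := by positivity
  rw [hn, heightInterp, mul_div_cancel₀ _ hpos, Nat.floor_natCast]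
  simp

/-- The Hölder bound for the heights of vertices. -/
lemma abs_length_sub_le {μ : ℕ → ℝ} {K n : ℕ} {δ γ ρ : ℝ} {c : BinaryTree Unit} (hn0 : 1 ≤ n)
    (hΩ : toPlanarTree c ∈ Omega μ K n (2 / 5) δ γ ρ) {a b : ℕ} (hab : a ≤ b) (hb : b ≤ n) :
    |((lineageAt c a).length : ℝ) - (lineageAt c b).length| ≤
      δ * (√(n : ℝ) * (((b - a : ℕ) : ℝ) / n) ^ (2 / 5 : ℝ)) := by
  have hpos : (0 : ℝ) < n := by exact_mod_cast hn0
  have hmem : ∀ i ≤ n, (i : ℝ) / n ∈ Set.Icc (0 : ℝ) 1 := fun i hi =>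
    ⟨by positivity, (div_le_one hpos).2 (by exact_mod_cast hi)⟩
  have h := hΩ.1 _ (hmem a (hab.trans hb)) _ (hmem b hb)
  rw [hn_natCast_div _ hn0, hn_natCast_div _ hn0, length_vertexAt, length_vertexAt, ← sub_div,
    ← sub_div, abs_div, abs_of_pos (Real.sqrt_pos.2 hpos), div_le_iff₀ (Real.sqrt_pos.2 hpos),
    ← Nat.cast_sub hab,
    abs_of_nonneg (div_nonneg (Nat.cast_nonneg (b - a)) hpos.le)] at h
  refine h.trans_eq ?_
  ring

lemma one_le_sqrt_mul_rpow {n m : ℕ} (hm : 1 ≤ m) (hmn : m ≤ n) :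
    (n : ℝ) ^ (1 / 10 : ℝ) ≤ √(n : ℝ) * ((m : ℝ) / n) ^ (2 / 5 : ℝ) := by
  have hpos : (0 : ℝ) < n := by exact_mod_cast hm.trans hmn
  have h1 : (1 : ℝ) ≤ (m : ℝ) ^ (2 / 5 : ℝ) :=
    Real.one_le_rpow (by exact_mod_cast hm) (by norm_num)
  rw [Real.div_rpow (by positivity) hpos.le, Real.sqrt_eq_rpow]
  have h2 : (n : ℝ) ^ (1 / 2 : ℝ) = (n : ℝ) ^ (1 / 10 : ℝ) * (n : ℝ) ^ (2 / 5 : ℝ) := by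
    rw [← Real.rpow_add hpos]
    norm_num
  have h3 : (0 : ℝ) < (n : ℝ) ^ (2 / 5 : ℝ) := by positivity
  rw [h2, mul_assoc, mul_div_cancel₀ _ h3.ne']
  exact le_mul_of_one_le_right (by positivity) h1

/-- The increment of the lineage counts, minus its mean, between two vertices only depends on the
short end of their lineages. -/
lemma exists_lineage_split {μ : ℕ → ℝ} {K n : ℕ} {δ γ ρ : ℝ} (hδ : 0 < δ) {c : BinaryTree Unit}
    (hc : c.numNodes = n) (hΩ : toPlanarTree c ∈ Omega μ K n (2 / 5) δ γ ρ) {a b : ℕ}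
    (hab : a < b) (hb : b ≤ n) :
    ∃ q, q ≤ (lineageAt c a).length ∧ q ≤ (lineageAt c b).length ∧
      (lineageAt c a).take q = (lineageAt c b).take q ∧
      (((lineageAt c a).length - q : ℕ) : ℝ) ≤
        (δ + 1) * (√(n : ℝ) * (((b - a : ℕ) : ℝ) / n) ^ (2 / 5 : ℝ)) ∧
      (((lineageAt c b).length - q : ℕ) : ℝ) ≤
        (δ + 1) * (√(n : ℝ) * (((b - a : ℕ) : ℝ) / n) ^ (2 / 5 : ℝ)) := by
  obtain ⟨q, r, har, hrb, hq1, hq2, htake, hr⟩ := exists_branching hab (hb.trans_eq hc.symm)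
  have hn0 : 1 ≤ n := by omega
  have hone : 1 ≤ √(n : ℝ) * (((b - a : ℕ) : ℝ) / n) ^ (2 / 5 : ℝ) :=
    (Real.one_le_rpow (by exact_mod_cast hn0) (by norm_num)).trans
      (one_le_sqrt_mul_rpow (by omega) (by omega))
  have hmono : ∀ i : ℕ, i ≤ b - a → δ * (√(n : ℝ) * ((i : ℝ) / n) ^ (2 / 5 : ℝ)) ≤
      δ * (√(n : ℝ) * (((b - a : ℕ) : ℝ) / n) ^ (2 / 5 : ℝ)) := by
    intro i hi
    have : (i : ℝ) ≤ ((b - a : ℕ) : ℝ) := by exact_mod_cast hi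
    gcongr
  have hr' : ((lineageAt c r).length : ℝ) ≤ q + 1 := by exact_mod_cast hr
  have h1 := (abs_le.1 ((abs_length_sub_le hn0 hΩ har (hrb.trans hb)).trans
    (hmono (r - a) (by omega)))).2
  have h2 := (abs_le.1 ((abs_length_sub_le hn0 hΩ hrb hb).trans (hmono (b - r) (by omega)))).1
  refine ⟨q, hq1, hq2, htake, ?_, ?_⟩
  · rw [Nat.cast_sub hq1]
    linarith
  · rw [Nat.cast_sub hq2]
    linarith

/-- The centred number of entries equal to `p` among the last `d` entries of `σ`. -/
def tailDeviation (μ : ℕ → ℝ) (p : ℕ × ℕ) (σ : List (ℕ × ℕ)) (d : ℕ) : ℝ :=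
  ((σ.drop (σ.length - d)).count p : ℝ) - μ p.1 * d

lemma gfun_toPlanarTree (μ : ℕ → ℝ) {c : BinaryTree Unit} {l : ℕ} (hl : l ≤ c.numNodes)
    (p : ℕ × ℕ) {q : ℕ} (hq : q ≤ (lineageAt c l).length) :
    gfun μ (toPlanarTree c) p.1 p.2 l =
      ((((lineageAt c l).take q).count p : ℝ) - μ p.1 * q) +
        tailDeviation μ p (lineageAt c l) ((lineageAt c l).length - q) := by
  rw [gfun, length_vertexAt, vertexAt_toPlanarTree_eq, Acount_lineage (lineageAt_mem hl),
    tailDeviation, Nat.sub_sub_self hq, Nat.cast_sub hq]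
  have : (lineageAt c l).count p =
      ((lineageAt c l).take q).count p + ((lineageAt c l).drop q).count p := by
    rw [← List.count_append, List.take_append_drop]
  rw [Prod.mk.eta, this]
  push_cast
  ring

lemma abs_tailDeviation_le {μ : ℕ → ℝ} {K n : ℕ} {δ γ ρ : ℝ} {c : BinaryTree Unit}
    {l : ℕ} (hl : l ≤ c.numNodes) (hΩ : toPlanarTree c ∈ Omega μ K n (2 / 5) δ γ ρ) {p : ℕ × ℕ}
    (hp : p ∈ IKfin K) {d : ℕ} (hd : d ≤ (lineageAt c l).length) :
    |tailDeviation μ p (lineageAt c l) d| ≤ γ * √(d * Real.log n) := by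
  rcases Nat.eq_zero_or_pos d with rfl | hd0
  · simp [tailDeviation]
  have hmem : (lineageAt c l).map Prod.snd ∈ (toPlanarTree c).val := by
    rw [toPlanarTree_val, List.mem_toFinset, treeWords_eq_map_treeLineages]
    exact List.mem_map.2 ⟨_, lineageAt_mem hl, rfl⟩
  have := hΩ.2.2.2 ⟨p, hp⟩ _ hmem d hd0 (by simpa using hd)
  rwa [AcountLe_lineage (lineageAt_mem hl)] at this

/-- The conditioned expectation of a functional of the tree, read on forests. -/
def treeMean (μ : ℕ → ℝ) (n : ℕ) (f : BinaryTree Unit → ℝ) : ℝ :=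
  (∑ c ∈ BinaryTree.treesOfNumNodesEq n, μ (rootCount c) * forestWeight μ c * f c) /
    PowerSeries.coeff (n + 1) (treeSeries μ)

lemma coeff_treeSeries_nonneg {μ : ℕ → ℝ} (h0 : ∀ k, 0 ≤ μ k) (m : ℕ) :
    0 ≤ PowerSeries.coeff m (treeSeries μ) := by
  simpa using coeff_treeSeries_pow_nonneg h0 1 m

lemma treeMean_mono {μ : ℕ → ℝ} (h0 : ∀ k, 0 ≤ μ k) {n : ℕ} {f g : BinaryTree Unit → ℝ}
    (h : ∀ c, c.numNodes = n → f c ≤ g c) : treeMean μ n f ≤ treeMean μ n g :=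
  div_le_div_of_nonneg_right (Finset.sum_le_sum fun c hc => mul_le_mul_of_nonneg_left
    (h c (BinaryTree.mem_treesOfNumNodesEq.1 hc)) (mul_nonneg (h0 _) (forestWeight_nonneg h0 c)))
    (coeff_treeSeries_nonneg h0 _)

lemma treeMean_const_le {μ : ℕ → ℝ} (n : ℕ) {C : ℝ} (hC : 0 ≤ C) :
    treeMean μ n (fun _ => C) ≤ C := by
  have : ∑ c ∈ BinaryTree.treesOfNumNodesEq n, μ (rootCount c) * forestWeight μ c =
      PowerSeries.coeff (n + 1) (treeSeries μ) := by
    rw [treeSeries, PowerSeries.coeff_mk, treeCoeff]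
  rw [treeMean, ← Finset.sum_mul, this]
  by_cases h : PowerSeries.coeff (n + 1) (treeSeries μ) = 0
  · simpa [h] using hC
  · rw [mul_div_cancel_left₀ _ h]

lemma treeMean_const_mul (μ : ℕ → ℝ) (n : ℕ) (C : ℝ) (f : BinaryTree Unit → ℝ) :
    treeMean μ n (fun c => C * f c) = C * treeMean μ n f := by
  simp only [treeMean, mul_left_comm _ C, ← Finset.mul_sum, mul_div_assoc]

lemma treeMean_sum {ι : Type*} (μ : ℕ → ℝ) (n : ℕ) (s : Finset ι)
    (f : ι → BinaryTree Unit → ℝ) :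
    treeMean μ n (fun c => ∑ i ∈ s, f i c) = ∑ i ∈ s, treeMean μ n (f i) := by
  simp only [treeMean, Finset.mul_sum, ← Finset.sum_div]
  rw [Finset.sum_comm]

/-- Functionals of the lineage of a vertex far from both ends of the exploration have mean at most
of the order of their mean under the spine measure. -/
lemma exists_treeMean_lineageAt_le {μ : ℕ → ℝ} {K : ℕ} (hμ : H1 μ K) :
    ∃ C > 0, ∀ᶠ n : ℕ in atTop, ∀ l H m : ℕ, 1 ≤ m → m ≤ l → l + m ≤ n → 2 * H ≤ l →
      ∀ (F : List (ℕ × ℕ) → ℝ) (M : ℝ), (∀ σ, 0 ≤ F σ) → (∀ h, lineageSum μ K h F ≤ M) →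
        treeMean μ n (fun c => if (lineageAt c l).length ≤ H then F (lineageAt c l) else 0) ≤
          C * M * (H + 1) ^ 3 * (n * √n) / m ^ 3 := by
  obtain ⟨C, hC, hQ⟩ := exists_coeff_treeSeries_pow_le hμ
  obtain ⟨c, hc, hq⟩ := exists_le_coeff_treeSeries hμ
  refine ⟨3 * C ^ 2 * (K + 1) ^ 2 / c, by positivity, ?_⟩
  filter_upwards [hq] with n hn l H m hm hml hlm hH F M hF hFM
  have hM : 0 ≤ M := by
    have := hFM 0
    rw [lineageSum_zero] at this
    exact (hF _).trans this
  have hmpos : (0 : ℝ) < m := by exact_mod_cast hm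
  have hnpos : (0 : ℝ) < n := by exact_mod_cast (by omega : 0 < n)
  rcases hn with hn | hn
  · rw [treeMean, hn, div_zero]
    positivity
  rw [treeMean, sum_lineageAt hμ.2.2.2.2.2 (by omega : l ≤ n)]
  set B : ℝ := 3 * C ^ 2 * ((K + 1) * (H + 1)) * ((K + 1) * (H + 1)) / m ^ 3 with hB
  have hterm : ∀ h ∈ Finset.range (H + 1), (lineageSum μ K h fun σ =>
      F σ * spineCoeff μ h (leftCount σ) (rightCount σ + 1) l (n + 1 - l)) ≤ M * B := by
    intro h hh
    have hh' : h ≤ H := Nat.lt_succ_iff.1 (Finset.mem_range.1 hh)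
    have hhR : (h : ℝ) ≤ H := by exact_mod_cast hh'
    have hle : ∀ σ ∈ lineageSet K h,
        F σ * spineCoeff μ h (leftCount σ) (rightCount σ + 1) l (n + 1 - l) ≤ F σ * B := by
      intro σ hσ
      refine mul_le_mul_of_nonneg_left ?_ (hF σ)
      refine (spineCoeff_le hμ.1 hC hQ hσ (by omega) (by omega) (by omega)).trans ?_
      have e1 : (h : ℝ) * K ≤ (K + 1) * (H + 1) := by nlinarith [Nat.cast_nonneg (α := ℝ) K]
      have e2 : (h : ℝ) * K + 1 ≤ (K + 1) * (H + 1) := by nlinarith [Nat.cast_nonneg (α := ℝ) K]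
      have e3 : (m : ℝ) ^ 3 ≤ l * √l * ((n + 1 - l : ℕ) * √((n + 1 - l : ℕ) : ℝ)) := by
        have h1 : (m : ℝ) ≤ l := by exact_mod_cast hml
        have h2 : (m : ℝ) ≤ ((n + 1 - l : ℕ) : ℝ) := by exact_mod_cast (by omega)
        have h3 : (m : ℝ) ^ 3 = m * √m * (m * √m) := by
          rw [mul_mul_mul_comm, Real.mul_self_sqrt hmpos.le]
          ring
        rw [h3]
        gcongr
      rw [hB]
      gcongr
    refine (lineageSum_le hμ.1 hle).trans ?_
    rw [lineageSum_mul_const]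
    exact mul_le_mul_of_nonneg_right (hFM h) (by positivity)
  refine (div_le_div₀ (by positivity) (Finset.sum_le_sum hterm) (by positivity) hn).trans_eq ?_
  rw [Finset.sum_const, Finset.card_range, nsmul_eq_mul, hB]
  push_cast
  field_simp

/-- The scale of the height variations over `m` steps of the exploration. -/
def heightScale (n m : ℕ) : ℝ := √(n : ℝ) * ((m : ℝ) / n) ^ (2 / 5 : ℝ)

lemma heightScale_nonneg (n m : ℕ) : 0 ≤ heightScale n m := by
  unfold heightScale
  positivity

lemma heightScale_pow (n m : ℕ) : heightScale n m ^ 20 = (n : ℝ) ^ 10 * ((m : ℝ) / n) ^ 8 := by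
  rw [heightScale, mul_pow, ← Real.rpow_natCast (((m : ℝ) / n) ^ (2 / 5 : ℝ)),
    ← Real.rpow_mul (by positivity)]
  have h1 : √(n : ℝ) ^ 20 = (n : ℝ) ^ 10 := by
    rw [show 20 = 2 * 10 by norm_num, pow_mul, Real.sq_sqrt (by positivity)]
  have h2 : (2 / 5 : ℝ) * ((20 : ℕ) : ℝ) = ((8 : ℕ) : ℝ) := by norm_num
  rw [h1, h2, Real.rpow_natCast]

lemma one_le_heightScale {n m : ℕ} (hm : 1 ≤ m) (hmn : m ≤ n) : 1 ≤ heightScale n m :=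
  (Real.one_le_rpow (by exact_mod_cast hm.trans hmn) (by norm_num)).trans
    (one_le_sqrt_mul_rpow hm hmn)

/-- Close to both ends of the exploration, the height itself is small. -/
lemma length_le_heightScale {μ : ℕ → ℝ} {K n : ℕ} {δ γ ρ : ℝ} {c : BinaryTree Unit}
    (hn0 : 1 ≤ n) (hρ : ρ * Real.log n ≤ (n : ℝ) ^ (1 / 10 : ℝ)) (hδ : 0 < δ)
    (hΩ : toPlanarTree c ∈ Omega μ K n (2 / 5) δ γ ρ) {l m d : ℕ} (hl : l ≤ n)
    (hd : d ≤ (lineageAt c l).length) (hdm : (d : ℝ) ≤ (δ + 1) * heightScale n m) :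
    (d : ℝ) ≤ (δ + 1) * heightScale n (max 1 (min m (min l (n - l)))) := by
  have hd' : (d : ℝ) ≤ (lineageAt c l).length := by exact_mod_cast hd
  have hlow : (n : ℝ) ^ (1 / 10 : ℝ) ≤ heightScale n (max 1 (min m (min l (n - l)))) :=
    one_le_sqrt_mul_rpow (le_max_left _ _) (by omega)
  have hmono : ∀ i : ℕ, i ≤ max 1 (min m (min l (n - l))) →
      heightScale n i ≤ heightScale n (max 1 (min m (min l (n - l)))) := by
    intro i hi
    have : (i : ℝ) ≤ (max 1 (min m (min l (n - l))) : ℕ) := by exact_mod_cast hi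
    unfold heightScale
    gcongr
  have hnn := heightScale_nonneg n (max 1 (min m (min l (n - l))))
  have hcases : m ≤ max 1 (min m (min l (n - l))) ∨ l ≤ max 1 (min m (min l (n - l))) ∨
      n - l ≤ max 1 (min m (min l (n - l))) := by omega
  rcases hcases with h | h | h
  · exact hdm.trans (mul_le_mul_of_nonneg_left (hmono m h) (by linarith))
  · have h1 := (abs_le.1 (abs_length_sub_le hn0 hΩ (Nat.zero_le l) hl)).1
    rw [lineageAt_zero, List.length_nil, Nat.cast_zero, Nat.sub_zero] at h1
    have h2 : δ * heightScale n l ≤ _ := mul_le_mul_of_nonneg_left (hmono l h) hδ.le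
    unfold heightScale at h2 hnn ⊢
    linarith
  · have h1 := (abs_le.1 (abs_length_sub_le hn0 hΩ hl le_rfl)).2
    have h2 : δ * heightScale n (n - l) ≤ _ := mul_le_mul_of_nonneg_left (hmono _ h) hδ.le
    have h3 := hΩ.2.2.1
    rw [length_vertexAt] at h3
    unfold heightScale at h2 hlow hnn ⊢
    linarith

lemma eventually_log_pow_le (A : ℝ) :
    ∀ᶠ n : ℕ in atTop, A * √(n : ℝ) * Real.log n ^ 5 ≤ n := by
  have h := (isLittleO_log_rpow_rpow_atTop (s := 1 / 2) 5 (by norm_num)).bound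
    (c := (|A| + 1)⁻¹) (by positivity)
  filter_upwards [tendsto_natCast_atTop_atTop.eventually h, eventually_ge_atTop 1] with n hn hn1
  have hlog : 0 ≤ Real.log n := Real.log_nonneg (by exact_mod_cast hn1)
  rw [Real.norm_of_nonneg (by positivity), Real.norm_of_nonneg (by positivity),
    ← Real.sqrt_eq_rpow, inv_mul_eq_div, le_div_iff₀ (by positivity)] at hn
  have h5 : Real.log (n : ℝ) ^ (5 : ℝ) = Real.log n ^ 5 := by
    rw [show (5 : ℝ) = ((5 : ℕ) : ℝ) by norm_num, Real.rpow_natCast]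
  rw [h5] at hn
  calc A * √(n : ℝ) * Real.log n ^ 5 ≤ (|A| + 1) * √(n : ℝ) * Real.log n ^ 5 := by
        gcongr
        linarith [le_abs_self A]
    _ = √(n : ℝ) * (Real.log n ^ 5 * (|A| + 1)) := by ring
    _ ≤ √(n : ℝ) * √(n : ℝ) := by gcongr
    _ = n := Real.mul_self_sqrt (by positivity)

lemma eventually_log_le (ρ : ℝ) :
    ∀ᶠ n : ℕ in atTop, ρ * Real.log n ≤ (n : ℝ) ^ (1 / 10 : ℝ) := by
  have h := (isLittleO_log_rpow_atTop (r := 1 / 10) (by norm_num)).bound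
    (c := (|ρ| + 1)⁻¹) (by positivity)
  filter_upwards [tendsto_natCast_atTop_atTop.eventually h, eventually_ge_atTop 1] with n hn hn1
  have hlog : 0 ≤ Real.log n := Real.log_nonneg (by exact_mod_cast hn1)
  rw [Real.norm_of_nonneg hlog, Real.norm_of_nonneg (by positivity), inv_mul_eq_div,
    le_div_iff₀ (by positivity)] at hn
  nlinarith [le_abs_self ρ]

/-- The moment bound at a single vertex, close to the ends of the exploration: the deviations are
controlled by the definition of `Omega`. -/
lemma treeMean_tailDeviation_le_of_small {μ : ℕ → ℝ} {K : ℕ} (hμ : H1 μ K) {δ γ ρ : ℝ}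
    (hδ : 0 < δ) (hγ : 0 < γ) {n l m : ℕ} (hl : l ≤ n) (hm : 1 ≤ m) (hmn : m ≤ n)
    (hsmall : (m : ℝ) / n * Real.log n ^ 5 ≤ 1) {p : ℕ × ℕ} (hp : p ∈ IKfin K)
    {d : BinaryTree Unit → ℕ}
    (hd : ∀ c : BinaryTree Unit, c.numNodes = n → toPlanarTree c ∈ Omega μ K n (2 / 5) δ γ ρ →
      d c ≤ (lineageAt c l).length ∧ (d c : ℝ) ≤ (δ + 1) * heightScale n m) :
    treeMean μ n (fun c => if toPlanarTree c ∈ Omega μ K n (2 / 5) δ γ ρ then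
        |tailDeviation μ p (lineageAt c l) (d c)| ^ 40 else 0) ≤
      γ ^ 40 * (δ + 1) ^ 20 * (n ^ 10 * ((m : ℝ) / n) ^ 2) := by
  have hnpos : (0 : ℝ) < n := by exact_mod_cast hm.trans hmn
  have hlog : 0 ≤ Real.log n := Real.log_nonneg (by exact_mod_cast hm.trans hmn)
  have hx0 : 0 ≤ (m : ℝ) / n := by positivity
  have hx1 : (m : ℝ) / n ≤ 1 := (div_le_one hnpos).2 (by exact_mod_cast hmn)
  refine (treeMean_mono hμ.1 fun c hc => ?_).trans (treeMean_const_le n (by positivity))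
  split_ifs with hΩ
  · obtain ⟨h1, h2⟩ := hd c hc hΩ
    have h3 := abs_tailDeviation_le (hl.trans_eq hc.symm) hΩ hp h1
    have h4 : √((d c : ℝ) * Real.log n) ^ 40 = ((d c : ℝ) * Real.log n) ^ 20 := by
      rw [show 40 = 2 * 20 by norm_num, pow_mul, Real.sq_sqrt (by positivity)]
    calc |tailDeviation μ p (lineageAt c l) (d c)| ^ 40
        ≤ (γ * √((d c : ℝ) * Real.log n)) ^ 40 := by gcongr
      _ = γ ^ 40 * ((d c : ℝ) ^ 20 * Real.log n ^ 20) := by rw [mul_pow, h4, mul_pow]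
      _ ≤ γ ^ 40 * (((δ + 1) * heightScale n m) ^ 20 * Real.log n ^ 20) := by gcongr
      _ = γ ^ 40 * (δ + 1) ^ 20 * (n ^ 10 * (((m : ℝ) / n) ^ 4 *
            ((m : ℝ) / n * Real.log n ^ 5) ^ 4)) := by
          rw [mul_pow, heightScale_pow]
          ring
      _ ≤ γ ^ 40 * (δ + 1) ^ 20 * (n ^ 10 * (((m : ℝ) / n) ^ 2 * 1)) := by
          have h5 : ((m : ℝ) / n * Real.log n ^ 5) ^ 4 ≤ 1 := pow_le_one₀ (by positivity) hsmall
          have h6 : ((m : ℝ) / n) ^ 4 ≤ ((m : ℝ) / n) ^ 2 :=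
            pow_le_pow_of_le_one hx0 hx1 (by norm_num)
          gcongr
      _ = _ := by rw [mul_one]
  · positivity

/-- The moment bound at a single vertex, far from the ends of the exploration. -/
lemma exists_treeMean_tailDeviation_le_of_large {μ : ℕ → ℝ} {K : ℕ} (hμ : H1 μ K) {δ γ ρ : ℝ}
    (hδ : 0 < δ) :
    ∃ C > 0, ∀ᶠ n : ℕ in atTop, ∀ l m : ℕ, 1 ≤ m → m ≤ l → l + m ≤ n →
      2 * (δ * √(n : ℝ)) ≤ m → ∀ p ∈ IKfin K, ∀ d : BinaryTree Unit → ℕ,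
      (∀ c : BinaryTree Unit, c.numNodes = n → toPlanarTree c ∈ Omega μ K n (2 / 5) δ γ ρ →
        d c ≤ (lineageAt c l).length ∧ (d c : ℝ) ≤ (δ + 1) * heightScale n m) →
      treeMean μ n (fun c => if toPlanarTree c ∈ Omega μ K n (2 / 5) δ γ ρ then
          |tailDeviation μ p (lineageAt c l) (d c)| ^ 40 else 0) ≤
        C * (n ^ 10 * ((m : ℝ) / n) ^ 2) := by
  obtain ⟨C, hC, hbound⟩ := exists_treeMean_lineageAt_le hμ
  set A : ℝ := 8 * Real.exp 1 * Nat.factorial 40 with hA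
  have hApos : 0 < A := by positivity
  refine ⟨C * (A * 2 ^ 40 * (δ + 1) ^ 20) * (δ + 1) ^ 3, by positivity, ?_⟩
  filter_upwards [hbound] with n hn l m hm hml hlm hbig p hp d hd
  have hn1 : 1 ≤ n := by omega
  have hnR : (1 : ℝ) ≤ n := by exact_mod_cast hn1
  have hnpos : (0 : ℝ) < n := by linarith
  have hmpos : (0 : ℝ) < m := by exact_mod_cast hm
  have hsn : 1 ≤ √(n : ℝ) := Real.one_le_sqrt.2 hnR
  have hx1 : (m : ℝ) / n ≤ 1 := (div_le_one hnpos).2 (by exact_mod_cast (by omega : m ≤ n))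
  have hy := one_le_heightScale hm (by omega : m ≤ n)
  set D : ℕ := ⌊(δ + 1) * heightScale n m⌋₊ with hD
  have hDle : (D : ℝ) ≤ (δ + 1) * heightScale n m :=
    Nat.floor_le (mul_nonneg (by linarith) (heightScale_nonneg n m))
  have hD1 : 1 ≤ D := Nat.le_floor (by push_cast; nlinarith)
  set H : ℕ := ⌊δ * √(n : ℝ)⌋₊ with hH
  have hHle : (H : ℝ) ≤ δ * √(n : ℝ) := Nat.floor_le (by positivity)
  have hHl : 2 * H ≤ l := by
    have : (2 * H : ℝ) ≤ l := by
      have : (m : ℝ) ≤ l := by exact_mod_cast hml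
      linarith
    exact_mod_cast this
  obtain ⟨F, hF0, hF, hFsum⟩ := exists_lineageSum_moment_le hμ hp 40 hD1
  have hkey := hn l H m hm hml hlm hHl F _ hF0 hFsum
  have hpt : treeMean μ n (fun c => if toPlanarTree c ∈ Omega μ K n (2 / 5) δ γ ρ then
      |tailDeviation μ p (lineageAt c l) (d c)| ^ 40 else 0) ≤
      treeMean μ n (fun c => if (lineageAt c l).length ≤ H then F (lineageAt c l) else 0) := by
    refine treeMean_mono hμ.1 fun c hc => ?_
    split_ifs with hΩ hlen hlen
    · obtain ⟨h1, h2⟩ := hd c hc hΩ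
      exact hF _ _ (Nat.le_floor h2) h1
    · exfalso
      apply hlen
      refine Nat.le_floor ?_
      have h1 := (abs_le.1 (abs_length_sub_le hn1 hΩ (Nat.zero_le l) (by omega))).1
      rw [lineageAt_zero, List.length_nil, Nat.cast_zero, Nat.sub_zero] at h1
      have h2 : √(n : ℝ) * ((l : ℝ) / n) ^ (2 / 5 : ℝ) ≤ √(n : ℝ) * 1 := by
        refine mul_le_mul_of_nonneg_left (Real.rpow_le_one (by positivity) ?_ (by norm_num))
          (Real.sqrt_nonneg _)
        exact (div_le_one hnpos).2 (by exact_mod_cast (by omega : l ≤ n))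
      have h3 := mul_le_mul_of_nonneg_left h2 hδ.le
      linarith
    · exact hF0 _
    · exact le_rfl
  refine hpt.trans (hkey.trans ?_)
  have hpow : (2 * √(D : ℝ)) ^ 40 ≤ 2 ^ 40 * (δ + 1) ^ 20 * (n ^ 10 * ((m : ℝ) / n) ^ 8) := by
    have h4 : √(D : ℝ) ^ 40 = (D : ℝ) ^ 20 := by
      rw [show 40 = 2 * 20 by norm_num, pow_mul, Real.sq_sqrt (by positivity)]
    rw [mul_pow, h4, mul_assoc, ← heightScale_pow, ← mul_pow (δ + 1)]
    gcongr
  have hH3 : ((H : ℝ) + 1) ^ 3 ≤ (δ + 1) ^ 3 * (n * √(n : ℝ)) := by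
    have h5 : (n : ℝ) * √(n : ℝ) = √(n : ℝ) ^ 3 := by
      rw [pow_succ, Real.sq_sqrt hnpos.le]
    rw [h5, ← mul_pow]
    gcongr
    linarith
  calc C * (A * (2 * √(D : ℝ)) ^ 40) * ((H : ℝ) + 1) ^ 3 * (n * √(n : ℝ)) / (m : ℝ) ^ 3
      ≤ C * (A * (2 ^ 40 * (δ + 1) ^ 20 * (n ^ 10 * ((m : ℝ) / n) ^ 8))) *
          ((δ + 1) ^ 3 * (n * √(n : ℝ))) * (n * √(n : ℝ)) / (m : ℝ) ^ 3 := by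
        gcongr
    _ = C * (A * 2 ^ 40 * (δ + 1) ^ 20) * (δ + 1) ^ 3 * (n ^ 10 * ((m : ℝ) / n) ^ 5) := by
        have h6 : √(n : ℝ) * √(n : ℝ) = n := Real.mul_self_sqrt hnpos.le
        rw [div_pow, div_pow, div_eq_iff (by positivity)]
        generalize (2 : ℝ) ^ 40 = E
        field_simp
        rw [pow_two, h6]
    _ ≤ _ := by
        have h7 : ((m : ℝ) / n) ^ 5 ≤ ((m : ℝ) / n) ^ 2 :=
          pow_le_pow_of_le_one (by positivity) hx1 (by norm_num)
        gcongr

/-- The moment bound at a single vertex. -/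
lemma exists_treeMean_tailDeviation_le {μ : ℕ → ℝ} {K : ℕ} (hμ : H1 μ K) {δ γ : ℝ} (ρ : ℝ)
    (hδ : 0 < δ) (hγ : 0 < γ) :
    ∃ C > 0, ∀ᶠ n : ℕ in atTop, ∀ l m : ℕ, l ≤ n → 1 ≤ m → m ≤ n →
      ∀ p ∈ IKfin K, ∀ d : BinaryTree Unit → ℕ,
      (∀ c : BinaryTree Unit, c.numNodes = n → toPlanarTree c ∈ Omega μ K n (2 / 5) δ γ ρ →
        d c ≤ (lineageAt c l).length ∧ (d c : ℝ) ≤ (δ + 1) * heightScale n m) →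
      treeMean μ n (fun c => if toPlanarTree c ∈ Omega μ K n (2 / 5) δ γ ρ then
          |tailDeviation μ p (lineageAt c l) (d c)| ^ 40 else 0) ≤
        C * (n ^ 10 * ((m : ℝ) / n) ^ 2) := by
  obtain ⟨C, hC, hbound⟩ := exists_treeMean_tailDeviation_le_of_large (γ := γ) (ρ := ρ) hμ hδ
  refine ⟨C + γ ^ 40 * (δ + 1) ^ 20, by positivity, ?_⟩
  filter_upwards [hbound, eventually_log_le ρ, eventually_log_pow_le (2 * δ + 1),
    eventually_ge_atTop 1] with n hn hlogn hpow hn1 l m hl hm hmn p hp d hd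
  have hnR : (1 : ℝ) ≤ n := by exact_mod_cast hn1
  have hnpos : (0 : ℝ) < n := by linarith
  have hlog : 0 ≤ Real.log n := Real.log_nonneg hnR
  have hsn : 1 ≤ √(n : ℝ) := Real.one_le_sqrt.2 hnR
  set m' := max 1 (min m (min l (n - l))) with hm'
  have hm'1 : 1 ≤ m' := le_max_left _ _
  have hm'm : m' ≤ m := by omega
  have hd' : ∀ c : BinaryTree Unit, c.numNodes = n →
      toPlanarTree c ∈ Omega μ K n (2 / 5) δ γ ρ →
      d c ≤ (lineageAt c l).length ∧ (d c : ℝ) ≤ (δ + 1) * heightScale n m' := fun c hc hΩ =>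
    ⟨(hd c hc hΩ).1, length_le_heightScale hn1 hlogn hδ hΩ hl (hd c hc hΩ).1 (hd c hc hΩ).2⟩
  have hle : (n : ℝ) ^ 10 * ((m' : ℝ) / n) ^ 2 ≤ n ^ 10 * ((m : ℝ) / n) ^ 2 := by
    have : (m' : ℝ) ≤ m := by exact_mod_cast hm'm
    gcongr
  have hnn : 0 ≤ (n : ℝ) ^ 10 * ((m' : ℝ) / n) ^ 2 := by positivity
  have hγδ : 0 < γ ^ 40 * (δ + 1) ^ 20 := by positivity
  rcases le_or_gt ((m' : ℝ) / n * Real.log n ^ 5) 1 with hx | hx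
  · refine (treeMean_tailDeviation_le_of_small hμ hδ hγ hl hm'1 (hm'm.trans hmn) hx hp hd').trans ?_
    nlinarith
  · rw [div_mul_eq_mul_div, one_lt_div hnpos] at hx
    have h5 : 0 ≤ Real.log (n : ℝ) ^ 5 := by positivity
    have hbig : (2 * δ + 1) * √(n : ℝ) < m' := by
      by_contra hcon
      exact absurd hx (not_lt.2 ((mul_le_mul_of_nonneg_right (not_lt.1 hcon) h5).trans hpow))
    have hm'2 : 1 < m' := by
      have : (1 : ℝ) < m' := by nlinarith
      exact_mod_cast this
    refine (hn l m' hm'1 (by omega) (by omega) (by nlinarith) p hp d hd').trans ?_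
    nlinarith

lemma sum_abs_pow_le {ι : Type*} (s : Finset ι) (f : ι → ℝ) :
    |∑ i ∈ s, f i| ^ 40 ≤ (s.card : ℝ) ^ 39 * ∑ i ∈ s, |f i| ^ 40 := by
  rcases s.eq_empty_or_nonempty with rfl | hs
  · simp
  have h := pow_sum_div_card_le_sum_pow (s := s) (f := fun i => |f i|) (n := 39)
    (fun i _ => abs_nonneg _)
  have hcard : (0 : ℝ) < s.card := by exact_mod_cast hs.card_pos
  rw [div_le_iff₀ (by positivity), mul_comm] at h
  exact (pow_le_pow_left₀ (abs_nonneg _) (Finset.abs_sum_le_sum_abs f s) 40).trans h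

/-- The moment, under the conditioned law, of `f` on the event `Omega`. -/
def goodMoment (μ : ℕ → ℝ) (K n : ℕ) (δ γ ρ : ℝ) (f : BinaryTree Unit → ℝ) : ℝ :=
  treeMean μ n fun c => if toPlanarTree c ∈ Omega μ K n (2 / 5) δ γ ρ then |f c| ^ 40 else 0

lemma goodMoment_const_mul (μ : ℕ → ℝ) (K n : ℕ) (δ γ ρ θ : ℝ) (f : BinaryTree Unit → ℝ) :
    goodMoment μ K n δ γ ρ (fun c => θ * f c) = |θ| ^ 40 * goodMoment μ K n δ γ ρ f := by
  rw [goodMoment, goodMoment, ← treeMean_const_mul]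
  simp only [abs_mul, mul_pow, mul_ite, mul_zero]

lemma goodMoment_sum_le {μ : ℕ → ℝ} (h0 : ∀ k, 0 ≤ μ k) (K n : ℕ) (δ γ ρ : ℝ) {ι : Type*}
    (s : Finset ι) (f : ι → BinaryTree Unit → ℝ) :
    goodMoment μ K n δ γ ρ (fun c => ∑ i ∈ s, f i c) ≤
      (s.card : ℝ) ^ 39 * ∑ i ∈ s, goodMoment μ K n δ γ ρ (f i) := by
  simp only [goodMoment]
  rw [← treeMean_sum, ← treeMean_const_mul]
  refine treeMean_mono h0 fun c _ => ?_
  split_ifs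
  · exact sum_abs_pow_le s fun i => f i c
  · simp

lemma goodMoment_congr {μ : ℕ → ℝ} (h0 : ∀ k, 0 ≤ μ k) {K n : ℕ} {δ γ ρ : ℝ}
    {f g : BinaryTree Unit → ℝ}
    (h : ∀ c : BinaryTree Unit, c.numNodes = n → toPlanarTree c ∈ Omega μ K n (2 / 5) δ γ ρ →
      |f c| = |g c|) : goodMoment μ K n δ γ ρ f = goodMoment μ K n δ γ ρ g := by
  refine le_antisymm ?_ ?_
  · refine treeMean_mono h0 fun c hc => ?_
    split_ifs with hΩ
    · rw [h c hc hΩ]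
    · exact le_rfl
  · refine treeMean_mono h0 fun c hc => ?_
    split_ifs with hΩ
    · rw [h c hc hΩ]
    · exact le_rfl

/-- The moment bound for the increments between two vertices. -/
lemma exists_goodMoment_gfun_sub_le {μ : ℕ → ℝ} {K : ℕ} (hμ : H1 μ K) {δ γ : ℝ} (ρ : ℝ)
    (hδ : 0 < δ) (hγ : 0 < γ) :
    ∃ C > 0, ∀ᶠ n : ℕ in atTop, ∀ a b : ℕ, a ≤ b → b ≤ n → ∀ p ∈ IKfin K,
      goodMoment μ K n δ γ ρ (fun c =>
        gfun μ (toPlanarTree c) p.1 p.2 b - gfun μ (toPlanarTree c) p.1 p.2 a) ≤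
        C * (n ^ 10 * (((b : ℝ) - a) / n) ^ 2) := by
  obtain ⟨C, hC, hbound⟩ := exists_treeMean_tailDeviation_le hμ ρ hδ hγ
  refine ⟨2 ^ 39 * (C + C), by positivity, ?_⟩
  filter_upwards [hbound] with n hn a b hab hb p hp
  rcases hab.eq_or_lt with rfl | hlt
  · rw [goodMoment]
    simp only [sub_self, abs_zero, ne_eq, OfNat.ofNat_ne_zero, not_false_eq_true, zero_pow,
      ite_self]
    exact (treeMean_const_le n le_rfl).trans (by simp)
  have hsplit : ∀ c : BinaryTree Unit, ∃ q : ℕ, c.numNodes = n →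
      toPlanarTree c ∈ Omega μ K n (2 / 5) δ γ ρ →
      q ≤ (lineageAt c a).length ∧ q ≤ (lineageAt c b).length ∧
      (lineageAt c a).take q = (lineageAt c b).take q ∧
      (((lineageAt c a).length - q : ℕ) : ℝ) ≤ (δ + 1) * heightScale n (b - a) ∧
      (((lineageAt c b).length - q : ℕ) : ℝ) ≤ (δ + 1) * heightScale n (b - a) := by
    intro c
    by_cases h : c.numNodes = n ∧ toPlanarTree c ∈ Omega μ K n (2 / 5) δ γ ρ
    · obtain ⟨q, hq⟩ := exists_lineage_split hδ h.1 h.2 hlt hb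
      exact ⟨q, fun _ _ => hq⟩
    · exact ⟨0, fun h1 h2 => absurd ⟨h1, h2⟩ h⟩
  choose q hq using hsplit
  have hA := hn a (b - a) (hab.trans hb) (by omega) (by omega) p hp
    (fun c => (lineageAt c a).length - q c)
    fun c hc hΩ => ⟨Nat.sub_le _ _, (hq c hc hΩ).2.2.2.1⟩
  have hB := hn b (b - a) hb (by omega) (by omega) p hp
    (fun c => (lineageAt c b).length - q c)
    fun c hc hΩ => ⟨Nat.sub_le _ _, (hq c hc hΩ).2.2.2.2⟩
  rw [Nat.cast_sub hab] at hA hB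
  have hle : goodMoment μ K n δ γ ρ (fun c =>
      gfun μ (toPlanarTree c) p.1 p.2 b - gfun μ (toPlanarTree c) p.1 p.2 a) =
      goodMoment μ K n δ γ ρ (fun c => ∑ i : Fin 2,
        ![tailDeviation μ p (lineageAt c b) ((lineageAt c b).length - q c),
          -tailDeviation μ p (lineageAt c a) ((lineageAt c a).length - q c)] i) := by
    refine goodMoment_congr hμ.1 fun c hc hΩ => ?_
    obtain ⟨h1, h2, h3, -, -⟩ := hq c hc hΩ
    rw [gfun_toPlanarTree μ (hb.trans_eq hc.symm) p h2,
      gfun_toPlanarTree μ ((hab.trans hb).trans_eq hc.symm) p h1, h3, Fin.sum_univ_two]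
    congr 1
    simp only [Matrix.cons_val_zero, Matrix.cons_val_one]
    ring
  rw [hle]
  refine (goodMoment_sum_le hμ.1 K n δ γ ρ Finset.univ fun (i : Fin 2) c =>
    ![tailDeviation μ p (lineageAt c b) ((lineageAt c b).length - q c),
      -tailDeviation μ p (lineageAt c a) ((lineageAt c a).length - q c)] i).trans ?_
  rw [Fin.sum_univ_two]
  simp only [goodMoment, Matrix.cons_val_zero, Matrix.cons_val_one, abs_neg, Finset.card_univ,
    Fintype.card_fin]
  push_cast
  rw [mul_assoc, add_mul]
  exact mul_le_mul_of_nonneg_left (add_le_add hB hA) (by positivity)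

/-- The linear interpolation of `gfun`. -/
def gInterp (μ : ℕ → ℝ) (T : PlanarTree) (p : ℕ × ℕ) (x : ℝ) : ℝ :=
  gfun μ T p.1 p.2 ⌊x⌋₊ +
    (x - ⌊x⌋₊) * (gfun μ T p.1 p.2 (⌊x⌋₊ + 1) - gfun μ T p.1 p.2 ⌊x⌋₊)

/-- The moment bound for the increments of the interpolated process. -/
lemma exists_goodMoment_gInterp_sub_le {μ : ℕ → ℝ} {K : ℕ} (hμ : H1 μ K) {δ γ : ℝ} (ρ : ℝ)
    (hδ : 0 < δ) (hγ : 0 < γ) :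
    ∃ C > 0, ∀ᶠ n : ℕ in atTop, ∀ x y : ℝ, 0 ≤ x → x ≤ y → y ≤ n → ∀ p ∈ IKfin K,
      goodMoment μ K n δ γ ρ (fun c =>
        gInterp μ (toPlanarTree c) p y - gInterp μ (toPlanarTree c) p x) ≤
        C * (n ^ 10 * ((y - x) / n) ^ 2) := by
  obtain ⟨C, hC, hbound⟩ := exists_goodMoment_gfun_sub_le hμ ρ hδ hγ
  refine ⟨3 ^ 39 * C, by positivity, ?_⟩
  filter_upwards [hbound] with n hn x y hx hxy hy p hp
  have hstep : ∀ (a : ℕ) (θ : ℝ), 0 ≤ θ → θ ≤ 1 → (a < n ∨ θ = 0) →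
      goodMoment μ K n δ γ ρ (fun c => θ *
        (gfun μ (toPlanarTree c) p.1 p.2 (a + 1) - gfun μ (toPlanarTree c) p.1 p.2 a)) ≤
        C * (n ^ 10 * (θ / n) ^ 2) := by
    intro a θ h0 h1 ha
    rw [goodMoment_const_mul]
    rcases ha with ha | rfl
    · have := hn a (a + 1) (Nat.le_succ a) ha p hp
      push_cast at this
      rw [add_sub_cancel_left] at this
      have hθ : |θ| ^ 40 ≤ θ ^ 2 := by
        rw [abs_of_nonneg h0]
        exact pow_le_pow_of_le_one h0 h1 (by norm_num)
      calc |θ| ^ 40 * _ ≤ |θ| ^ 40 * (C * (n ^ 10 * (1 / n) ^ 2)) :=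
            mul_le_mul_of_nonneg_left this (by positivity)
        _ ≤ θ ^ 2 * (C * (n ^ 10 * (1 / n) ^ 2)) :=
            mul_le_mul_of_nonneg_right hθ (by positivity)
        _ = C * (n ^ 10 * (θ / n) ^ 2) := by ring
    · simp
  have hfx := Nat.floor_le hx
  have hfy := Nat.floor_le (hx.trans hxy)
  have hlx := Nat.lt_floor_add_one x
  have hly := Nat.lt_floor_add_one y
  have hend : ∀ z : ℝ, z ≤ n → 0 ≤ z → ⌊z⌋₊ < n ∨ z = ⌊z⌋₊ := by
    intro z hz hz0
    have h1 := Nat.floor_le hz0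
    rcases (Nat.floor_le_of_le hz).lt_or_eq with h | h
    · exact Or.inl h
    · rw [h] at h1 ⊢
      exact Or.inr (le_antisymm hz h1)
  have hnn : ∀ z : ℝ, 0 ≤ (n : ℝ) ^ 10 * (z / n) ^ 2 := fun z => by positivity
  rcases (Nat.floor_le_floor hxy).eq_or_lt with hxy' | hlt
  · have heq : ∀ c, gInterp μ (toPlanarTree c) p y - gInterp μ (toPlanarTree c) p x =
        (y - x) * (gfun μ (toPlanarTree c) p.1 p.2 (⌊x⌋₊ + 1) -
          gfun μ (toPlanarTree c) p.1 p.2 ⌊x⌋₊) := by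
      intro c
      rw [gInterp, gInterp, ← hxy']
      ring
    simp only [heq]
    rw [← hxy'] at hly hfy
    refine (hstep ⌊x⌋₊ (y - x) (by linarith) (by linarith) ?_).trans ?_
    · rcases hend y hy (hx.trans hxy) with h | h
      · exact Or.inl (hxy' ▸ h)
      · rw [← hxy'] at h
        exact Or.inr (by linarith)
    · have : C ≤ 3 ^ 39 * C := by nlinarith
      exact mul_le_mul_of_nonneg_right this (hnn _)
  · have hlt' : ((⌊x⌋₊ : ℝ) + 1) ≤ ⌊y⌋₊ := by exact_mod_cast hlt
    have hyn : ⌊y⌋₊ ≤ n := Nat.floor_le_of_le hy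
    have heq : ∀ c, gInterp μ (toPlanarTree c) p y - gInterp μ (toPlanarTree c) p x =
        ∑ i : Fin 3,
          ![(⌊x⌋₊ + 1 - x) * (gfun μ (toPlanarTree c) p.1 p.2 (⌊x⌋₊ + 1) -
              gfun μ (toPlanarTree c) p.1 p.2 ⌊x⌋₊),
            gfun μ (toPlanarTree c) p.1 p.2 ⌊y⌋₊ -
              gfun μ (toPlanarTree c) p.1 p.2 (⌊x⌋₊ + 1),
            (y - ⌊y⌋₊) * (gfun μ (toPlanarTree c) p.1 p.2 (⌊y⌋₊ + 1) -
              gfun μ (toPlanarTree c) p.1 p.2 ⌊y⌋₊)] i := by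
      intro c
      rw [gInterp, gInterp, Fin.sum_univ_three]
      simp only [Matrix.cons_val_zero, Matrix.cons_val_one, Matrix.cons_val_two, Matrix.head_cons,
        Matrix.tail_cons]
      ring
    simp only [heq]
    refine (goodMoment_sum_le hμ.1 K n δ γ ρ Finset.univ fun (i : Fin 3) c =>
      ![(⌊x⌋₊ + 1 - x) * (gfun μ (toPlanarTree c) p.1 p.2 (⌊x⌋₊ + 1) -
              gfun μ (toPlanarTree c) p.1 p.2 ⌊x⌋₊),
            gfun μ (toPlanarTree c) p.1 p.2 ⌊y⌋₊ -
              gfun μ (toPlanarTree c) p.1 p.2 (⌊x⌋₊ + 1),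
            (y - ⌊y⌋₊) * (gfun μ (toPlanarTree c) p.1 p.2 (⌊y⌋₊ + 1) -
              gfun μ (toPlanarTree c) p.1 p.2 ⌊y⌋₊)] i).trans ?_
    rw [Fin.sum_univ_three]
    simp only [Matrix.cons_val_zero, Matrix.cons_val_one, Matrix.cons_val_two, Matrix.head_cons,
      Matrix.tail_cons, Finset.card_univ, Fintype.card_fin]
    push_cast
    have h1 := hstep ⌊x⌋₊ (⌊x⌋₊ + 1 - x) (by linarith) (by linarith) (Or.inl (by omega))
    have h2 := hn (⌊x⌋₊ + 1) ⌊y⌋₊ hlt hyn p hp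
    have h3 := hstep ⌊y⌋₊ (y - ⌊y⌋₊) (by linarith) (by linarith)
      ((hend y hy (hx.trans hxy)).imp id fun h => by linarith)
    push_cast at h2
    rw [mul_assoc]
    refine mul_le_mul_of_nonneg_left ((add_le_add (add_le_add h1 h2) h3).trans ?_) (by positivity)
    rw [← mul_add, ← mul_add, ← mul_add, ← mul_add]
    refine mul_le_mul_of_nonneg_left (mul_le_mul_of_nonneg_left ?_ (by positivity)) hC.le
    simp only [div_pow]
    rw [← add_div, ← add_div]
    refine div_le_div_of_nonneg_right ?_ (by positivity)
    have e1 : 0 ≤ (⌊x⌋₊ : ℝ) + 1 - x := by linarith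
    have e2 : 0 ≤ (⌊y⌋₊ : ℝ) - (⌊x⌋₊ + 1) := by linarith
    have e3 : 0 ≤ y - ⌊y⌋₊ := by linarith
    nlinarith [mul_nonneg e1 e2, mul_nonneg e1 e3, mul_nonneg e2 e3]

lemma Gn_sub_Gn (μ : ℕ → ℝ) (T : PlanarTree) (n : ℕ) (p : ℕ × ℕ) (s t : ℝ) :
    Gn μ T n p.1 p.2 s - Gn μ T n p.1 p.2 t =
      ((n : ℝ) ^ (1 / 4 : ℝ))⁻¹ * (gInterp μ T p (n * s) - gInterp μ T p (n * t)) := by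
  rw [Gn, Gn, gInterp, gInterp, ← sub_div, inv_mul_eq_div]

lemma condExpect_eq_goodMoment {μ : ℕ → ℝ} (K n : ℕ) (δ γ ρ : ℝ) (s t : ℝ) :
    condExpect μ n (fun T =>
        (∑ p : IK K, |Gn μ T n p.val.1 p.val.2 s - Gn μ T n p.val.1 p.val.2 t|) ^ (40 : ℝ) *
          (if T ∈ Omega μ K n (2 / 5) δ γ ρ then 1 else 0)) =
      goodMoment μ K n δ γ ρ (fun c => ∑ p : IK K, |((n : ℝ) ^ (1 / 4 : ℝ))⁻¹ *
        (gInterp μ (toPlanarTree c) p.val (n * s) - gInterp μ (toPlanarTree c) p.val (n * t))|) := by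
  rw [condExpect_eq, goodMoment, treeMean]
  congr 1
  refine Finset.sum_congr rfl fun c _ => ?_
  congr 1
  have h40 : (40 : ℝ) = ((40 : ℕ) : ℝ) := by norm_num
  simp only [Gn_sub_Gn, mul_ite, mul_one, mul_zero, h40, Real.rpow_natCast]
  rw [abs_of_nonneg (Finset.sum_nonneg fun _ _ => abs_nonneg _)]

/-- Assume (H1).  Let `ε > 0` and `δ, γ, ρ > 0` be such that
`P_n(Ω_ε) ≥ 1 - ε` for `n` large, where `Ω_ε = Ω_n^{2/5,δ,γ,ρ}`.  Then there exist
`a, β, c > 0` such that, for `n` large enough, for all `s, t ∈ [0,1]`,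
`E_{P_n}(‖G^{(n)}(s) - G^{(n)}(t)‖₁^β 1_{Ω_ε}) ≤ c |t-s|^{1+a}`. -/
theorem statement17
    (μ : ℕ → ℝ) (K : ℕ) (hμ : H1 μ K)
    (ε δ γ ρ : ℝ) (hε : 0 < ε) (hδ : 0 < δ) (hγ : 0 < γ) (hρ : 0 < ρ)
    (hΩ : ∀ᶠ n : ℕ in atTop, 1 - ε ≤ condProb μ n (Omega μ K n (2 / 5) δ γ ρ)) :
    ∃ a > (0 : ℝ), ∃ β > (0 : ℝ), ∃ c > (0 : ℝ), ∀ᶠ n : ℕ in atTop,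
      ∀ s ∈ Set.Icc (0 : ℝ) 1, ∀ t ∈ Set.Icc (0 : ℝ) 1,
        condExpect μ n
          (fun T =>
            (∑ p : IK K, |Gn μ T n p.val.1 p.val.2 s - Gn μ T n p.val.1 p.val.2 t|) ^ β *
              (if T ∈ Omega μ K n (2 / 5) δ γ ρ then 1 else 0))
          ≤ c * |t - s| ^ (1 + a) := by
  obtain ⟨C, hC, hbound⟩ := exists_goodMoment_gInterp_sub_le hμ ρ hδ hγ
  refine ⟨1, one_pos, 40, by norm_num,
    (Fintype.card (IK K) : ℝ) ^ 39 * (Fintype.card (IK K) * C) + 1, by positivity, ?_⟩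
  filter_upwards [hbound, eventually_ge_atTop 1] with n hn hn1 s hs t ht
  have hnpos : (0 : ℝ) < n := by exact_mod_cast hn1
  have h10 : |((n : ℝ) ^ (1 / 4 : ℝ))⁻¹| ^ 40 * (n : ℝ) ^ 10 = 1 := by
    rw [abs_of_pos (by positivity), inv_pow, ← Real.rpow_natCast ((n : ℝ) ^ (1 / 4 : ℝ)),
      ← Real.rpow_mul hnpos.le,
      show (1 / 4 : ℝ) * ((40 : ℕ) : ℝ) = ((10 : ℕ) : ℝ) by norm_num, Real.rpow_natCast,
      inv_mul_cancel₀ (by positivity)]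
  have hpair : ∀ p : IK K, goodMoment μ K n δ γ ρ (fun c => |((n : ℝ) ^ (1 / 4 : ℝ))⁻¹ *
      (gInterp μ (toPlanarTree c) p.val (n * s) - gInterp μ (toPlanarTree c) p.val (n * t))|) ≤
      C * |t - s| ^ 2 := by
    intro p
    have hord : ∀ x y : ℝ, 0 ≤ x → x ≤ y → y ≤ 1 →
        goodMoment μ K n δ γ ρ (fun c => ((n : ℝ) ^ (1 / 4 : ℝ))⁻¹ *
          (gInterp μ (toPlanarTree c) p.val (n * y) - gInterp μ (toPlanarTree c) p.val (n * x))) ≤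
        C * |y - x| ^ 2 := by
      intro x y hx hxy hy
      have := hn (n * x) (n * y) (by positivity) (by gcongr) (by nlinarith) p.val p.property
      rw [← mul_sub, mul_div_cancel_left₀ _ hnpos.ne'] at this
      rw [goodMoment_const_mul, sq_abs]
      calc _ ≤ |((n : ℝ) ^ (1 / 4 : ℝ))⁻¹| ^ 40 * (C * (n ^ 10 * (y - x) ^ 2)) :=
            mul_le_mul_of_nonneg_left this (by positivity)
        _ = C * (|((n : ℝ) ^ (1 / 4 : ℝ))⁻¹| ^ 40 * n ^ 10) * (y - x) ^ 2 := by ring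
        _ = C * (y - x) ^ 2 := by rw [h10, mul_one]
    rcases le_total s t with hst | hst
    · refine le_of_eq_of_le (goodMoment_congr hμ.1 fun c _ _ => ?_) (hord s t hs.1 hst ht.2)
      rw [abs_abs, abs_mul, abs_mul, abs_sub_comm]
    · rw [abs_sub_comm t s]
      refine le_of_eq_of_le (goodMoment_congr hμ.1 fun c _ _ => ?_) (hord t s ht.1 hst hs.2)
      rw [abs_abs]
  rw [condExpect_eq_goodMoment]
  refine (goodMoment_sum_le hμ.1 K n δ γ ρ Finset.univ fun (p : IK K) c =>
    |((n : ℝ) ^ (1 / 4 : ℝ))⁻¹ * (gInterp μ (toPlanarTree c) p.val (n * s) -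
      gInterp μ (toPlanarTree c) p.val (n * t))|).trans ?_
  have h2 : |t - s| ^ (1 + 1 : ℝ) = |t - s| ^ 2 := by
    rw [show (1 + 1 : ℝ) = ((2 : ℕ) : ℝ) by norm_num, Real.rpow_natCast]
  rw [h2]
  calc _ ≤ (Fintype.card (IK K) : ℝ) ^ 39 * ∑ _p : IK K, C * |t - s| ^ 2 :=
        mul_le_mul_of_nonneg_left (Finset.sum_le_sum fun p _ => hpair p) (by positivity)
    _ = (Fintype.card (IK K) : ℝ) ^ 39 * (Fintype.card (IK K) * C) * |t - s| ^ 2 := by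
        rw [Finset.sum_const, Finset.card_univ, nsmul_eq_mul]
        ring
    _ ≤ _ := by
        rw [add_mul]
        linarith [sq_nonneg |t - s|]

end
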